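/- (Caviglia–De Stefani) Let I ⊆ A = K[x_1,…,x_n] be a homogeneous ideal containing a regular sequence of homogeneous elements of degree a = (a_1,…,a_r), and assume a_i ≥ Σ_{j=1}^{i−1} (a_j − 1) for all i ≥ 3. Then I satisfies EGH_a. -/

import Mathlib

open MvPolynomial

section Defs

variable {K : Type*} [Field K]

/-- Total degree of an exponent vector. -/
def expDeg {n : ℕ} (m : Fin n →₀ ℕ) : ℕ := ∑ i, m i

/-- `lexLe m m'` means `m ≤ m'` in the lexicographic order with `x_1 > x_2 > … > x_n`. -/
def lexLe {n : ℕ} (m m' : Fin n →₀ ℕ) : Prop :=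
  m = m' ∨ ∃ i : Fin n, (∀ j : Fin n, j < i → m j = m' j) ∧ m i < m' i

/-- A lex-segment in degree `d`: an upward (w.r.t. lex) closed set of degree-`d`
exponent vectors. -/
def IsLexSegment (n d : ℕ) (S : Set (Fin n →₀ ℕ)) : Prop :=
  (∀ m ∈ S, expDeg m = d) ∧
    ∀ m ∈ S, ∀ m' : Fin n →₀ ℕ, expDeg m' = d → lexLe m m' → m' ∈ S

/-- The pure-powers ideal `(x_1^{a_1}, …, x_r^{a_r})`. -/
noncomputable def purePowers (K : Type*) [Field K] {n r : ℕ} (hrn : r ≤ n)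
    (a : Fin r → ℕ) : Ideal (MvPolynomial (Fin n) K) :=
  Ideal.span (Set.range fun i : Fin r => X (Fin.castLE hrn i) ^ a i)

/-- A homogeneous ideal. -/
def IsHomog {n : ℕ} (I : Ideal (MvPolynomial (Fin n) K)) : Prop :=
  ∀ f ∈ I, ∀ d : ℕ, homogeneousComponent d f ∈ I

/-- The degree-`d` component of an ideal, as a `K`-subspace. -/
noncomputable def component {n : ℕ} (I : Ideal (MvPolynomial (Fin n) K)) (d : ℕ) :
    Submodule K (MvPolynomial (Fin n) K) :=
  Submodule.restrictScalars K I ⊓ homogeneousSubmodule (Fin n) K d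

/-- Hilbert function of an ideal: `dim_K I_d`. -/
noncomputable def hilb {n : ℕ} (I : Ideal (MvPolynomial (Fin n) K)) (d : ℕ) : ℕ :=
  Module.finrank K ↥(component I d)

/-- An `a`-lpp (lex-plus-powers) ideal: a homogeneous (monomial) ideal each of whose graded
components is the span of a lex-segment plus the corresponding component of the
pure-powers ideal. -/
def IsLPP {n r : ℕ} (hrn : r ≤ n) (a : Fin r → ℕ)
    (J : Ideal (MvPolynomial (Fin n) K)) : Prop :=
  IsHomog J ∧
    ∀ d : ℕ, ∃ S : Set (Fin n →₀ ℕ), IsLexSegment n d S ∧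
      component J d =
        Submodule.span K ((fun m => (monomial m (1 : K) : MvPolynomial (Fin n) K)) '' S)
          ⊔ component (purePowers K hrn a) d

/-- `I` satisfies `EGH_a(d)`. -/
def EGHd {n r : ℕ} (hrn : r ≤ n) (a : Fin r → ℕ)
    (I : Ideal (MvPolynomial (Fin n) K)) (d : ℕ) : Prop :=
  ∃ J : Ideal (MvPolynomial (Fin n) K), IsLPP hrn a J ∧
    hilb J d = hilb I d ∧ hilb J (d + 1) ≤ hilb I (d + 1)

/-- `I` satisfies `EGH_a`. -/
def EGH {n r : ℕ} (hrn : r ≤ n) (a : Fin r → ℕ)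
    (I : Ideal (MvPolynomial (Fin n) K)) : Prop :=
  ∀ d : ℕ, EGHd hrn a I d

/-- A monomial ideal. -/
def IsMonomialIdeal {n : ℕ} (I : Ideal (MvPolynomial (Fin n) K)) : Prop :=
  ∃ M : Set (Fin n →₀ ℕ),
    I = Ideal.span ((fun m => (monomial m (1 : K) : MvPolynomial (Fin n) K)) '' M)

/-- A strongly stable (monomial) ideal. -/
def IsStronglyStable {n : ℕ} (S : Ideal (MvPolynomial (Fin n) K)) : Prop :=
  IsMonomialIdeal S ∧
    ∀ (m : Fin n →₀ ℕ) (i j : Fin n), j ≤ i →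
      (monomial (m + Finsupp.single i 1) (1 : K) : MvPolynomial (Fin n) K) ∈ S →
      (monomial (m + Finsupp.single j 1) (1 : K) : MvPolynomial (Fin n) K) ∈ S

/-- An `a`-spp (strongly-stable-plus-powers) ideal. -/
def IsSPP {n r : ℕ} (hrn : r ≤ n) (a : Fin r → ℕ)
    (J : Ideal (MvPolynomial (Fin n) K)) : Prop :=
  ∃ S : Ideal (MvPolynomial (Fin n) K), IsStronglyStable S ∧ J = S ⊔ purePowers K hrn a

/-- A regular sequence: each `f i` is a non-zerodivisor modulo `(f j : j < i)`. -/
def IsRegSeq {n r : ℕ} (f : Fin r → MvPolynomial (Fin n) K) : Prop :=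
  ∀ i : Fin r, ∀ g : MvPolynomial (Fin n) K,
    g * f i ∈ Ideal.span { p | ∃ j : Fin r, j < i ∧ p = f j } →
    g ∈ Ideal.span { p | ∃ j : Fin r, j < i ∧ p = f j }

/-- `I` contains a homogeneous regular sequence of degree `a`. -/
def ContainsRegSeq {n r : ℕ} (a : Fin r → ℕ)
    (I : Ideal (MvPolynomial (Fin n) K)) : Prop :=
  ∃ f : Fin r → MvPolynomial (Fin n) K,
    (∀ i, f i ∈ I) ∧ IsRegSeq f ∧ ∀ i, (f i).IsHomogeneous (a i)

/-- `dim_K (N/P)` for ideals `P ≤ N` (the `K`-dimension of `N/(N ∩ P)`). -/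
noncomputable def quotDim (K : Type*) [Field K] {n : ℕ}
    (N P : Ideal (MvPolynomial (Fin n) K)) : ℕ :=
  Module.finrank K
    (↥(Submodule.restrictScalars K N) ⧸
      Submodule.comap (Submodule.restrictScalars K N).subtype (Submodule.restrictScalars K P))

/-- `dim_K (I/F)_d`. -/
noncomputable def relHilb {n : ℕ} (I F : Ideal (MvPolynomial (Fin n) K)) (d : ℕ) : ℕ :=
  Module.finrank K
    (↥(component I d) ⧸ Submodule.comap (component I d).subtype (Submodule.restrictScalars K F))

/-- `dim_K (A/I)_d`. -/
noncomputable def hilbQ {n : ℕ} (I : Ideal (MvPolynomial (Fin n) K)) (d : ℕ) : ℕ :=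
  Module.finrank K
    (↥(homogeneousSubmodule (Fin n) K d) ⧸
      Submodule.comap (homogeneousSubmodule (Fin n) K d).subtype (Submodule.restrictScalars K I))

end Defs

namespace CavigliaDeStefani

open Finset

section Tops

variable {α β γ : Type*} [LinearOrder β]

/-- `S` is an upper set of `X` with respect to the key `κ`. -/
def IsTop (κ : α → β) (X S : Finset α) : Prop :=
  S ⊆ X ∧ ∀ x ∈ S, ∀ y ∈ X, κ x ≤ κ y → y ∈ S

theorem IsTop.subset_or {κ : α → β} {X S T : Finset α} (hS : IsTop κ X S) (hT : IsTop κ X T) :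
    S ⊆ T ∨ T ⊆ S := by
  by_contra! h
  obtain ⟨x, hx, hx'⟩ := Finset.not_subset.1 h.1
  obtain ⟨y, hy, hy'⟩ := Finset.not_subset.1 h.2
  rcases le_total (κ x) (κ y) with h | h
  · exact hy' (hS.2 x hx y (hT.1 hy) h)
  · exact hx' (hT.2 y hy x (hS.1 hx) h)

theorem isTop_empty (κ : α → β) (X : Finset α) : IsTop κ X ∅ :=
  ⟨empty_subset _, by simp⟩

variable [DecidableEq α] [DecidableEq γ]

theorem IsTop.union {κ : α → β} {X S T : Finset α} (hS : IsTop κ X S) (hT : IsTop κ X T) :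
    IsTop κ X (S ∪ T) := by
  refine ⟨union_subset hS.1 hT.1, fun x hx y hy h => ?_⟩
  rcases mem_union.1 hx with hx | hx
  · exact mem_union_left _ (hS.2 x hx y hy h)
  · exact mem_union_right _ (hT.2 x hx y hy h)

theorem IsTop.card_union {κ : α → β} {X S T : Finset α} (hS : IsTop κ X S) (hT : IsTop κ X T) :
    (S ∪ T).card = max S.card T.card := by
  rcases hS.subset_or hT with h | h
  · rw [union_eq_right.2 h, max_eq_right (card_le_card h)]
  · rw [union_eq_left.2 h, max_eq_left (card_le_card h)]

theorem exists_isTop (κ : α → β) (X : Finset α) (hκ : Set.InjOn κ X) {k : ℕ} (hk : k ≤ X.card) :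
    ∃ S, IsTop κ X S ∧ S.card = k := by
  induction k with
  | zero => exact ⟨∅, isTop_empty _ _, card_empty⟩
  | succ k ih =>
    obtain ⟨S, hS, hc⟩ := ih (by omega)
    have hne : (X \ S).Nonempty := by
      rw [← card_pos, card_sdiff_of_subset hS.1]; omega
    obtain ⟨m, hm, hmax⟩ := exists_max_image (X \ S) κ hne
    rw [mem_sdiff] at hm
    refine ⟨insert m S, ⟨insert_subset hm.1 hS.1, fun x hx y hy hxy => ?_⟩,
      by rw [card_insert_of_notMem hm.2, hc]⟩
    rcases mem_insert.1 hx with rfl | hx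
    · by_cases hyS : y ∈ S
      · exact mem_insert_of_mem hyS
      · rw [hκ hy hm.1 (le_antisymm (hmax y (by simp [hy, hyS])) hxy)]
        exact mem_insert_self _ _
    · exact mem_insert_of_mem (hS.2 x hx y hy hxy)

theorem card_le_card_of_fibers {S T : Finset α} (φ : α → γ)
    (h : ∀ c, (S.filter (φ · = c)).card ≤ (T.filter (φ · = c)).card) : S.card ≤ T.card := by
  rw [card_eq_sum_card_image φ S]
  calc ∑ c ∈ S.image φ, (S.filter (φ · = c)).card
      ≤ ∑ c ∈ S.image φ, (T.filter (φ · = c)).card := sum_le_sum fun c _ => h c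
    _ = ((S.image φ).biUnion fun c => T.filter (φ · = c)).card := by
        rw [card_biUnion]
        intro c _ c' _ hcc
        rw [Function.onFun, disjoint_left]
        intro x hx hx'
        exact hcc ((mem_filter.1 hx).2.symm.trans (mem_filter.1 hx').2)
    _ ≤ T.card := card_le_card (by
        intro x hx
        obtain ⟨c, _, hc⟩ := mem_biUnion.1 hx
        exact (mem_filter.1 hc).1)

theorem card_eq_card_of_fibers {S T : Finset α} (φ : α → γ)
    (h : ∀ c, (S.filter (φ · = c)).card = (T.filter (φ · = c)).card) : S.card = T.card :=
  (card_le_card_of_fibers φ fun c => (h c).le).antisymm (card_le_card_of_fibers φ fun c => (h c).ge)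

theorem exists_compression (κ : α → β) (φ : α → γ) {X S : Finset α} (hSX : S ⊆ X)
    (hκ : ∀ x ∈ X, ∀ y ∈ X, φ x = φ y → κ x = κ y → x = y) :
    ∃ S', S' ⊆ X ∧ ∀ c, (S'.filter (φ · = c)).card = (S.filter (φ · = c)).card ∧
      IsTop κ (X.filter (φ · = c)) (S'.filter (φ · = c)) := by
  have h : ∀ c, ∃ U, IsTop κ (X.filter (φ · = c)) U ∧ U.card = (S.filter (φ · = c)).card := by
    intro c
    refine exists_isTop κ _ ?_ (card_le_card (filter_subset_filter _ hSX))
    intro x hx y hy hxy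
    simp only [coe_filter, Set.mem_ofPred_eq] at hx hy
    exact hκ x hx.1 y hy.1 (hx.2.trans hy.2.symm) hxy
  choose U hU hUc using h
  have key : ∀ c, ((X.image φ).biUnion U).filter (φ · = c) = U c := by
    intro c
    ext x
    simp only [mem_filter, mem_biUnion, mem_image]
    constructor
    · rintro ⟨⟨c', -, hx⟩, rfl⟩
      have := (mem_filter.1 ((hU c').1 hx)).2
      rwa [this]
    · intro hx
      have := mem_filter.1 ((hU c).1 hx)
      exact ⟨⟨c, ⟨x, this.1, this.2⟩, hx⟩, this.2⟩
  refine ⟨(X.image φ).biUnion U, ?_, fun c => ?_⟩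
  · intro x hx
    obtain ⟨c, _, hc⟩ := mem_biUnion.1 hx
    exact (mem_filter.1 ((hU c).1 hc)).1
  · rw [key]; exact ⟨hUc c, hU c⟩

theorem IsTop.sum_le {κ : α → ℕ} {X A T : Finset α} (hT : IsTop κ X T) (hA : A ⊆ X)
    (hc : A.card = T.card) :
    ∑ x ∈ A, κ x ≤ ∑ x ∈ T, κ x ∧ (∑ x ∈ A, κ x = ∑ x ∈ T, κ x → A = T) := by
  rcases Finset.eq_empty_or_nonempty (T \ A) with h0 | hne
  · have : A = T := (eq_of_subset_of_card_le (sdiff_eq_empty_iff_subset.1 h0) hc.le).symm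
    exact ⟨by rw [this], fun _ => this⟩
  · obtain ⟨t, ht, hmin⟩ := exists_min_image (T \ A) κ hne
    have hcard : (A \ T).card = (T \ A).card := card_sdiff_comm hc
    have h1 : ∀ x ∈ A \ T, κ x ≤ κ t - 1 ∧ 0 < κ t := by
      intro x hx
      rw [mem_sdiff] at hx ht
      have : κ x < κ t := by
        by_contra! h
        exact hx.2 (hT.2 t ht.1 x (hA hx.1) h)
      omega
    have hAs : ∑ x ∈ A, κ x = ∑ x ∈ A ∩ T, κ x + ∑ x ∈ A \ T, κ x :=
      (sum_inter_add_sum_sdiff A T κ).symm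
    have hTs : ∑ x ∈ T, κ x = ∑ x ∈ A ∩ T, κ x + ∑ x ∈ T \ A, κ x := by
      rw [inter_comm]; exact (sum_inter_add_sum_sdiff T A κ).symm
    have h2 : ∑ x ∈ A \ T, κ x ≤ (A \ T).card * (κ t - 1) := by
      rw [← smul_eq_mul]; exact sum_le_card_nsmul _ _ _ fun x hx => (h1 x hx).1
    have h3 : (T \ A).card * κ t ≤ ∑ x ∈ T \ A, κ x := by
      rw [← smul_eq_mul]; exact card_nsmul_le_sum _ _ _ hmin
    have h4 : 0 < (T \ A).card := card_pos.2 hne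
    obtain ⟨x, hx⟩ : (A \ T).Nonempty := by rw [← card_pos, hcard]; exact h4
    have h5 := (h1 x hx).2
    have h6 : (T \ A).card * (κ t - 1) < (T \ A).card * κ t := by
      apply Nat.mul_lt_mul_of_pos_left <;> omega
    rw [hcard] at h2
    exact ⟨by omega, fun h => by omega⟩

end Tops

section Boxes

variable {n : ℕ}

/-- Exponent vectors bounded strictly by `b`. -/
def InBox (b : Fin n → ℕ∞) (m : Fin n →₀ ℕ) : Prop := ∀ i, (m i : ℕ∞) < b i

theorem InBox.mono {b : Fin n → ℕ∞} {m m' : Fin n →₀ ℕ} (h : InBox b m') (hm : m ≤ m') :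
    InBox b m := fun i => lt_of_le_of_lt (by exact_mod_cast hm i) (h i)

@[simp] theorem expDeg_add (m m' : Fin n →₀ ℕ) : expDeg (m + m') = expDeg m + expDeg m' := by
  simp [expDeg, sum_add_distrib]

@[simp] theorem expDeg_single (i : Fin n) (k : ℕ) : expDeg (Finsupp.single i k) = k := by
  simp [expDeg, Finsupp.single_apply]

@[simp] theorem expDeg_zero : expDeg (0 : Fin n →₀ ℕ) = 0 := by simp [expDeg]

theorem expDeg_eq_degree (m : Fin n →₀ ℕ) : expDeg m = m.degree := by
  rw [Finsupp.degree_eq_sum]; rfl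

theorem expDeg_mono {m m' : Fin n →₀ ℕ} (h : m ≤ m') : expDeg m ≤ expDeg m' :=
  sum_le_sum fun i _ => h i

theorem eq_of_le_of_expDeg {m m' : Fin n →₀ ℕ} (h : m ≤ m') (hd : expDeg m' ≤ expDeg m) :
    m = m' := by
  ext i
  by_contra hne
  have : expDeg m < expDeg m' :=
    sum_lt_sum (fun i _ => h i) ⟨i, mem_univ _, lt_of_le_of_ne (h i) hne⟩
  omega

open scoped Classical in
/-- The exponent vectors in the box `b` of degree `d`. -/
noncomputable def box (b : Fin n → ℕ∞) (d : ℕ) : Finset (Fin n →₀ ℕ) :=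
  (univ.finsuppAntidiag d).filter (InBox b)

@[simp] theorem mem_box {b : Fin n → ℕ∞} {d : ℕ} {m : Fin n →₀ ℕ} :
    m ∈ box b d ↔ expDeg m = d ∧ InBox b m := by
  simp [box, mem_finsuppAntidiag, expDeg]

open scoped Classical in
/-- The upper shadow inside the box `b`. -/
noncomputable def up (b : Fin n → ℕ∞) (S : Finset (Fin n →₀ ℕ)) : Finset (Fin n →₀ ℕ) :=
  ((S ×ˢ univ).image fun p => p.1 + Finsupp.single p.2 1).filter (InBox b)

theorem mem_up {b : Fin n → ℕ∞} {S : Finset (Fin n →₀ ℕ)} {w : Fin n →₀ ℕ} :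
    w ∈ up b S ↔ InBox b w ∧ ∃ m ∈ S, ∃ i, w = m + Finsupp.single i 1 := by
  simp only [up, mem_filter, mem_image, mem_product, mem_univ, and_true, Prod.exists]
  constructor
  · rintro ⟨⟨m, i, hm, rfl⟩, h⟩; exact ⟨h, m, hm, i, rfl⟩
  · rintro ⟨h, m, hm, i, rfl⟩; exact ⟨⟨m, i, hm, rfl⟩, h⟩

theorem up_mono {b : Fin n → ℕ∞} {S T : Finset (Fin n →₀ ℕ)} (h : S ⊆ T) : up b S ⊆ up b T := by
  intro w
  simp only [mem_up]
  rintro ⟨hw, m, hm, hi⟩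
  exact ⟨hw, m, h hm, hi⟩

theorem up_subset_box {b : Fin n → ℕ∞} {d : ℕ} {S : Finset (Fin n →₀ ℕ)} (h : S ⊆ box b d) :
    up b S ⊆ box b (d + 1) := by
  intro w hw
  obtain ⟨hw, m, hm, i, rfl⟩ := mem_up.1 hw
  simp [(mem_box.1 (h hm)).1, hw]

/-- A lex-upper subset of the degree `d` part of the box. -/
abbrev LexTop (b : Fin n → ℕ∞) (d : ℕ) (S : Finset (Fin n →₀ ℕ)) : Prop :=
  IsTop (toLex : (Fin n →₀ ℕ) → Lex (Fin n →₀ ℕ)) (box b d) S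

theorem toLex_lt_iff {m m' : Fin n →₀ ℕ} :
    toLex m < toLex m' ↔ ∃ i, (∀ j < i, m j = m' j) ∧ m i < m' i := Finsupp.Lex.lt_iff

theorem lexLe_iff {m m' : Fin n →₀ ℕ} : lexLe m m' ↔ toLex m ≤ toLex m' := by
  rw [le_iff_lt_or_eq, toLex_lt_iff, lexLe, toLex_inj, or_comm]

theorem injOn_toLex (X : Finset (Fin n →₀ ℕ)) :
    Set.InjOn (toLex : (Fin n →₀ ℕ) → Lex (Fin n →₀ ℕ)) X := toLex.injective.injOn

theorem exists_last {m : Fin n →₀ ℕ} (h : 0 < expDeg m) :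
    ∃ l, 0 < m l ∧ ∀ j, l < j → m j = 0 := by
  have hne : m.support.Nonempty := by
    rw [Finsupp.support_nonempty_iff]
    rintro rfl
    simp at h
  refine ⟨m.support.max' hne, ?_, fun j hj => ?_⟩
  · exact Nat.pos_of_ne_zero (Finsupp.mem_support_iff.1 (m.support.max'_mem hne))
  · by_contra h0
    exact absurd (m.support.le_max' j (Finsupp.mem_support_iff.2 h0)) (not_le.2 hj)

theorem sub_single_add {m : Fin n →₀ ℕ} {l : Fin n} (h : 0 < m l) :
    m - Finsupp.single l 1 + Finsupp.single l 1 = m := by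
  ext j
  simp only [Finsupp.add_apply, Finsupp.tsub_apply, Finsupp.single_apply]
  split_ifs with hj
  · subst hj; omega
  · simp

theorem toLex_le_sub_last {m w : Fin n →₀ ℕ} {i l : Fin n} (hd : expDeg w = expDeg m + 1)
    (hle : toLex (m + Finsupp.single i 1) ≤ toLex w) (hl : 0 < w l) (hlast : ∀ j, l < j → w j = 0) :
    toLex m ≤ toLex (w - Finsupp.single l 1) := by
  have hwl := sub_single_add hl
  set v := w - Finsupp.single l 1 with hv
  have hvl : ∀ j, l < j → v j = 0 := fun j hj => by
    have := hlast j hj; rw [hv]; simp [this]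
  have hdv : expDeg v = expDeg m := by
    have := congrArg expDeg hwl; simp at this; omega
  by_contra! hlt
  obtain ⟨k, hk, hk'⟩ := toLex_lt_iff.1 hlt
  have hkl : k < l := by
    by_contra! hlk
    have : expDeg v < expDeg m := by
      refine sum_lt_sum (fun j _ => ?_) ⟨k, mem_univ _, hk'⟩
      rcases lt_trichotomy j k with h | rfl | h
      · exact (hk j h).le
      · exact hk'.le
      · rw [hvl j (lt_of_le_of_lt hlk h)]; exact Nat.zero_le _
    omega
  have hw : ∀ j, j < l → w j = v j := fun j hj => by
    rw [← hwl]; simp [hj.ne']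
  refine absurd hle (not_le.2 ?_)
  rcases lt_or_ge i k with hik | hki
  · refine toLex_lt_iff.2 ⟨i, fun j hj => ?_, ?_⟩
    · rw [hw j (hj.trans (hik.trans hkl)), hk j (hj.trans hik)]; simp [hj.ne']
    · rw [hw i (hik.trans hkl), hk i hik]; simp
  · refine toLex_lt_iff.2 ⟨k, fun j hj => ?_, ?_⟩
    · rw [hw j (hj.trans hkl), hk j hj]
      simp [(lt_of_lt_of_le hj hki).ne']
    · rw [hw k hkl]
      simp only [Finsupp.add_apply]
      omega

theorem LexTop.up {b : Fin n → ℕ∞} {d : ℕ} {S : Finset (Fin n →₀ ℕ)} (h : LexTop b d S) :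
    LexTop b (d + 1) (up b S) := by
  refine ⟨up_subset_box h.1, fun x hx w hw hxw => ?_⟩
  obtain ⟨_, m, hm, i, rfl⟩ := mem_up.1 hx
  rw [mem_box] at hw
  obtain ⟨l, hl, hlast⟩ := exists_last (m := w) (by omega)
  have hmd := (mem_box.1 (h.1 hm)).1
  have hle := toLex_le_sub_last (by omega) hxw hl hlast
  have hwl := sub_single_add hl
  refine mem_up.2 ⟨hw.2, w - Finsupp.single l 1, h.2 m hm _ ?_ hle, l, hwl.symm⟩
  rw [mem_box]
  refine ⟨?_, hw.2.mono tsub_le_self⟩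
  have := congrArg expDeg hwl; simp at this; omega

/-- The Clements–Lindström property of the box `b`. -/
def CL (b : Fin n → ℕ∞) : Prop :=
  ∀ (d : ℕ) (S T : Finset (Fin n →₀ ℕ)), S ⊆ box b d → LexTop b d T → T.card ≤ S.card →
    (up b T).card ≤ (up b S).card

end Boxes

end CavigliaDeStefani

namespace CavigliaDeStefani

open Finset

section Dehomogenized

variable {n : ℕ}

/-- The exponent vectors in the box `b` of degree at most `d`. -/
noncomputable def boxLE (b : Fin n → ℕ∞) (d : ℕ) : Finset (Fin n →₀ ℕ) :=
  (range (d + 1)).biUnion (box b)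

@[simp] theorem mem_boxLE {b : Fin n → ℕ∞} {d : ℕ} {m : Fin n →₀ ℕ} :
    m ∈ boxLE b d ↔ expDeg m ≤ d ∧ InBox b m := by
  simp [boxLE]

/-- The shadow of a set of dehomogenized exponent vectors. -/
noncomputable def nab (b : Fin n → ℕ∞) (S : Finset (Fin n →₀ ℕ)) : Finset (Fin n →₀ ℕ) :=
  S ∪ up b S

theorem nab_mono {b : Fin n → ℕ∞} {S T : Finset (Fin n →₀ ℕ)} (h : S ⊆ T) : nab b S ⊆ nab b T :=
  union_subset_union h (up_mono h)

theorem nab_filter_zero (b : Fin n → ℕ∞) (S : Finset (Fin n →₀ ℕ)) :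
    (nab b S).filter (expDeg · = 0) = S.filter (expDeg · = 0) := by
  ext w
  simp only [nab, mem_filter, mem_union, mem_up]
  constructor
  · rintro ⟨h | ⟨-, m, -, i, rfl⟩, h0⟩
    · exact ⟨h, h0⟩
    · simp at h0
  · rintro ⟨h, h0⟩; exact ⟨Or.inl h, h0⟩

theorem nab_filter_succ (b : Fin n → ℕ∞) (S : Finset (Fin n →₀ ℕ)) (e : ℕ) :
    (nab b S).filter (expDeg · = e + 1) =
      S.filter (expDeg · = e + 1) ∪ up b (S.filter (expDeg · = e)) := by
  ext w
  simp only [nab, mem_filter, mem_union, mem_up]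
  constructor
  · rintro ⟨h | ⟨hw, m, hm, i, rfl⟩, h0⟩
    · exact Or.inl ⟨h, h0⟩
    · exact Or.inr ⟨hw, m, ⟨hm, by simpa using h0⟩, i, rfl⟩
  · rintro (⟨h, h0⟩ | ⟨hw, m, ⟨hm, h0⟩, i, rfl⟩)
    · exact ⟨Or.inl h, h0⟩
    · exact ⟨Or.inr ⟨hw, m, hm, i, rfl⟩, by simp [h0]⟩

theorem filter_subset_box {b : Fin n → ℕ∞} {d : ℕ} {S : Finset (Fin n →₀ ℕ)}
    (h : S ⊆ boxLE b d) (e : ℕ) : S.filter (expDeg · = e) ⊆ box b e := by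
  intro m hm
  rw [mem_filter] at hm
  exact mem_box.2 ⟨hm.2, (mem_boxLE.1 (h hm.1)).2⟩

theorem exists_degree_compression {b : Fin n → ℕ∞} (hb : CL b) {d : ℕ} {S : Finset (Fin n →₀ ℕ)}
    (hS : S ⊆ boxLE b d) :
    ∃ S' ⊆ boxLE b d, (∀ e, LexTop b e (S'.filter (expDeg · = e))) ∧
      (∀ e, (S'.filter (expDeg · = e)).card = (S.filter (expDeg · = e)).card) ∧
      (nab b S').card ≤ (nab b S).card := by
  obtain ⟨S', hS', h⟩ := exists_compression toLex expDeg hS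
    (fun x _ y _ _ hxy => toLex.injective hxy)
  have htop : ∀ e, LexTop b e (S'.filter (expDeg · = e)) := by
    intro e
    refine ⟨filter_subset_box hS' e, fun x hx y hy hxy => (h e).2.2 x hx y ?_ hxy⟩
    have hx' := mem_filter.1 hx
    have := mem_boxLE.1 (hS' hx'.1)
    have hy' := mem_box.1 hy
    exact mem_filter.2 ⟨mem_boxLE.2 ⟨by omega, hy'.2⟩, hy'.1⟩
  refine ⟨S', hS', htop, fun e => (h e).1, ?_⟩
  refine card_le_card_of_fibers expDeg fun e => ?_
  rcases e with _ | e
  · rw [nab_filter_zero, nab_filter_zero, (h 0).1]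
  · rw [nab_filter_succ, nab_filter_succ, (htop (e + 1)).card_union (htop e).up]
    refine max_le ?_ ?_
    · rw [(h (e + 1)).1]; exact card_le_card subset_union_left
    · exact (hb e _ _ (filter_subset_box hS e) (htop e) (h e).1.le).trans
        (card_le_card subset_union_right)

theorem expDeg_erase_add (i : Fin n) (m : Fin n →₀ ℕ) : expDeg (m.erase i) + m i = expDeg m := by
  conv_rhs => rw [← Finsupp.erase_add_single i m]
  simp

theorem eq_of_erase_eq {i : Fin n} {m m' : Fin n →₀ ℕ} (h : m.erase i = m'.erase i)
    (hd : expDeg m = expDeg m') : m = m' := by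
  have h1 := expDeg_erase_add i m
  have h2 := expDeg_erase_add i m'
  rw [← Finsupp.erase_add_single i m, ← Finsupp.erase_add_single i m', h]
  rw [h] at h1
  rw [show m i = m' i by omega]

theorem apply_eq_of_erase_eq {i j : Fin n} {m m' : Fin n →₀ ℕ} (h : m.erase i = m'.erase i)
    (hj : j ≠ i) : m j = m' j := by
  rw [← Finsupp.erase_ne hj, h, Finsupp.erase_ne hj]

theorem card_biUnion_le_of_isTop {α β ι : Type*} [LinearOrder β] [DecidableEq α] {κ : α → β}
    {X : Finset α} (s : Finset ι) (P : ι → Finset α) (hP : ∀ l ∈ s, IsTop κ X (P l)) {N : ℕ}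
    (hN : ∀ l ∈ s, (P l).card ≤ N) : (s.biUnion P).card ≤ N := by
  classical
  have : IsTop κ X (s.biUnion P) ∧ (s.biUnion P).card ≤ N := by
    induction s using Finset.induction_on with
    | empty => simpa using isTop_empty κ X
    | insert l s hl ih =>
      have := ih (fun l hl => hP l (mem_insert_of_mem hl)) (fun l hl => hN l (mem_insert_of_mem hl))
      have hl := hP l (mem_insert_self _ _)
      rw [biUnion_insert]
      exact ⟨hl.union this.1, by
        rw [hl.card_union this.1]; exact max_le (hN l (mem_insert_self _ _)) this.2⟩
  exact this.2

theorem card_nab_le_of_line_compression {b : Fin n → ℕ∞} {d : ℕ} {S S' : Finset (Fin n →₀ ℕ)}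
    (i : Fin n) (hS : S ⊆ boxLE b d) (hS' : S' ⊆ boxLE b d)
    (h : ∀ c, (S'.filter (Finsupp.erase i · = c)).card = (S.filter (Finsupp.erase i · = c)).card ∧
      IsTop expDeg ((boxLE b d).filter (Finsupp.erase i · = c))
        (S'.filter (Finsupp.erase i · = c))) :
    (nab b S').card ≤ (nab b S).card := by
  classical
  refine card_le_card_of_fibers (Finsupp.erase i) fun ρ => ?_
  set Y := (boxLE b (d + 1)).filter (Finsupp.erase i · = ρ) with hY
  set Z := (nab b S).filter (Finsupp.erase i · = ρ) with hZ
  let P : Fin n → Finset (Fin n →₀ ℕ) := fun l =>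
    (S'.image (· + Finsupp.single l 1)).filter fun w => InBox b w ∧ w.erase i = ρ
  have hPmem : ∀ l w, w ∈ P l ↔ (∃ m ∈ S', m + Finsupp.single l 1 = w) ∧ InBox b w ∧
      w.erase i = ρ := fun l w => by simp [P]
  -- elements of `S'` are detected by degree along a line
  have hline : ∀ m ∈ S', ∀ y ∈ boxLE b d, y.erase i = m.erase i → expDeg m ≤ expDeg y →
      y ∈ S' := by
    intro m hm y hy he hd
    exact (mem_filter.1 ((h (m.erase i)).2.2 m (by simp [hm]) y (by simp [he, mem_boxLE.1 hy])
      hd)).1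
  have hPtop : ∀ l, IsTop expDeg Y (P l) := by
    intro l
    refine ⟨fun w hw => ?_, fun x hx y hy hxy => ?_⟩
    · obtain ⟨⟨m, hm, rfl⟩, hb, he⟩ := (hPmem l w).1 hw
      have := (mem_boxLE.1 (hS' hm)).1
      simp [hY, hb, he, this]
    · obtain ⟨⟨m, hm, rfl⟩, hb, he⟩ := (hPmem l x).1 hx
      obtain ⟨hy, hye⟩ := mem_filter.1 hy
      have hy := mem_boxLE.1 hy
      have hyl : 0 < y l := by
        by_cases hl : l = i
        · subst hl
          have h1 := expDeg_erase_add l y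
          have h2 := expDeg_erase_add l (m + Finsupp.single l 1)
          rw [hye] at h1; rw [he] at h2
          simp at h2 hxy
          omega
        · rw [apply_eq_of_erase_eq (hye.trans he.symm) hl]; simp
      have hyl' := sub_single_add hyl
      have hdy : expDeg (y - Finsupp.single l 1) + 1 = expDeg y := by
        conv_rhs => rw [← hyl']
        simp
      refine (hPmem l y).2 ⟨⟨y - Finsupp.single l 1, ?_, hyl'⟩, hy.2, hye⟩
      simp only [expDeg_add, expDeg_single] at hxy
      refine hline m hm _ (mem_boxLE.2 ⟨by omega, hy.2.mono tsub_le_self⟩) ?_ (by omega)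
      have : (y - Finsupp.single l 1 + Finsupp.single l 1).erase i
        = (m + Finsupp.single l 1).erase i := by rw [hyl', hye, he]
      rw [Finsupp.erase_add, Finsupp.erase_add] at this
      exact add_right_cancel this
  let Q : Finset (Fin n →₀ ℕ) := S'.filter (Finsupp.erase i · = ρ) ∪ P i
  have hQtop : IsTop expDeg Y Q := by
    refine ⟨union_subset (fun w hw => ?_) (hPtop i).1, fun x hx y hy hxy => ?_⟩
    · obtain ⟨hw, he⟩ := mem_filter.1 hw
      have := mem_boxLE.1 (hS' hw)
      simp [hY, he, this.2]; omega
    · rcases mem_union.1 hx with hx | hx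
      · obtain ⟨hx, he⟩ := mem_filter.1 hx
        obtain ⟨hy', hye⟩ := mem_filter.1 hy
        have hy' := mem_boxLE.1 hy'
        have hx' := mem_boxLE.1 (hS' hx)
        rcases Nat.lt_or_ge d (expDeg y) with hyd | hyd
        · have h1 := expDeg_erase_add i y
          have h2 := expDeg_erase_add i x
          rw [hye] at h1; rw [he] at h2
          have hyi : 0 < y i := by omega
          have hyl' := sub_single_add hyi
          have hdy : expDeg (y - Finsupp.single i 1) + 1 = expDeg y := by
            conv_rhs => rw [← hyl']
            simp
          refine mem_union_right _ ((hPmem i y).2 ⟨⟨y - Finsupp.single i 1, ?_, hyl'⟩, hy'.2, hye⟩)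
          refine hline x hx _ (mem_boxLE.2 ⟨by omega, hy'.2.mono tsub_le_self⟩) ?_ (by omega)
          have : (y - Finsupp.single i 1 + Finsupp.single i 1).erase i = x.erase i := by
            rw [hyl', hye, he]
          rw [Finsupp.erase_add, Finsupp.erase_single, add_zero] at this
          exact this
        · exact mem_union_left _ (mem_filter.2
            ⟨hline x hx y (mem_boxLE.2 ⟨hyd, hy'.2⟩) (hye.trans he.symm) hxy, hye⟩)
      · exact mem_union_right _ ((hPtop i).2 x hx y hy hxy)
  have hSZ : S.filter (Finsupp.erase i · = ρ) ⊆ Z :=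
    filter_subset_filter _ subset_union_left
  have hPcard : ∀ l, l ≠ i → (P l).card ≤ Z.card := by
    intro l hl
    rcases (P l).eq_empty_or_nonempty with h0 | ⟨w, hw⟩
    · simp [h0]
    · obtain ⟨⟨m, hm, rfl⟩, hb, he⟩ := (hPmem l w).1 hw
      have hc := (h (m.erase i)).1
      calc (P l).card ≤ ((S'.filter (Finsupp.erase i · = m.erase i)).image
            (· + Finsupp.single l 1)).card := by
            refine card_le_card fun w hw => ?_
            obtain ⟨⟨m', hm', rfl⟩, hb', he'⟩ := (hPmem l w).1 hw
            refine mem_image.2 ⟨m', mem_filter.2 ⟨hm', ?_⟩, rfl⟩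
            rw [← he, Finsupp.erase_add, Finsupp.erase_add] at he'
            exact add_right_cancel he'
        _ ≤ (S'.filter (Finsupp.erase i · = m.erase i)).card := card_image_le
        _ = (S.filter (Finsupp.erase i · = m.erase i)).card := hc
        _ = ((S.filter (Finsupp.erase i · = m.erase i)).image (· + Finsupp.single l 1)).card :=
            (card_image_of_injective _ (add_left_injective _)).symm
        _ ≤ Z.card := by
            refine card_le_card fun w hw => ?_
            obtain ⟨m', hm', rfl⟩ := mem_image.1 hw
            obtain ⟨hmS, he'⟩ := mem_filter.1 hm'
            have hee : (m' + Finsupp.single l 1).erase i = (m + Finsupp.single l 1).erase i := by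
              rw [Finsupp.erase_add, he', Finsupp.erase_add]
            refine mem_filter.2 ⟨mem_union_right _ (mem_up.2 ⟨fun j => ?_, m', hmS, l, rfl⟩),
              hee.trans he⟩
            by_cases hj : j = i
            · subst hj
              have := (mem_boxLE.1 (hS hmS)).2 j
              simpa [hl] using this
            · rw [apply_eq_of_erase_eq hee hj]; exact hb j
  have hQcard : Q.card ≤ Z.card := by
    have hlow : ∀ w ∈ Q, expDeg w ≤ d → w ∈ S'.filter (Finsupp.erase i · = ρ) := by
      intro w hw hd
      rcases mem_union.1 hw with hw | hw
      · exact hw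
      · obtain ⟨⟨m, hm, rfl⟩, hb, he⟩ := (hPmem i w).1 hw
        refine mem_filter.2 ⟨hline m hm _ (mem_boxLE.2 ⟨hd, hb⟩) ?_ (by simp), he⟩
        rw [Finsupp.erase_add, Finsupp.erase_single, add_zero]
    by_cases hz : ∃ z ∈ Q, d < expDeg z
    · obtain ⟨z, hz, hzd⟩ := hz
      have hzY := mem_filter.1 (hQtop.1 hz)
      have hzb := mem_boxLE.1 hzY.1
      have h1 : Q ⊆ insert z (S'.filter (Finsupp.erase i · = ρ)) := by
        intro w hw
        rcases Nat.lt_or_ge d (expDeg w) with hwd | hwd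
        · have hwY := mem_filter.1 (hQtop.1 hw)
          have hwb := mem_boxLE.1 hwY.1
          rw [eq_of_erase_eq (hwY.2.trans hzY.2.symm) (by omega)]
          exact mem_insert_self _ _
        · exact mem_insert_of_mem (hlow w hw hwd)
      have h2 : (S.filter (Finsupp.erase i · = ρ)).Nonempty := by
        rw [← card_pos, ← (h ρ).1, card_pos]
        rcases mem_union.1 hz with hz | hz
        · exact ⟨z, hz⟩
        · obtain ⟨⟨m, hm, rfl⟩, hb, he⟩ := (hPmem i z).1 hz
          rw [Finsupp.erase_add, Finsupp.erase_single, add_zero] at he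
          exact ⟨m, mem_filter.2 ⟨hm, he⟩⟩
      obtain ⟨s, hs, hmax⟩ := exists_max_image _ expDeg h2
      obtain ⟨hsS, hse⟩ := mem_filter.1 hs
      have hsb := mem_boxLE.1 (hS hsS)
      have hse' : (s + Finsupp.single i 1).erase i = ρ := by
        rw [Finsupp.erase_add, Finsupp.erase_single, add_zero, hse]
      have h3 : s + Finsupp.single i 1 ∉ S.filter (Finsupp.erase i · = ρ) := by
        intro hcon
        have := hmax _ hcon
        simp at this
      have h4 : insert (s + Finsupp.single i 1) (S.filter (Finsupp.erase i · = ρ)) ⊆ Z := by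
        refine insert_subset (mem_filter.2 ⟨mem_union_right _ (mem_up.2
          ⟨fun j => ?_, s, hsS, i, rfl⟩), hse'⟩) hSZ
        by_cases hj : j = i
        · subst hj
          have h5 := expDeg_erase_add j z
          have h6 := expDeg_erase_add j s
          rw [hzY.2] at h5
          rw [hse] at h6
          refine lt_of_le_of_lt ?_ (hzb.2 j)
          simp only [Finsupp.add_apply, Finsupp.single_eq_same]
          exact_mod_cast (by omega : s j + 1 ≤ z j)
        · simpa [Finsupp.single_apply, Ne.symm hj] using hsb.2 j
      calc Q.card ≤ (insert z (S'.filter (Finsupp.erase i · = ρ))).card := card_le_card h1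
        _ ≤ (S'.filter (Finsupp.erase i · = ρ)).card + 1 := card_insert_le _ _
        _ = (insert (s + Finsupp.single i 1) (S.filter (Finsupp.erase i · = ρ))).card := by
            rw [card_insert_of_notMem h3, (h ρ).1]
        _ ≤ Z.card := card_le_card h4
    · push Not at hz
      calc Q.card ≤ (S'.filter (Finsupp.erase i · = ρ)).card :=
            card_le_card fun w hw => hlow w hw (hz w hw)
        _ = (S.filter (Finsupp.erase i · = ρ)).card := (h ρ).1
        _ ≤ Z.card := card_le_card hSZ
  let R : Fin n → Finset (Fin n →₀ ℕ) := fun l => if l = i then Q else P l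
  have hsub : (nab b S').filter (Finsupp.erase i · = ρ) ⊆ univ.biUnion R := by
    intro w hw
    obtain ⟨hw, he⟩ := mem_filter.1 hw
    rcases mem_union.1 hw with hw | hw
    · exact mem_biUnion.2 ⟨i, mem_univ _, by simp [R, Q, hw, he]⟩
    · obtain ⟨hb, m, hm, l, rfl⟩ := mem_up.1 hw
      have hwP : m + Finsupp.single l 1 ∈ P l := (hPmem l _).2 ⟨⟨m, hm, rfl⟩, hb, he⟩
      refine mem_biUnion.2 ⟨l, mem_univ _, ?_⟩
      by_cases hl : l = i
      · subst hl
        simp only [R, if_true]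
        exact mem_union_right _ hwP
      · simpa [R, hl] using hwP
  refine (card_le_card hsub).trans (card_biUnion_le_of_isTop (κ := expDeg) (X := Y) _ _
    (fun l _ => ?_) fun l _ => ?_)
  · by_cases hl : l = i
    · simpa [R, hl] using hQtop
    · simpa [R, hl] using hPtop l
  · by_cases hl : l = i
    · simpa [R, hl] using hQcard
    · simpa [R, hl] using hPcard l hl

end Dehomogenized

end CavigliaDeStefani

namespace CavigliaDeStefani

open Finset

section CombinatorialStep

variable {n : ℕ}

theorem exists_fill_up {b : Fin n → ℕ∞} {d : ℕ} {q : Fin n →₀ ℕ} (hq : q ∈ box b d) (j : ℕ) :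
    ∀ m : Fin n →₀ ℕ, InBox b m → expDeg m + j = d → toLex m ≤ toLex q →
      ∃ u ∈ box b d, m ≤ u ∧ toLex u ≤ toLex q := by
  induction j with
  | zero => intro m hm hd hle; exact ⟨m, mem_box.2 ⟨by omega, hm⟩, le_rfl, hle⟩
  | succ j ih =>
    intro m hm hd hle
    obtain ⟨hqd, hqb⟩ := mem_box.1 hq
    have hne : toLex m ≠ toLex q := fun h => by
      have := congrArg expDeg (toLex.injective h); omega
    obtain ⟨i, hi, hi'⟩ := toLex_lt_iff.1 (lt_of_le_of_ne hle hne)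
    have step : ∀ l, InBox b (m + Finsupp.single l 1) →
        toLex (m + Finsupp.single l 1) ≤ toLex q →
        ∃ u ∈ box b d, m ≤ u ∧ toLex u ≤ toLex q := by
      intro l hl hlq
      obtain ⟨u, hu, hmu, huq⟩ := ih _ hl (by simp; omega) hlq
      exact ⟨u, hu, le_self_add.trans hmu, huq⟩
    have hbox : ∀ l, ((m l + 1 : ℕ) : ℕ∞) < b l → InBox b (m + Finsupp.single l 1) := by
      intro l hl k
      by_cases hk : k = l
      · subst hk; simpa using hl
      · simpa [Finsupp.single_apply, Ne.symm hk] using hm k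
    by_cases hex : ∃ l, i < l ∧ ((m l + 1 : ℕ) : ℕ∞) < b l
    · obtain ⟨l, hil, hl⟩ := hex
      refine step l (hbox l hl) (toLex_lt_iff.2 ⟨i, fun k hk => ?_, ?_⟩).le
      · simp [hi k hk, (hk.trans hil).ne']
      · simpa [hil.ne'] using hi'
    · push Not at hex
      refine step i (hbox i (lt_of_le_of_lt (by exact_mod_cast hi') (hqb i))) ?_
      rcases Nat.lt_or_ge (m i + 1) (q i) with h | h
      · refine (toLex_lt_iff.2 ⟨i, fun k hk => ?_, ?_⟩).le
        · simp [hi k hk, hk.ne']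
        · simpa using h
      · refine le_of_eq (congrArg toLex (eq_of_le_of_expDeg (fun k => ?_) (by simp; omega)).symm)
        rcases lt_trichotomy k i with hk | rfl | hk
        · simp [hi k hk, hk.ne']
        · simpa using h
        · have h1 := lt_of_lt_of_le (hqb k) (hex k hk)
          have h2 : q k < m k + 1 := by exact_mod_cast h1
          simp [hk.ne]
          omega

/-- Stability of a set of exponent vectors inside `boxLE b d`. -/
def StableIn (b : Fin n → ℕ∞) (d : ℕ) (S : Finset (Fin n →₀ ℕ)) : Prop :=
  ∀ m ∈ S, ∀ i, m + Finsupp.single i 1 ∈ boxLE b d → m + Finsupp.single i 1 ∈ S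

theorem StableIn.mem_of_le {b : Fin n → ℕ∞} {d : ℕ} {S : Finset (Fin n →₀ ℕ)}
    (hS : StableIn b d S) (j : ℕ) :
    ∀ m ∈ S, ∀ u ∈ boxLE b d, m ≤ u → expDeg m + j = expDeg u → u ∈ S := by
  induction j with
  | zero =>
    intro m hm u _ hmu hd
    rwa [← eq_of_le_of_expDeg hmu (by omega)]
  | succ j ih =>
    intro m hm u hu hmu hd
    obtain ⟨i, hi⟩ : ∃ i, m i < u i := by
      by_contra! h
      have := expDeg_mono (m := u) (m' := m) h
      omega
    have hle : m + Finsupp.single i 1 ≤ u := by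
      intro k
      by_cases hk : k = i
      · subst hk; simpa using hi
      · simpa [Finsupp.single_apply, Ne.symm hk] using hmu k
    obtain ⟨hu1, hu2⟩ := mem_boxLE.1 hu
    exact ih _ (hS m hm i (mem_boxLE.2 ⟨(expDeg_mono hle).trans hu1, hu2.mono hle⟩)) u hu hle
      (by simp; omega)

theorem exists_stable {b : Fin n → ℕ∞} (hb : CL b) {d : ℕ} {S : Finset (Fin n →₀ ℕ)}
    (hS : S ⊆ boxLE b d) :
    ∃ S' ⊆ boxLE b d, S'.card = S.card ∧ (nab b S').card ≤ (nab b S).card ∧ StableIn b d S' ∧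
      ∀ e, LexTop b e (S'.filter (expDeg · = e)) := by
  classical
  let C := (boxLE b d).powerset.filter fun S' =>
    S'.card = S.card ∧ (nab b S').card ≤ (nab b S).card
  have hC : ∀ S', S' ∈ C ↔ S' ⊆ boxLE b d ∧ S'.card = S.card ∧
      (nab b S').card ≤ (nab b S).card := fun S' => by simp [C]
  obtain ⟨S0, hS0, hmax⟩ := exists_max_image C (fun S' => ∑ m ∈ S', expDeg m)
    ⟨S, (hC S).2 ⟨hS, rfl, le_rfl⟩⟩
  obtain ⟨h01, h02, h03⟩ := (hC S0).1 hS0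
  obtain ⟨S1, h11, htop, hcard, hnab⟩ := exists_degree_compression hb h01
  have hmaps : ∀ U ⊆ boxLE b d, ∀ x ∈ U, expDeg x ∈ range (d + 1) := fun U hU x hx => by
    have := (mem_boxLE.1 (hU hx)).1
    simp; omega
  have hsum : ∀ U ⊆ boxLE b d, ∑ m ∈ U, expDeg m =
      ∑ e ∈ range (d + 1), (U.filter (expDeg · = e)).card * e := by
    intro U hU
    rw [← sum_fiberwise_of_maps_to (hmaps U hU)]
    refine sum_congr rfl fun e _ => ?_
    rw [sum_congr rfl fun x hx => (mem_filter.1 hx).2, sum_const, smul_eq_mul]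
  have hΨ : ∑ m ∈ S1, expDeg m = ∑ m ∈ S0, expDeg m := by
    rw [hsum S1 h11, hsum S0 h01]
    exact sum_congr rfl fun e _ => by rw [hcard]
  have hc1 : S1.card = S.card := (card_eq_card_of_fibers expDeg hcard).trans h02
  refine ⟨S1, h11, hc1, hnab.trans h03, fun m hm i hmi => ?_, htop⟩
  obtain ⟨S2, h21, h2⟩ := exists_compression expDeg (Finsupp.erase i) h11
    (fun x _ y _ h h' => eq_of_erase_eq h h')
  have h22 := card_nab_le_of_line_compression i h11 h21 h2
  have h23 := card_eq_card_of_fibers (Finsupp.erase i) fun c => (h2 c).1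
  have h2C : S2 ∈ C := (hC S2).2 ⟨h21, h23.trans hc1, h22.trans (hnab.trans h03)⟩
  have hle := hmax S2 h2C
  have hmaps' : ∀ U ⊆ boxLE b d, ∀ x ∈ U, x.erase i ∈ (boxLE b d).image (Finsupp.erase i) :=
    fun U hU x hx => mem_image_of_mem _ (hU hx)
  rw [← hΨ, ← sum_fiberwise_of_maps_to (hmaps' S1 h11),
    ← sum_fiberwise_of_maps_to (hmaps' S2 h21)] at hle
  have hfib : ∀ c, _ := fun c => IsTop.sum_le (h2 c).2
    (filter_subset_filter (Finsupp.erase i · = c) h11) (h2 c).1.symm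
  have heq := (sum_eq_sum_iff_of_le fun c _ => (hfib c).1).1
    (le_antisymm (sum_le_sum fun c _ => (hfib c).1) hle) (m.erase i)
    (mem_image_of_mem _ (h11 hm))
  have htop' := (h2 (m.erase i)).2
  rw [← (hfib (m.erase i)).2 heq] at htop'
  have he : (m + Finsupp.single i 1).erase i = m.erase i := by
    rw [Finsupp.erase_add, Finsupp.erase_single, add_zero]
  exact (mem_filter.1 (htop'.2 m (mem_filter.2 ⟨hm, rfl⟩) _ (mem_filter.2 ⟨hmi, he⟩)
    (by simp))).1

/-- The dehomogenized Clements–Lindström inequality. -/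
theorem card_nab_le {b : Fin n → ℕ∞} (hb : CL b) {d : ℕ} {S T : Finset (Fin n →₀ ℕ)}
    (hS : S ⊆ boxLE b d)
    (hT : IsTop (toLex : (Fin n →₀ ℕ) → Lex (Fin n →₀ ℕ)) (boxLE b d) T)
    (hc : T.card ≤ S.card) : (nab b T).card ≤ (nab b S).card := by
  classical
  obtain ⟨S', hS'S, hS'c⟩ := exists_subset_card_eq hc
  obtain ⟨U, hU, hUc, hUn, hst, htop⟩ := exists_stable hb (hS'S.trans hS)
  refine le_trans ?_ (hUn.trans (card_le_card (nab_mono hS'S)))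
  rw [hS'c] at hUc
  set L := U.filter (expDeg · = d) with hL
  set M := T.filter (expDeg · = d) with hM
  have hMtop : LexTop b d M := by
    refine ⟨filter_subset_box hT.1 d, fun x hx y hy hxy => ?_⟩
    have hy' := mem_box.1 hy
    exact mem_filter.2 ⟨hT.2 x (mem_filter.1 hx).1 y (mem_boxLE.2 ⟨hy'.1.le, hy'.2⟩) hxy, hy'.1⟩
  have hML : M ⊆ L := by
    by_contra hnot
    obtain ⟨q, hqM, hqL⟩ := not_subset.1 hnot
    have hUT : U ⊆ T := by
      intro m hm
      by_contra hmT
      have hqT := (mem_filter.1 hqM).1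
      have hmq : toLex m ≤ toLex q := by
        by_contra! hlt
        exact hmT (hT.2 q hqT m (hU hm) hlt.le)
      have hmb := mem_boxLE.1 (hU hm)
      obtain ⟨u, hu, hmu, huq⟩ := exists_fill_up (hMtop.1 hqM) (d - expDeg m) m hmb.2
        (by omega) hmq
      have hu' := mem_box.1 hu
      have huU : u ∈ U := hst.mem_of_le (d - expDeg m) m hm u
        (mem_boxLE.2 ⟨hu'.1.le, hu'.2⟩) hmu (by omega)
      exact hqL ((htop d).2 u (mem_filter.2 ⟨huU, hu'.1⟩) q (hMtop.1 hqM) huq)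
    have : U = T := eq_of_subset_of_card_le hUT hUc.ge
    exact hqL (by rw [hL, this]; exact hqM)
  have hdisj : Disjoint U (up b L) := by
    rw [disjoint_left]
    intro w hw hw'
    have h1 := (mem_boxLE.1 (hU hw)).1
    have h2 := (mem_box.1 (up_subset_box (filter_subset_box hU d) hw')).1
    omega
  calc (nab b T).card ≤ (T ∪ up b M).card := by
        refine card_le_card (union_subset subset_union_left fun w hw => ?_)
        obtain ⟨hwb, m, hm, i, rfl⟩ := mem_up.1 hw
        rcases Nat.lt_or_ge d (expDeg (m + Finsupp.single i 1)) with h | h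
        · refine mem_union_right _ (mem_up.2 ⟨hwb, m, mem_filter.2 ⟨hm, ?_⟩, i, rfl⟩)
          have := (mem_boxLE.1 (hT.1 hm)).1
          simp at h
          omega
        · refine mem_union_left _ (hT.2 m hm _ (mem_boxLE.2 ⟨h, hwb⟩) (toLex_lt_iff.2
            ⟨i, fun k hk => ?_, ?_⟩).le)
          · simp [hk.ne']
          · simp
    _ ≤ T.card + (up b M).card := card_union_le _ _
    _ ≤ U.card + (up b L).card := add_le_add hUc.ge (card_le_card (up_mono hML))
    _ = (U ∪ up b L).card := (card_union_of_disjoint hdisj).symm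
    _ ≤ (nab b U).card :=
        card_le_card (union_subset_union Subset.rfl (up_mono (filter_subset _ _)))

/-- Drop the last coordinate of an exponent vector. -/
noncomputable def dropLast (m : Fin (n + 1) →₀ ℕ) : Fin n →₀ ℕ :=
  Finsupp.equivFunOnFinite.symm fun i => m i.castSucc

@[simp] theorem dropLast_apply (m : Fin (n + 1) →₀ ℕ) (i : Fin n) :
    dropLast m i = m i.castSucc := rfl

theorem expDeg_dropLast (m : Fin (n + 1) →₀ ℕ) :
    expDeg (dropLast m) + m (Fin.last n) = expDeg m := by
  simp [expDeg, Fin.sum_univ_castSucc]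

theorem dropLast_inj {m m' : Fin (n + 1) →₀ ℕ} (h : dropLast m = dropLast m')
    (hd : expDeg m = expDeg m') : m = m' := by
  have h1 := expDeg_dropLast m
  have h2 := expDeg_dropLast m'
  rw [h] at h1
  ext i
  induction i using Fin.lastCases with
  | last => omega
  | cast i => exact DFunLike.congr_fun h i

theorem dropLast_add_castSucc (m : Fin (n + 1) →₀ ℕ) (i : Fin n) :
    dropLast (m + Finsupp.single i.castSucc 1) = dropLast m + Finsupp.single i 1 := by
  ext j
  simp [Finsupp.single_apply]

theorem dropLast_add_last (m : Fin (n + 1) →₀ ℕ) :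
    dropLast (m + Finsupp.single (Fin.last n) 1) = dropLast m := by
  ext j
  simp

theorem exists_dropLast_eq {d : ℕ} {m : Fin n →₀ ℕ} (h : expDeg m ≤ d) :
    ∃ w : Fin (n + 1) →₀ ℕ, dropLast w = m ∧ expDeg w = d := by
  let w : Fin (n + 1) →₀ ℕ :=
    Finsupp.equivFunOnFinite.symm (Fin.snoc (α := fun _ => ℕ) (fun i => m i) (d - expDeg m))
  have h1 : dropLast w = m := by ext i; simp [w]
  refine ⟨w, h1, ?_⟩
  have := expDeg_dropLast w
  rw [h1, show w (Fin.last n) = d - expDeg m by simp [w]] at this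
  omega

theorem toLex_dropLast_lt {m m' : Fin (n + 1) →₀ ℕ} (h : toLex (dropLast m) < toLex (dropLast m')) :
    toLex m < toLex m' := by
  obtain ⟨i, hi, hi'⟩ := toLex_lt_iff.1 h
  refine toLex_lt_iff.2 ⟨i.castSucc, fun j hj => ?_, hi'⟩
  have hjl : j ≠ Fin.last n := (hj.trans (Fin.castSucc_lt_last i)).ne
  obtain ⟨k, rfl⟩ := Fin.exists_castSucc_eq.2 hjl
  exact hi k hj

/-- The combinatorial step: shadows of lex segments in a box with an unbounded last side. -/
theorem card_up_le_card_nab {b : Fin (n + 1) → ℕ∞} (hlast : b (Fin.last n) = ⊤)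
    (hb : CL fun i : Fin n => b i.castSucc) {d : ℕ} {S : Finset (Fin n →₀ ℕ)}
    (hS : S ⊆ boxLE (fun i : Fin n => b i.castSucc) d) {T : Finset (Fin (n + 1) →₀ ℕ)}
    (hT : LexTop b d T) (hc : T.card ≤ S.card) :
    (up b T).card ≤ (nab (fun i : Fin n => b i.castSucc) S).card := by
  classical
  set b' := fun i : Fin n => b i.castSucc with hb'
  have hin : ∀ m : Fin (n + 1) →₀ ℕ, InBox b m ↔ InBox b' (dropLast m) := by
    intro m
    refine ⟨fun h i => h i.castSucc, fun h i => ?_⟩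
    induction i using Fin.lastCases with
    | last => rw [hlast]; exact ENat.natCast_lt_top _
    | cast i => exact h i
  have hinj : ∀ e, ∀ U ⊆ box b e, (U.image dropLast).card = U.card := by
    intro e U hU
    refine card_image_of_injOn fun x hx y hy hxy => dropLast_inj hxy ?_
    rw [(mem_box.1 (hU hx)).1, (mem_box.1 (hU hy)).1]
  have htop : IsTop (toLex : (Fin n →₀ ℕ) → Lex (Fin n →₀ ℕ)) (boxLE b' d)
      (T.image dropLast) := by
    refine ⟨fun w hw => ?_, fun x hx y hy hxy => ?_⟩
    · obtain ⟨m, hm, rfl⟩ := mem_image.1 hw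
      have := mem_box.1 (hT.1 hm)
      have h1 := expDeg_dropLast m
      exact mem_boxLE.2 ⟨by omega, (hin m).1 this.2⟩
    · obtain ⟨m, hm, rfl⟩ := mem_image.1 hx
      obtain ⟨w, rfl, hwd⟩ := exists_dropLast_eq (mem_boxLE.1 hy).1
      have hwb : w ∈ box b d := mem_box.2 ⟨hwd, (hin w).2 (mem_boxLE.1 hy).2⟩
      refine mem_image_of_mem _ (hT.2 m hm w hwb ?_)
      rcases hxy.lt_or_eq with h | h
      · exact (toLex_dropLast_lt h).le
      · rw [dropLast_inj (toLex.injective h) (by rw [hwd, (mem_box.1 (hT.1 hm)).1])]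
  rw [← hinj (d + 1) _ (up_subset_box hT.1)]
  refine le_trans (card_le_card fun w hw => ?_)
    (card_nab_le hb hS htop ((hinj d T hT.1).trans_le hc))
  obtain ⟨v, hv, rfl⟩ := mem_image.1 hw
  obtain ⟨hvb, m, hm, i, rfl⟩ := mem_up.1 hv
  have hvb' := (hin _).1 hvb
  induction i using Fin.lastCases with
  | last => rw [dropLast_add_last]; exact mem_union_left _ (mem_image_of_mem _ hm)
  | cast i =>
    refine mem_union_right _ (mem_up.2 ⟨hvb', dropLast m, mem_image_of_mem _ hm, i, ?_⟩)
    rw [dropLast_add_castSucc]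

end CombinatorialStep

end CavigliaDeStefani

namespace CavigliaDeStefani

open Finset MvPolynomial

theorem finrank_map_of_injective {K V W : Type*} [Field K] [AddCommGroup V] [Module K V]
    [AddCommGroup W] [Module K W] (φ : V →ₗ[K] W) (h : Function.Injective φ) (p : Submodule K V) :
    Module.finrank K (p.map φ) = Module.finrank K p :=
  (Submodule.equivMapOfInjective φ h p).finrank_eq.symm

section Graded

variable {K : Type*} [Field K] {n : ℕ}

theorem homogeneousComponent_mul_add {p q : MvPolynomial (Fin n) K} {e : ℕ}
    (hq : q.IsHomogeneous e) (d : ℕ) :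
    homogeneousComponent (d + e) (p * q) = homogeneousComponent d p * q := by
  let _ := MvPolynomial.gradedAlgebra (σ := Fin n) (R := K)
  have h := DirectSum.coe_decompose_mul_add_of_right_mem (homogeneousSubmodule (Fin n) K)
    (a := p) (i := d) ((mem_homogeneousSubmodule e q).2 hq)
  have h2 : ∀ (x : MvPolynomial (Fin n) K) (i : ℕ),
      (DirectSum.decompose (homogeneousSubmodule (Fin n) K) x i : MvPolynomial (Fin n) K) =
        homogeneousComponent i x := fun x i => decomposition.decompose'_apply x i
  rwa [h2, h2] at h

theorem homogeneousComponent_mul_of_lt {p q : MvPolynomial (Fin n) K} {d e : ℕ}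
    (hq : q.IsHomogeneous e) (h : d < e) : homogeneousComponent d (p * q) = 0 := by
  rw [← sum_homogeneousComponent p, Finset.sum_mul, map_sum]
  refine sum_eq_zero fun i _ => ?_
  rw [homogeneousComponent_of_mem (((homogeneousComponent_isHomogeneous i p).mul hq)),
    if_neg (by omega)]

theorem mem_of_forall_homogeneousComponent {I : Ideal (MvPolynomial (Fin n) K)}
    {p : MvPolynomial (Fin n) K} (h : ∀ d, homogeneousComponent d p ∈ I) : p ∈ I := by
  rw [← sum_homogeneousComponent p]; exact sum_mem fun i _ => h i

theorem isHomog_span {S : Set (MvPolynomial (Fin n) K)} (h : ∀ p ∈ S, ∃ d, p.IsHomogeneous d) :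
    IsHomog (Ideal.span S) := by
  let _ := MvPolynomial.gradedAlgebra (σ := Fin n) (R := K)
  intro f hf d
  refine homogeneousComponent_mem_of_mem (Ideal.homogeneous_span _ _ fun x hx => ?_) hf d
  obtain ⟨e, he⟩ := h x hx
  exact ⟨e, he⟩

/-- The ideal quotient `I : g`. -/
noncomputable def colon (I : Ideal (MvPolynomial (Fin n) K)) (g : MvPolynomial (Fin n) K) :
    Ideal (MvPolynomial (Fin n) K) :=
  Submodule.comap (LinearMap.mulLeft (MvPolynomial (Fin n) K) g) I

@[simp] theorem mem_colon {I : Ideal (MvPolynomial (Fin n) K)} {g p : MvPolynomial (Fin n) K} :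
    p ∈ colon I g ↔ g * p ∈ I := Iff.rfl

theorem le_colon (I : Ideal (MvPolynomial (Fin n) K)) (g : MvPolynomial (Fin n) K) :
    I ≤ colon I g := fun _ h => I.mul_mem_left _ h

theorem IsHomog.colon {I : Ideal (MvPolynomial (Fin n) K)} (hI : IsHomog I)
    {g : MvPolynomial (Fin n) K} {e : ℕ} (hg : g.IsHomogeneous e) : IsHomog (colon I g) := by
  intro f hf d
  rw [mem_colon, mul_comm, ← homogeneousComponent_mul_add hg, mul_comm]
  exact hI _ hf _

theorem mem_component {I : Ideal (MvPolynomial (Fin n) K)} {d : ℕ} {p : MvPolynomial (Fin n) K} :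
    p ∈ component I d ↔ p ∈ I ∧ p.IsHomogeneous d := Iff.rfl

instance finite_homogeneousSubmodule (d : ℕ) :
    Module.Finite K (homogeneousSubmodule (Fin n) K d) :=
  Module.Finite.iff_fg.2 (homogeneousSubmodule_fg _ _ d)

theorem component_le (I : Ideal (MvPolynomial (Fin n) K)) (d : ℕ) :
    component I d ≤ homogeneousSubmodule (Fin n) K d := inf_le_right

instance finite_component (I : Ideal (MvPolynomial (Fin n) K)) (d : ℕ) :
    Module.Finite K (component I d) :=
  Submodule.finiteDimensional_of_le (component_le I d)

theorem component_mono {I J : Ideal (MvPolynomial (Fin n) K)} (h : I ≤ J) (d : ℕ) :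
    component I d ≤ component J d := inf_le_inf_right _ h

theorem hilb_mono {I J : Ideal (MvPolynomial (Fin n) K)} (h : I ≤ J) (d : ℕ) :
    hilb I d ≤ hilb J d := Submodule.finrank_mono (component_mono h d)

theorem component_eq_of_hilb_eq {I J : Ideal (MvPolynomial (Fin n) K)} (h : I ≤ J) {d : ℕ}
    (hd : hilb J d ≤ hilb I d) : component I d = component J d :=
  Submodule.eq_of_le_of_finrank_le (component_mono h d) hd

theorem component_top (d : ℕ) :
    component (⊤ : Ideal (MvPolynomial (Fin n) K)) d = homogeneousSubmodule (Fin n) K d := by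
  ext p; simp [mem_component]

theorem isHomogeneous_iff_support {p : MvPolynomial (Fin n) K} {d : ℕ} :
    p.IsHomogeneous d ↔ ∀ m ∈ p.support, expDeg m = d := by
  simp only [expDeg_eq_degree]
  constructor
  · intro h m hm
    by_contra hne
    exact mem_support_iff.1 hm (h.coeff_eq_zero hne)
  · intro h m hm
    rw [← h m (mem_support_iff.2 hm), Finsupp.degree_eq_weight_one]
    rfl

theorem finrank_restrictSupport (s : Finset (Fin n →₀ ℕ)) :
    Module.finrank K (restrictSupport K (s : Set (Fin n →₀ ℕ))) = s.card := by
  rw [Module.finrank_eq_card_basis (basisRestrictSupport K (s : Set (Fin n →₀ ℕ)))]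
  simp

theorem component_eq_restrictSupport {I : Ideal (MvPolynomial (Fin n) K)}
    {M : Set (Fin n →₀ ℕ)} (hI : ∀ p, p ∈ I ↔ ∀ m ∈ p.support, m ∈ M) {d : ℕ}
    {s : Finset (Fin n →₀ ℕ)} (hs : ∀ m, m ∈ s ↔ expDeg m = d ∧ m ∈ M) :
    component I d = restrictSupport K (s : Set (Fin n →₀ ℕ)) := by
  ext p
  rw [mem_component, hI, isHomogeneous_iff_support, mem_restrictSupport_iff]
  constructor
  · rintro ⟨h1, h2⟩ m hm
    exact (hs m).2 ⟨h2 m hm, h1 m hm⟩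
  · intro h
    exact ⟨fun m hm => ((hs m).1 (h hm)).2, fun m hm => ((hs m).1 (h hm)).1⟩

theorem hilb_eq_card {I : Ideal (MvPolynomial (Fin n) K)}
    {M : Set (Fin n →₀ ℕ)} (hI : ∀ p, p ∈ I ↔ ∀ m ∈ p.support, m ∈ M) {d : ℕ}
    {s : Finset (Fin n →₀ ℕ)} (hs : ∀ m, m ∈ s ↔ expDeg m = d ∧ m ∈ M) :
    hilb I d = s.card := by
  rw [hilb, component_eq_restrictSupport hI hs, finrank_restrictSupport]

theorem hilb_top (d : ℕ) :
    hilb (⊤ : Ideal (MvPolynomial (Fin n) K)) d = (box (fun _ : Fin n => ⊤) d).card :=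
  hilb_eq_card (M := Set.univ) (by simp) fun m => by simp [InBox]

theorem component_sup {I J : Ideal (MvPolynomial (Fin n) K)} (hI : IsHomog I) (hJ : IsHomog J)
    (d : ℕ) : component (I ⊔ J) d = component I d ⊔ component J d := by
  refine le_antisymm (fun p hp => ?_)
    (sup_le (component_mono le_sup_left d) (component_mono le_sup_right d))
  obtain ⟨hp, hd⟩ := mem_component.1 hp
  obtain ⟨x, hx, y, hy, rfl⟩ := Submodule.mem_sup.1 hp
  rw [← homogeneousComponent_eq_self hd, map_add]
  exact Submodule.add_mem_sup ⟨hI x hx d, homogeneousComponent_isHomogeneous d x⟩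
    ⟨hJ y hy d, homogeneousComponent_isHomogeneous d y⟩

theorem mem_sup_span_singleton {I : Ideal (MvPolynomial (Fin n) K)}
    {g p : MvPolynomial (Fin n) K} : p ∈ I ⊔ Ideal.span {g} ↔ ∃ v, p - v * g ∈ I := by
  rw [Submodule.mem_sup]
  constructor
  · rintro ⟨x, hx, y, hy, rfl⟩
    obtain ⟨v, rfl⟩ := Ideal.mem_span_singleton'.1 hy
    exact ⟨v, by simpa using hx⟩
  · rintro ⟨v, hv⟩
    exact ⟨_, hv, v * g, Ideal.mem_span_singleton'.2 ⟨v, rfl⟩, by ring⟩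

theorem component_span_singleton_of_lt {g : MvPolynomial (Fin n) K} {e d : ℕ}
    (hg : g.IsHomogeneous e) (h : d < e) : component (Ideal.span {g}) d = ⊥ := by
  rw [eq_bot_iff]
  rintro p ⟨hp, hd⟩
  obtain ⟨v, rfl⟩ := Ideal.mem_span_singleton'.1 hp
  rw [Submodule.mem_bot, ← homogeneousComponent_eq_self hd, homogeneousComponent_mul_of_lt hg h]

theorem component_span_singleton {g : MvPolynomial (Fin n) K} {e : ℕ}
    (hg : g.IsHomogeneous e) (d : ℕ) :
    component (Ideal.span {g}) (d + e) =
      (homogeneousSubmodule (Fin n) K d).map (LinearMap.mulLeft K g) := by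
  ext p
  rw [mem_component, Submodule.mem_map]
  constructor
  · rintro ⟨hp, hd⟩
    obtain ⟨v, rfl⟩ := Ideal.mem_span_singleton'.1 hp
    refine ⟨homogeneousComponent d v, homogeneousComponent_isHomogeneous d v, ?_⟩
    rw [LinearMap.mulLeft_apply, mul_comm, ← homogeneousComponent_mul_add hg,
      homogeneousComponent_eq_self hd]
  · rintro ⟨v, hv, rfl⟩
    rw [LinearMap.mulLeft_apply, mul_comm]
    exact ⟨Ideal.mem_span_singleton'.2 ⟨v, rfl⟩, IsHomogeneous.mul hv hg⟩

/-- The Hilbert function after adding a homogeneous nonzerodivisor. -/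
theorem hilb_sup_span_singleton {I : Ideal (MvPolynomial (Fin n) K)} (hI : IsHomog I)
    {g : MvPolynomial (Fin n) K} {e : ℕ} (hg : g.IsHomogeneous e) (hg0 : g ≠ 0)
    (hreg : ∀ u, u * g ∈ I → u ∈ I) (d : ℕ) :
    hilb (I ⊔ Ideal.span {g}) (d + e) + hilb I d =
      hilb I (d + e) + hilb (⊤ : Ideal (MvPolynomial (Fin n) K)) d := by
  have hJ : IsHomog (Ideal.span {g}) := isHomog_span fun p hp => ⟨e, by rwa [hp]⟩
  have hinj : Function.Injective (LinearMap.mulLeft K g) := fun x y h => mul_left_cancel₀ hg0 h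
  have h1 := Submodule.finrank_sup_add_finrank_inf_eq (component I (d + e))
    (component (Ideal.span {g}) (d + e))
  have h2 : component I (d + e) ⊓ component (Ideal.span {g}) (d + e) =
      (component I d).map (LinearMap.mulLeft K g) := by
    rw [component_span_singleton hg]
    ext p
    simp only [Submodule.mem_inf, Submodule.mem_map, LinearMap.mulLeft_apply]
    constructor
    · rintro ⟨hp, v, hv, rfl⟩
      exact ⟨v, ⟨hreg v (by rw [mul_comm]; exact hp.1), hv⟩, rfl⟩
    · rintro ⟨v, hv, rfl⟩
      exact ⟨⟨I.mul_mem_left _ hv.1, by rw [mul_comm]; exact IsHomogeneous.mul hv.2 hg⟩,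
        v, hv.2, rfl⟩
  rw [h2, component_span_singleton hg, ← component_span_singleton hg, ← component_sup hI hJ,
    finrank_map_of_injective _ hinj] at h1
  rw [component_span_singleton hg, finrank_map_of_injective _ hinj] at h1
  rw [hilb, hilb, hilb, hilb, component_top]
  exact h1

theorem hilb_sup_span_singleton_of_lt {I : Ideal (MvPolynomial (Fin n) K)} (hI : IsHomog I)
    {g : MvPolynomial (Fin n) K} {e d : ℕ} (hg : g.IsHomogeneous e) (h : d < e) :
    hilb (I ⊔ Ideal.span {g}) d = hilb I d := by
  rw [hilb, component_sup hI (isHomog_span fun p hp => ⟨e, by rwa [hp]⟩),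
    component_span_singleton_of_lt hg h, sup_bot_eq, hilb]

end Graded

end CavigliaDeStefani

namespace CavigliaDeStefani

open Finset MvPolynomial

section RegularSequences

variable {K : Type*} [Field K] {n : ℕ}

/-- The ideal generated by a sequence. -/
noncomputable def seqIdeal {r : ℕ} (f : Fin r → MvPolynomial (Fin n) K) :
    Ideal (MvPolynomial (Fin n) K) := Ideal.span (Set.range f)

/-- The sequence without its last term. -/
def initSeq {α : Type*} {k : ℕ} (f : Fin (k + 1) → α) : Fin k → α := fun i => f i.castSucc

theorem seqIdeal_zero (f : Fin 0 → MvPolynomial (Fin n) K) : seqIdeal f = ⊥ := by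
  simp [seqIdeal]

theorem seqIdeal_succ {k : ℕ} (f : Fin (k + 1) → MvPolynomial (Fin n) K) :
    seqIdeal f = seqIdeal (initSeq f) ⊔ Ideal.span {f (Fin.last k)} := by
  rw [seqIdeal, seqIdeal, ← Ideal.span_union]
  congr 1
  ext p
  simp only [initSeq, Set.mem_range, Fin.exists_fin_succ', Set.mem_union, Set.mem_singleton_iff,
    eq_comm]

theorem mem_seqIdeal {r : ℕ} (f : Fin r → MvPolynomial (Fin n) K) (i : Fin r) :
    f i ∈ seqIdeal f := Ideal.subset_span ⟨i, rfl⟩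

theorem isRegSeq_succ_iff {k : ℕ} {f : Fin (k + 1) → MvPolynomial (Fin n) K} :
    IsRegSeq f ↔ IsRegSeq (initSeq f) ∧
      ∀ g, g * f (Fin.last k) ∈ seqIdeal (initSeq f) → g ∈ seqIdeal (initSeq f) := by
  have h1 : ∀ i : Fin k, {p | ∃ j : Fin (k + 1), j < i.castSucc ∧ p = f j} =
      {p | ∃ j : Fin k, j < i ∧ p = initSeq f j} := by
    intro i
    ext p
    constructor
    · rintro ⟨j, hj, rfl⟩
      obtain ⟨l, rfl⟩ := Fin.exists_castSucc_eq.2 (hj.trans (Fin.castSucc_lt_last i)).ne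
      exact ⟨l, hj, rfl⟩
    · rintro ⟨j, hj, rfl⟩
      exact ⟨j.castSucc, hj, rfl⟩
  have h2 : {p | ∃ j : Fin (k + 1), j < Fin.last k ∧ p = f j} = Set.range (initSeq f) := by
    ext p
    constructor
    · rintro ⟨j, hj, rfl⟩
      obtain ⟨l, rfl⟩ := Fin.exists_castSucc_eq.2 hj.ne
      exact ⟨l, rfl⟩
    · rintro ⟨j, rfl⟩
      exact ⟨j.castSucc, Fin.castSucc_lt_last j, rfl⟩
  rw [IsRegSeq, Fin.forall_fin_succ']
  simp only [h1, h2]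
  rfl

variable {r : ℕ}

theorem isHomog_seqIdeal {f : Fin r → MvPolynomial (Fin n) K} {a : Fin r → ℕ}
    (hf : ∀ i, (f i).IsHomogeneous (a i)) : IsHomog (seqIdeal f) :=
  isHomog_span (by rintro _ ⟨i, rfl⟩; exact ⟨_, hf i⟩)

theorem coeff_zero_of_mem_seqIdeal {f : Fin r → MvPolynomial (Fin n) K} {a : Fin r → ℕ}
    (hf : ∀ i, (f i).IsHomogeneous (a i)) (ha : ∀ i, 0 < a i) {p : MvPolynomial (Fin n) K}
    (hp : p ∈ seqIdeal f) : constantCoeff p = 0 := by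
  suffices seqIdeal f ≤ RingHom.ker (constantCoeff (R := K) (σ := Fin n)) from this hp
  rw [seqIdeal, Ideal.span_le]
  rintro _ ⟨i, rfl⟩
  refine RingHom.mem_ker.2 ((hf i).coeff_eq_zero ?_)
  simpa using (ha i).ne

theorem one_notMem_seqIdeal {f : Fin r → MvPolynomial (Fin n) K} {a : Fin r → ℕ}
    (hf : ∀ i, (f i).IsHomogeneous (a i)) (ha : ∀ i, 0 < a i) :
    (1 : MvPolynomial (Fin n) K) ∉ seqIdeal f := fun h => by
  simpa using coeff_zero_of_mem_seqIdeal hf ha h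

theorem last_ne_zero {k : ℕ} {f : Fin (k + 1) → MvPolynomial (Fin n) K} {a : Fin (k + 1) → ℕ}
    (hf : ∀ i, (f i).IsHomogeneous (a i)) (ha : ∀ i, 0 < a i) (hreg : IsRegSeq f) :
    f (Fin.last k) ≠ 0 := fun h0 =>
  one_notMem_seqIdeal (f := initSeq f) (a := initSeq a) (fun i => hf _) (fun i => ha _)
    ((isRegSeq_succ_iff.1 hreg).2 1 (by rw [h0, mul_zero]; exact zero_mem _))

/-- The box of a degree sequence. -/
noncomputable def bOf (n : ℕ) (a : Fin r → ℕ) : Fin n → ℕ∞ :=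
  fun i => if h : (i : ℕ) < r then (a ⟨i, h⟩ : ℕ∞) else ⊤

theorem bOf_succ {k : ℕ} (hk : k < n) (a : Fin (k + 1) → ℕ) :
    bOf n a = Function.update (bOf n (initSeq a)) ⟨k, hk⟩ (a (Fin.last k) : ℕ∞) := by
  ext i
  by_cases hi : i = ⟨k, hk⟩
  · subst hi; simp [bOf, Fin.last]
  · have : (i : ℕ) ≠ k := fun h => hi (Fin.ext h)
    rw [Function.update_of_ne hi]
    by_cases h : (i : ℕ) < k
    · simp [bOf, h, Nat.lt_succ_of_lt h, initSeq]
    · simp [bOf, h, show ¬ (i : ℕ) < k + 1 by omega]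

theorem card_box_update {b : Fin n → ℕ∞} {i : Fin n} (hi : b i = ⊤) (e d : ℕ) :
    (box (Function.update b i (e : ℕ∞)) (d + e)).card + (box b d).card =
      (box b (d + e)).card := by
  rw [← card_image_of_injective (box b d) (add_left_injective (Finsupp.single i e)),
    ← card_union_of_disjoint]
  · congr 1
    ext m
    simp only [mem_union, mem_box, mem_image]
    constructor
    · rintro (⟨hd, hm⟩ | ⟨m, ⟨hd, hm⟩, rfl⟩)
      · refine ⟨hd, fun j => ?_⟩
        by_cases hj : j = i
        · subst hj; rw [hi]; exact ENat.natCast_lt_top _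
        · simpa [Function.update_of_ne hj] using hm j
      · refine ⟨by simp [hd], fun j => ?_⟩
        by_cases hj : j = i
        · subst hj; rw [hi]; exact ENat.natCast_lt_top _
        · simpa [Finsupp.single_apply, Ne.symm hj] using hm j
    · rintro ⟨hd, hm⟩
      by_cases hmi : m i < e
      · left
        refine ⟨hd, fun j => ?_⟩
        by_cases hj : j = i
        · subst hj; simpa using hmi
        · simpa [Function.update_of_ne hj] using hm j
      · right
        have hle : Finsupp.single i e ≤ m := by
          rw [Finsupp.single_le_iff]; omega
        have heq : m - Finsupp.single i e + Finsupp.single i e = m := tsub_add_cancel_of_le hle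
        refine ⟨m - Finsupp.single i e, ⟨?_, hm.mono tsub_le_self⟩, heq⟩
        have := congrArg expDeg heq
        simp at this; omega
  · rw [disjoint_left]
    intro m hm hm'
    obtain ⟨m, _, rfl⟩ := mem_image.1 hm'
    have := (mem_box.1 hm).2 i
    simp at this
    have h2 : m i + e < e := by exact_mod_cast this
    omega

theorem box_update_of_lt {b : Fin n → ℕ∞} {i : Fin n} (hi : b i = ⊤) {e d : ℕ} (h : d < e) :
    box (Function.update b i (e : ℕ∞)) d = box b d := by
  ext m
  simp only [mem_box]
  refine and_congr_right fun hd => ⟨fun hm j => ?_, fun hm j => ?_⟩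
  · by_cases hj : j = i
    · subst hj; rw [hi]; exact ENat.natCast_lt_top _
    · simpa [Function.update_of_ne hj] using hm j
  · by_cases hj : j = i
    · subst hj
      have : m j ≤ expDeg m :=
        single_le_sum (f := fun i => m i) (fun _ _ => Nat.zero_le _) (mem_univ j)
      simpa using (by omega : m j < e)
    · simpa [Function.update_of_ne hj] using hm j

/-- The Hilbert function of a complete intersection is counted by its box. -/
theorem hilb_seqIdeal (hrn : r ≤ n) {f : Fin r → MvPolynomial (Fin n) K} {a : Fin r → ℕ}
    (hf : ∀ i, (f i).IsHomogeneous (a i)) (ha : ∀ i, 0 < a i) (hreg : IsRegSeq f) (d : ℕ) :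
    hilb (seqIdeal f) d + (box (bOf n a) d).card =
      hilb (⊤ : Ideal (MvPolynomial (Fin n) K)) d := by
  induction r generalizing d with
  | zero =>
    rw [seqIdeal_zero, hilb_top]
    have h0 : hilb (⊥ : Ideal (MvPolynomial (Fin n) K)) d = 0 := by
      rw [hilb, show component (⊥ : Ideal (MvPolynomial (Fin n) K)) d = ⊥ from ?_, finrank_bot]
      rw [eq_bot_iff]
      exact fun p hp => hp.1
    rw [h0, zero_add]
    congr 2
  | succ k ih =>
    have hreg' := isRegSeq_succ_iff.1 hreg
    have ih := fun d => ih (by omega) (f := initSeq f) (a := initSeq a) (fun i => hf _)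
      (fun i => ha _) hreg'.1 d
    have htop : bOf n (initSeq a) ⟨k, hrn⟩ = ⊤ := by simp [bOf]
    have hhom : IsHomog (seqIdeal (initSeq f)) := isHomog_seqIdeal (a := initSeq a) fun i => hf _
    rw [seqIdeal_succ, bOf_succ (by omega)]
    rcases Nat.lt_or_ge d (a (Fin.last k)) with h | h
    · rw [hilb_sup_span_singleton_of_lt hhom (hf _) h, box_update_of_lt htop h, ih]
    · obtain ⟨d, rfl⟩ := Nat.exists_eq_add_of_le' h
      have h1 := hilb_sup_span_singleton hhom (hf (Fin.last k)) (last_ne_zero hf ha hreg) hreg'.2 d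
      have h2 := card_box_update htop (a (Fin.last k)) d
      have h3 := ih d
      have h4 := ih (d + a (Fin.last k))
      omega

theorem mem_of_forall_mem_sup_span_pow {I : Ideal (MvPolynomial (Fin n) K)} (hI : IsHomog I)
    {g u : MvPolynomial (Fin n) K} {e : ℕ} (hg : g.IsHomogeneous e) (he : 0 < e)
    (h : ∀ m, u ∈ I ⊔ Ideal.span {g ^ m}) : u ∈ I := by
  refine mem_of_forall_homogeneousComponent fun d => ?_
  obtain ⟨v, hv⟩ := mem_sup_span_singleton.1 (h (d + 1))
  have := hI _ hv d
  rwa [map_sub, homogeneousComponent_mul_of_lt (hg.pow _) (by nlinarith), sub_zero] at this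

/-- A nonzerodivisor modulo a regular sequence is one modulo the initial segments. -/
theorem nzd_initSeq {k : ℕ} {f : Fin (k + 1) → MvPolynomial (Fin n) K} {a : Fin (k + 1) → ℕ}
    (hf : ∀ i, (f i).IsHomogeneous (a i)) (ha : ∀ i, 0 < a i) (hreg : IsRegSeq f)
    {y : MvPolynomial (Fin n) K} (hy : ∀ u, y * u ∈ seqIdeal f → u ∈ seqIdeal f) :
    ∀ u, y * u ∈ seqIdeal (initSeq f) → u ∈ seqIdeal (initSeq f) := by
  have hreg' := isRegSeq_succ_iff.1 hreg
  rw [seqIdeal_succ] at hy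
  set c := seqIdeal (initSeq f) with hc
  set g := f (Fin.last k) with hg
  have step : ∀ m u, y * u ∈ c → ∃ v, y * v ∈ c ∧ u - v * g ^ m ∈ c := by
    intro m
    induction m with
    | zero => intro u hu; exact ⟨u, hu, by simp⟩
    | succ m ih =>
      intro u hu
      obtain ⟨v, hv, huv⟩ := ih u hu
      obtain ⟨w, hw⟩ := mem_sup_span_singleton.1 (hy v (Ideal.mem_sup_left hv))
      refine ⟨w, hreg'.2 _ ?_, ?_⟩
      · rw [show y * w * g = y * v - y * (v - w * g) by ring]
        exact sub_mem hv (c.mul_mem_left _ hw)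
      · rw [show u - w * g ^ (m + 1) = (u - v * g ^ m) + g ^ m * (v - w * g) by ring]
        exact add_mem huv (c.mul_mem_left _ hw)
  intro u hu
  refine mem_of_forall_mem_sup_span_pow (isHomog_seqIdeal (a := initSeq a) fun i => hf _)
    (hf (Fin.last k)) (ha _) fun m => ?_
  obtain ⟨v, _, hv⟩ := step m u hu
  exact mem_sup_span_singleton.2 ⟨v, hv⟩

/-- Data of a hyperplane section `A / (y)`. -/
structure Hyperplane (y : MvPolynomial (Fin (n + 1)) K) where
  /-- the projection -/
  π : MvPolynomial (Fin (n + 1)) K →ₐ[K] MvPolynomial (Fin n) K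
  /-- a graded section -/
  σ : MvPolynomial (Fin n) K →ₐ[K] MvPolynomial (Fin (n + 1)) K
  hom : y.IsHomogeneous 1
  ne_zero : y ≠ 0
  π_σ : ∀ p, π (σ p) = p
  π_eq_zero : ∀ p, π p = 0 ↔ ∃ v, p = v * y
  π_hom : ∀ {p d}, p.IsHomogeneous d → (π p).IsHomogeneous d
  σ_hom : ∀ {p d}, p.IsHomogeneous d → (σ p).IsHomogeneous d

/-- The linear form with given coefficients. -/
noncomputable def linForm (c : Fin n → K) : MvPolynomial (Fin n) K := ∑ j, C (c j) * X j

theorem isHomogeneous_linForm (c : Fin n → K) : (linForm c).IsHomogeneous 1 :=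
  IsHomogeneous.sum _ _ _ fun _ _ => isHomogeneous_C_mul_X _ _

theorem exists_hyperplane {c : Fin (n + 1) → K} (h0 : linForm c ≠ 0) :
    Nonempty (Hyperplane (linForm c)) := by
  obtain ⟨i, hi⟩ : ∃ i, c i ≠ 0 := by
    by_contra! h
    exact h0 (by simp [linForm, h])
  let g : Fin (n + 1) → MvPolynomial (Fin n) K :=
    i.insertNth (∑ k, C (-(c i)⁻¹ * c (i.succAbove k)) * X k) fun k => X k
  have hgi : g i = ∑ k, C (-(c i)⁻¹ * c (i.succAbove k)) * X k := by simp [g]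
  have hgs : ∀ k, g (i.succAbove k) = X k := fun k => by simp [g]
  have hghom : ∀ j, (g j).IsHomogeneous 1 := by
    intro j
    induction j using i.succAboveCases with
    | x => rw [hgi]; exact IsHomogeneous.sum _ _ _ fun _ _ => isHomogeneous_C_mul_X _ _
    | p k => rw [hgs]; exact isHomogeneous_X _ _
  let π : MvPolynomial (Fin (n + 1)) K →ₐ[K] MvPolynomial (Fin n) K := aeval g
  let σ : MvPolynomial (Fin n) K →ₐ[K] MvPolynomial (Fin (n + 1)) K :=
    aeval fun k => X (i.succAbove k)
  have hy : linForm c = C (c i) * X i + ∑ k, C (c (i.succAbove k)) * X (i.succAbove k) := by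
    rw [linForm, Fin.sum_univ_succAbove _ i]
  have hπy : π (linForm c) = 0 := by
    have : ∀ k, π (X k) = g k := fun k => by simp [π]
    rw [hy]
    simp only [map_add, map_mul, map_sum, this, hgi, hgs, algHom_C, algebraMap_eq, Finset.mul_sum]
    rw [← sum_add_distrib]
    refine sum_eq_zero fun k _ => ?_
    rw [← mul_assoc, ← add_mul, ← C_mul, ← C_mul, ← C_add,
      show c i * (-(c i)⁻¹ * c (i.succAbove k)) + c (i.succAbove k) = 0 by field_simp; ring,
      C_0, zero_mul]
  have hquot : (Ideal.Quotient.mkₐ K (Ideal.span {linForm c})).comp (σ.comp π) =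
      Ideal.Quotient.mkₐ K (Ideal.span {linForm c}) := by
    refine algHom_ext fun j => ?_
    induction j using i.succAboveCases with
    | x =>
      simp only [AlgHom.comp_apply, Ideal.Quotient.mkₐ_eq_mk]
      rw [Ideal.Quotient.eq, Ideal.mem_span_singleton']
      refine ⟨-C (c i)⁻¹, ?_⟩
      rw [hy]
      simp only [π, σ, aeval_X, hgi, map_sum, map_mul, algHom_C, algebraMap_eq]
      have h1 : (C (c i)⁻¹ * C (c i) : MvPolynomial (Fin (n + 1)) K) = 1 := by
        rw [← C_mul, inv_mul_cancel₀ hi, C_1]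
      simp only [C_neg, neg_mul, mul_add, ← mul_assoc, h1, one_mul, sum_neg_distrib,
        Finset.mul_sum]
      ring
    | p k => simp [π, σ, hgs]
  refine ⟨⟨π, σ, isHomogeneous_linForm c, h0, fun p => ?_, fun p => ⟨fun h => ?_, ?_⟩,
    fun {p d} hp => ?_, fun {p d} hp => ?_⟩⟩
  · change (π.comp σ) p = AlgHom.id K _ p
    congr 1
    refine algHom_ext fun k => ?_
    simp [π, σ, hgs]
  · have h1 := DFunLike.congr_fun hquot p
    simp only [AlgHom.comp_apply, h, map_zero] at h1
    obtain ⟨v, hv⟩ := Ideal.mem_span_singleton'.1 (Ideal.Quotient.eq_zero_iff_mem.1 h1.symm)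
    exact ⟨v, hv.symm⟩
  · rintro ⟨v, rfl⟩
    rw [map_mul, hπy, mul_zero]
  · have h1 := hp.aeval g hghom
    rwa [one_mul] at h1
  · have h1 := hp.aeval (fun k => (X (i.succAbove k) : MvPolynomial (Fin (n + 1)) K))
      fun k => isHomogeneous_X _ _
    rwa [one_mul] at h1

end RegularSequences

end CavigliaDeStefani

namespace CavigliaDeStefani

open Finset MvPolynomial

section Sections

variable {K : Type*} [Field K] {n : ℕ}

theorem homogeneousComponent_map {m : ℕ}
    (φ : MvPolynomial (Fin m) K →ₐ[K] MvPolynomial (Fin n) K)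
    (hφ : ∀ {p d}, p.IsHomogeneous d → (φ p).IsHomogeneous d) (d : ℕ)
    (p : MvPolynomial (Fin m) K) :
    homogeneousComponent d (φ p) = φ (homogeneousComponent d p) := by
  conv_lhs => rw [← sum_homogeneousComponent p, map_sum, map_sum]
  have h : ∀ i, homogeneousComponent d (φ (homogeneousComponent i p)) =
      if i = d then φ (homogeneousComponent i p) else 0 := by
    intro i
    rw [homogeneousComponent_of_mem (hφ (homogeneousComponent_isHomogeneous i p))]
    simp only [eq_comm]
  simp only [h]
  rw [Finset.sum_ite_eq' (range (p.totalDegree + 1)) d]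
  split_ifs with hd
  · rfl
  · rw [homogeneousComponent_eq_zero, map_zero]
    simpa using hd

namespace Hyperplane

variable {y : MvPolynomial (Fin (n + 1)) K} (H : Hyperplane y)

/-- The image of an ideal in a hyperplane section. -/
noncomputable def sect (I : Ideal (MvPolynomial (Fin (n + 1)) K)) :
    Ideal (MvPolynomial (Fin n) K) := I.map H.π

theorem surjective : Function.Surjective H.π := fun p => ⟨_, H.π_σ p⟩

theorem mem_sect {I : Ideal (MvPolynomial (Fin (n + 1)) K)} {q : MvPolynomial (Fin n) K} :
    q ∈ H.sect I ↔ ∃ p ∈ I, H.π p = q :=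
  Ideal.mem_map_iff_of_surjective _ H.surjective

theorem sect_mono {I J : Ideal (MvPolynomial (Fin (n + 1)) K)} (h : I ≤ J) :
    H.sect I ≤ H.sect J := Ideal.map_mono h

theorem π_mem_sect_iff {I : Ideal (MvPolynomial (Fin (n + 1)) K)}
    {p : MvPolynomial (Fin (n + 1)) K} : H.π p ∈ H.sect I ↔ ∃ v, p - v * y ∈ I := by
  rw [mem_sect]
  constructor
  · rintro ⟨q, hq, hqp⟩
    obtain ⟨v, hv⟩ := (H.π_eq_zero (p - q)).1 (by rw [map_sub, hqp, sub_self])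
    exact ⟨v, by rwa [← hv, sub_sub_cancel]⟩
  · rintro ⟨v, hv⟩
    refine ⟨_, hv, ?_⟩
    rw [map_sub, (H.π_eq_zero _).2 ⟨v, rfl⟩, sub_zero]

theorem isHomog_sect {I : Ideal (MvPolynomial (Fin (n + 1)) K)} (hI : IsHomog I) :
    IsHomog (H.sect I) := by
  intro q hq d
  obtain ⟨p, hp, rfl⟩ := H.mem_sect.1 hq
  rw [homogeneousComponent_map _ H.π_hom]
  exact H.mem_sect.2 ⟨_, hI p hp d, rfl⟩

theorem sect_seqIdeal {k : ℕ} (f : Fin k → MvPolynomial (Fin (n + 1)) K) :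
    H.sect (seqIdeal f) = seqIdeal fun i => H.π (f i) := by
  rw [sect, seqIdeal, Ideal.map_span, ← Set.range_comp]; rfl

theorem isRegSeq {k : ℕ} {f : Fin k → MvPolynomial (Fin (n + 1)) K} {a : Fin k → ℕ}
    (hf : ∀ i, (f i).IsHomogeneous (a i)) (ha : ∀ i, 0 < a i) (hreg : IsRegSeq f)
    (hy : ∀ u, y * u ∈ seqIdeal f → u ∈ seqIdeal f) : IsRegSeq fun i => H.π (f i) := by
  induction k with
  | zero => exact fun i => i.elim0
  | succ k ih =>
    have hreg' := isRegSeq_succ_iff.1 hreg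
    refine isRegSeq_succ_iff.2 ⟨ih (f := initSeq f) (a := initSeq a) (fun i => hf _) (fun i => ha _)
      hreg'.1 (nzd_initSeq hf ha hreg hy), fun g hg => ?_⟩
    rw [show initSeq (fun i => H.π (f i)) = fun i => H.π (initSeq f i) from rfl,
      ← H.sect_seqIdeal] at hg ⊢
    obtain ⟨g, rfl⟩ := H.surjective g
    rw [← map_mul, π_mem_sect_iff] at hg
    rw [π_mem_sect_iff]
    obtain ⟨h, hh⟩ := hg
    rw [seqIdeal_succ] at hy
    obtain ⟨v, hv⟩ := mem_sup_span_singleton.1 (hy h (mem_sup_span_singleton.2 ⟨g, by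
      rw [← neg_mem_iff]; convert hh using 1; ring⟩))
    refine ⟨v, hreg'.2 _ ?_⟩
    rw [show (g - v * y) * f (Fin.last k) = (g * f (Fin.last k) - h * y) +
      y * (h - v * f (Fin.last k)) by ring]
    exact add_mem hh (Ideal.mul_mem_left _ _ hv)

theorem component_sect {I : Ideal (MvPolynomial (Fin (n + 1)) K)} (hI : IsHomog I) (d : ℕ) :
    component (H.sect I) d = (component I d).map H.π.toLinearMap := by
  ext q
  simp only [mem_component, Submodule.mem_map, AlgHom.toLinearMap_apply]
  constructor
  · rintro ⟨hq, hd⟩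
    obtain ⟨p, hp, rfl⟩ := H.mem_sect.1 hq
    refine ⟨_, ⟨hI p hp d, homogeneousComponent_isHomogeneous d p⟩, ?_⟩
    rw [← homogeneousComponent_map _ H.π_hom, homogeneousComponent_eq_self hd]
  · rintro ⟨p, hp, rfl⟩
    exact ⟨H.mem_sect.2 ⟨p, hp.1, rfl⟩, H.π_hom hp.2⟩

theorem hilb_zero (I : Ideal (MvPolynomial (Fin (n + 1)) K)) (hI : IsHomog I) :
    hilb I 0 = hilb (H.sect I) 0 := by
  have h := H.component_sect hI 0
  have h1 := (H.π.toLinearMap.domRestrict (component I 0)).finrank_range_add_finrank_ker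
  have h2 : LinearMap.ker (H.π.toLinearMap.domRestrict (component I 0)) = ⊥ := by
    rw [LinearMap.ker_eq_bot']
    rintro ⟨p, hp⟩ h
    obtain ⟨v, rfl⟩ := (H.π_eq_zero p).1 h
    ext1
    change v * y = 0
    rw [← homogeneousComponent_eq_self hp.2, homogeneousComponent_mul_of_lt H.hom zero_lt_one]
  rw [h2, finrank_bot, add_zero, LinearMap.range_domRestrict, ← h] at h1
  exact h1.symm

theorem hilb_succ (I : Ideal (MvPolynomial (Fin (n + 1)) K)) (hI : IsHomog I) (d : ℕ) :
    hilb I (d + 1) = hilb (colon I y) d + hilb (H.sect I) (d + 1) := by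
  have h := H.component_sect hI (d + 1)
  have h1 := (H.π.toLinearMap.domRestrict (component I (d + 1))).finrank_range_add_finrank_ker
  have hinj : Function.Injective (LinearMap.mulLeft K y) :=
    fun x z h => mul_left_cancel₀ H.ne_zero h
  have h2 : (LinearMap.ker (H.π.toLinearMap.domRestrict (component I (d + 1)))).map
      (component I (d + 1)).subtype = (component (colon I y) d).map (LinearMap.mulLeft K y) := by
    ext p
    simp only [Submodule.mem_map, LinearMap.mem_ker, Subtype.exists, LinearMap.mulLeft_apply,
      Submodule.subtype_apply, LinearMap.domRestrict_apply, AlgHom.toLinearMap_apply,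
      exists_and_right, exists_eq_right]
    constructor
    · rintro ⟨hp, h⟩
      obtain ⟨v, rfl⟩ := (H.π_eq_zero p).1 h
      have hv : y * homogeneousComponent d v = v * y := by
        rw [mul_comm, ← homogeneousComponent_mul_add H.hom, homogeneousComponent_eq_self hp.2]
      refine ⟨homogeneousComponent d v, ⟨?_, homogeneousComponent_isHomogeneous d v⟩, hv⟩
      exact mem_colon.2 (hv ▸ hp.1)
    · rintro ⟨v, hv, rfl⟩
      refine ⟨⟨hv.1, ?_⟩, (H.π_eq_zero _).2 ⟨v, mul_comm _ _⟩⟩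
      rw [mul_comm]; exact IsHomogeneous.mul hv.2 H.hom
  have h3 := congrArg (fun S : Submodule K _ => Module.finrank K S) h2
  simp only [finrank_map_of_injective _ hinj,
    finrank_map_of_injective _ (Submodule.injective_subtype _)] at h3
  rw [h3, LinearMap.range_domRestrict, ← h] at h1
  rw [hilb, ← h1, add_comm]; rfl

end Hyperplane

/-- Over an infinite field a homogeneous ideal with no socle admits a linear nonzerodivisor. -/
theorem exists_linForm_nzd [Infinite K] {c : Ideal (MvPolynomial (Fin n) K)} (hc : IsHomog c)
    (h : ∀ d u, u.IsHomogeneous d → (∀ i, X i * u ∈ c) → u ∈ c) :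
    ∃ w : Fin n → K, ∀ u, linForm w * u ∈ c → u ∈ c := by
  have hu : ∀ u, (∀ i, X i * u ∈ c) → u ∈ c := by
    intro u hu
    refine mem_of_forall_homogeneousComponent fun d =>
      h d _ (homogeneousComponent_isHomogeneous d u) fun i => ?_
    rw [mul_comm, ← homogeneousComponent_mul_add (isHomogeneous_X K i), mul_comm]
    exact hc _ (hu i) _
  let M := MvPolynomial (Fin n) K ⧸ c
  have hfin := associatedPrimes.finite (MvPolynomial (Fin n) K) M
  let L : (Fin n → K) →ₗ[K] MvPolynomial (Fin n) K :=
    { toFun := linForm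
      map_add' := fun v w => by simp [linForm, add_mul, sum_add_distrib]
      map_smul' := fun t v => by simp [linForm, smul_eq_C_mul, mul_assoc, Finset.mul_sum] }
  let s : Finset (Subspace K (Fin n → K)) := by
    classical
    exact hfin.toFinset.image fun P => (P.restrictScalars K).comap L
  have hs : ⊤ ∉ s := by
    intro hmem
    obtain ⟨P, hP, hPt⟩ := Finset.mem_image.1 hmem
    obtain ⟨hprime, x, hx⟩ := isAssociatedPrime_iff.1 (hfin.mem_toFinset.1 hP)
    obtain ⟨u, rfl⟩ := Ideal.Quotient.mk_surjective x
    have hmemP : ∀ p, p ∈ P ↔ p * u ∈ c := by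
      intro p
      rw [hx, Submodule.mem_colon_singleton, Submodule.mem_bot, ← Ideal.Quotient.eq_zero_iff_mem]
      rfl
    refine hprime.ne_top ((Ideal.eq_top_iff_one P).2 ((hmemP 1).2 ?_))
    rw [one_mul]
    refine hu u fun i => (hmemP _).1 ?_
    have h1 : Pi.single i (1 : K) ∈ (P.restrictScalars K).comap L := by rw [hPt]; trivial
    have h2 : L (Pi.single i 1) = X i := by
      change linForm _ = _
      simp [linForm, Pi.single_apply]
    rwa [Submodule.mem_comap, h2] at h1
  obtain ⟨w, hw⟩ := (Set.ne_univ_iff_exists_notMem _).1 (Subspace.biUnion_ne_univ_of_top_notMem hs)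
  refine ⟨w, fun u hwu => ?_⟩
  by_contra huc
  have hz : linForm w ∈ ⋃ P ∈ associatedPrimes (MvPolynomial (Fin n) K) M,
      (P : Set (MvPolynomial (Fin n) K)) := by
    rw [biUnion_associatedPrimes_eq_zero_divisors]
    exact ⟨Ideal.Quotient.mk c u, fun h0 => huc (Ideal.Quotient.eq_zero_iff_mem.1 h0),
      Ideal.Quotient.eq_zero_iff_mem.2 hwu⟩
  obtain ⟨P, hP, hwP⟩ := Set.mem_iUnion₂.1 hz
  exact hw (Set.mem_iUnion₂.2 ⟨_, Finset.mem_image.2 ⟨P, hfin.mem_toFinset.2 hP, rfl⟩, hwP⟩)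

end Sections
end CavigliaDeStefani

namespace CavigliaDeStefani

open Finset MvPolynomial

section Socle

variable {K : Type*} [Field K]

theorem mul_mem_of_forall_X_mul_mem {n : ℕ} {c : Ideal (MvPolynomial (Fin n) K)}
    {u : MvPolynomial (Fin n) K} (h : ∀ i, X i * u ∈ c) {p : MvPolynomial (Fin n) K} {d : ℕ}
    (hp : p.IsHomogeneous d) (hd : 0 < d) : p * u ∈ c := by
  rw [p.as_sum, Finset.sum_mul]
  refine sum_mem fun m hm => ?_
  have h1 := isHomogeneous_iff_support.1 hp m hm
  obtain ⟨i, hi⟩ : ∃ i, m i ≠ 0 := by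
    by_contra! h0
    rw [expDeg, sum_eq_zero fun i _ => h0 i] at h1
    omega
  have h2 : monomial m (coeff m p) = monomial (m - Finsupp.single i 1) (coeff m p) * X i := by
    rw [X, monomial_mul, mul_one, tsub_add_cancel_of_le]
    rw [Finsupp.single_le_iff]; omega
  rw [h2, mul_assoc]
  exact c.mul_mem_left _ (h i)

theorem linForm_ne_zero {n r : ℕ} {f : Fin r → MvPolynomial (Fin n) K} {a : Fin r → ℕ}
    (hf : ∀ i, (f i).IsHomogeneous (a i)) (ha : ∀ i, 0 < a i) {y : MvPolynomial (Fin n) K}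
    (hy : ∀ u, y * u ∈ seqIdeal f → u ∈ seqIdeal f) : y ≠ 0 := by
  rintro rfl
  exact one_notMem_seqIdeal hf ha (hy 1 (by simp))

/-- The socle of a complete intersection is concentrated in a single degree. -/
theorem socle_degree [Infinite K] {n r : ℕ} {f : Fin r → MvPolynomial (Fin n) K} {a : Fin r → ℕ}
    (hf : ∀ i, (f i).IsHomogeneous (a i)) (ha : ∀ i, 0 < a i) (hrn : r ≤ n) (hreg : IsRegSeq f)
    {u : MvPolynomial (Fin n) K} {e : ℕ} (hu : u.IsHomogeneous e) (huc : u ∉ seqIdeal f)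
    (hX : ∀ i, X i * u ∈ seqIdeal f) : r = n ∧ e + n = ∑ i, a i := by
  induction n generalizing r e with
  | zero =>
    obtain rfl : r = 0 := by omega
    have hu0 : u ≠ 0 := fun h => huc (h ▸ zero_mem _)
    obtain ⟨m, hm⟩ := exists_coeff_ne_zero hu0
    have := isHomogeneous_iff_support.1 hu m (mem_support_iff.2 hm)
    simpa [expDeg] using this.symm
  | succ n ih =>
    cases r with
    | zero =>
      exfalso
      rw [seqIdeal_zero] at huc hX
      have := hX 0
      rw [Ideal.mem_bot, mul_eq_zero] at this
      exact huc (Ideal.mem_bot.2 (this.resolve_left (X_ne_zero _)))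
    | succ k =>
      have hreg' := isRegSeq_succ_iff.1 hreg
      set g := f (Fin.last k) with hg
      set c := seqIdeal (initSeq f) with hc
      have hcf : seqIdeal f = c ⊔ Ideal.span {g} := seqIdeal_succ f
      have hchom : IsHomog c := isHomog_seqIdeal (a := initSeq a) fun i => hf _
      obtain ⟨w, hw⟩ := exists_linForm_nzd hchom fun d v _ hX => hreg'.2 v (by
        rw [mul_comm]; exact mul_mem_of_forall_X_mul_mem hX (hf (Fin.last k)) (ha _))
      set y := linForm w with hy
      obtain ⟨H⟩ := exists_hyperplane (c := w)
        (linForm_ne_zero (f := initSeq f) (a := initSeq a) (fun i => hf _) (fun i => ha _) hw)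
      obtain ⟨v, hv⟩ : ∃ v, y * u - v * g ∈ c := by
        rw [← mem_sup_span_singleton, ← hcf]
        exact mul_mem_of_forall_X_mul_mem hX (isHomogeneous_linForm w) one_pos
      have hyu : (y * u).IsHomogeneous (e + 1) := by
        rw [mul_comm]; exact hu.mul (isHomogeneous_linForm w)
      have hv := hchom _ hv (e + 1)
      rw [map_sub, homogeneousComponent_eq_self hyu] at hv
      have hle : a (Fin.last k) ≤ e + 1 := by
        by_contra! hlt
        rw [homogeneousComponent_mul_of_lt (hf (Fin.last k)) hlt, sub_zero] at hv
        exact huc (hcf ▸ Ideal.mem_sup_left (hw _ hv))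
      obtain ⟨t, ht⟩ := Nat.exists_eq_add_of_le' hle
      rw [ht, homogeneousComponent_mul_add (hf (Fin.last k))] at hv
      have hvhom := homogeneousComponent_isHomogeneous t v
      set v' := homogeneousComponent t v with hv'
      have key : ∀ p w, p * u - w * g ∈ c → p * v' - w * y ∈ c := by
        intro p w hpw
        refine hreg'.2 _ ?_
        rw [show (p * v' - w * y) * f (Fin.last k) =
          y * (p * u - w * g) - p * (y * u - v' * f (Fin.last k)) by rw [← hg]; ring]
        exact sub_mem (Ideal.mul_mem_left _ _ hpw) (Ideal.mul_mem_left _ _ hv)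
      have hIH := ih (r := k) (f := fun i => H.π (initSeq f i)) (a := initSeq a)
        (fun i => H.π_hom (hf _)) (fun i => ha _) (by omega)
        (H.isRegSeq (a := initSeq a) (fun i => hf _) (fun i => ha _) hreg'.1 hw)
        (H.π_hom hvhom) ?_ ?_
      · rw [Fin.sum_univ_castSucc]
        have := hIH.2
        change t + n = ∑ i : Fin k, a i.castSucc at this
        omega
      · rw [← H.sect_seqIdeal, H.π_mem_sect_iff]
        rintro ⟨w, hw'⟩
        refine huc ?_
        rw [hcf, mem_sup_span_singleton]
        refine ⟨w, hw _ ?_⟩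
        rw [show y * (u - w * g) = (y * u - v' * f (Fin.last k)) + g * (v' - w * y) by
          rw [← hg]; ring]
        exact add_mem hv (Ideal.mul_mem_left _ _ hw')
      · intro i
        rw [← H.sect_seqIdeal, ← H.π_σ (X i), ← map_mul, H.π_mem_sect_iff]
        obtain ⟨w, hw'⟩ : ∃ w, H.σ (X i) * u - w * g ∈ c := by
          rw [← mem_sup_span_singleton, ← hcf]
          exact mul_mem_of_forall_X_mul_mem hX (H.σ_hom (isHomogeneous_X K i)) one_pos
        exact ⟨w, key _ _ hw'⟩

theorem exists_nzd_of_lt [Infinite K] {n r : ℕ} {f : Fin r → MvPolynomial (Fin n) K}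
    {a : Fin r → ℕ} (hf : ∀ i, (f i).IsHomogeneous (a i)) (ha : ∀ i, 0 < a i) (hrn : r < n)
    (hreg : IsRegSeq f) : ∃ w : Fin n → K, linForm w ≠ 0 ∧
      ∀ u, linForm w * u ∈ seqIdeal f → u ∈ seqIdeal f := by
  obtain ⟨w, hw⟩ := exists_linForm_nzd (isHomog_seqIdeal hf) fun d u hu hX => by
    by_contra huc
    exact hrn.ne (socle_degree hf ha hrn.le hreg hu huc hX).1
  exact ⟨w, linForm_ne_zero hf ha hw, hw⟩

theorem box_eq_empty {n : ℕ} {a : Fin n → ℕ} {d : ℕ}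
    (h : ∑ i, (a i - 1) < d) : box (bOf n a) d = ∅ := by
  rw [eq_empty_iff_forall_notMem]
  intro m hm
  obtain ⟨rfl, hbox⟩ := mem_box.1 hm
  refine absurd h (not_lt.2 (sum_le_sum fun i _ => ?_))
  have := hbox i
  simp only [bOf, Fin.is_lt, dite_true] at this
  have h1 : m i < a i := by exact_mod_cast this
  omega

theorem component_eq_top_of_lt {n : ℕ} {f : Fin n → MvPolynomial (Fin n) K} {a : Fin n → ℕ}
    (hf : ∀ i, (f i).IsHomogeneous (a i)) (ha : ∀ i, 0 < a i) (hreg : IsRegSeq f) {d : ℕ}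
    (h : ∑ i, (a i - 1) < d) {p : MvPolynomial (Fin n) K} (hp : p.IsHomogeneous d) :
    p ∈ seqIdeal f := by
  have h1 := hilb_seqIdeal le_rfl hf ha hreg d
  rw [box_eq_empty h, card_empty, add_zero] at h1
  have h2 := component_eq_of_hilb_eq (le_top : seqIdeal f ≤ ⊤) h1.ge
  have : p ∈ component (⊤ : Ideal (MvPolynomial (Fin n) K)) d := ⟨trivial, hp⟩
  rw [← h2] at this
  exact this.1

/-- Every nonzero element of an Artinian complete intersection has a nonzero multiple in the
socle degree. -/
theorem exists_mul_notMem [Infinite K] {n : ℕ} {f : Fin n → MvPolynomial (Fin n) K}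
    {a : Fin n → ℕ} (hf : ∀ i, (f i).IsHomogeneous (a i)) (ha : ∀ i, 0 < a i)
    (hreg : IsRegSeq f) {u : MvPolynomial (Fin n) K} {e e' : ℕ} (hu : u.IsHomogeneous e)
    (huc : u ∉ seqIdeal f) (he : e + e' = ∑ i, (a i - 1)) :
    ∃ g : MvPolynomial (Fin n) K, g.IsHomogeneous e' ∧ g * u ∉ seqIdeal f := by
  induction e' generalizing e u with
  | zero => exact ⟨1, isHomogeneous_one _ _, by rwa [one_mul]⟩
  | succ e' ih =>
    obtain ⟨i, hi⟩ : ∃ i, X i * u ∉ seqIdeal f := by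
      by_contra! hX
      have h1 := (socle_degree hf ha le_rfl hreg hu huc hX).2
      have h2 : ∑ i, (a i - 1) + n = ∑ i, a i := by
        have : ∑ i : Fin n, (a i - 1 + 1) = ∑ i, a i :=
          sum_congr rfl fun i _ => Nat.succ_pred_eq_of_pos (ha i)
        rw [sum_add_distrib] at this
        simpa using this
      omega
    obtain ⟨g, hg, hgu⟩ := ih ((isHomogeneous_X K i).mul hu) hi (by omega)
    exact ⟨g * X i, hg.mul (isHomogeneous_X K i), by rwa [mul_assoc]⟩

end Socle

section Slices

variable {K : Type*} [Field K] {n : ℕ}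

theorem colon_colon_pow (I : Ideal (MvPolynomial (Fin n) K)) (y : MvPolynomial (Fin n) K)
    (j : ℕ) : colon (colon I y) (y ^ j) = colon I (y ^ (j + 1)) := by
  ext p
  rw [mem_colon, mem_colon, mem_colon, pow_succ', mul_assoc]

theorem colon_pow_zero (I : Ideal (MvPolynomial (Fin n) K)) (y : MvPolynomial (Fin n) K) :
    colon I (y ^ 0) = I := by
  ext p; simp

theorem colon_pow_le_succ (I : Ideal (MvPolynomial (Fin n) K)) (y : MvPolynomial (Fin n) K)
    (j : ℕ) : colon I (y ^ j) ≤ colon I (y ^ (j + 1)) := by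
  intro p hp
  rw [mem_colon, pow_succ', mul_assoc]
  exact I.mul_mem_left _ hp

theorem Hyperplane.hilb_eq_sum {y : MvPolynomial (Fin (n + 1)) K} (H : Hyperplane y)
    {I : Ideal (MvPolynomial (Fin (n + 1)) K)} (hI : IsHomog I) (d : ℕ) :
    hilb I d = ∑ e ∈ range (d + 1), hilb (H.sect (colon I (y ^ (d - e)))) e := by
  induction d generalizing I with
  | zero => rw [H.hilb_zero I hI, range_one, sum_singleton, Nat.sub_self, colon_pow_zero]
  | succ d ih =>
    rw [H.hilb_succ I hI, ih (IsHomog.colon hI H.hom), sum_range_succ _ (d + 1), Nat.sub_self,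
      colon_pow_zero]
    congr 1
    refine sum_congr rfl fun e he => ?_
    rw [colon_colon_pow, Nat.sub_add_comm (Nat.lt_succ_iff.1 (mem_range.1 he))]

end Slices

end CavigliaDeStefani

namespace CavigliaDeStefani

open Finset MvPolynomial

section Monomial

variable {K : Type*} [Field K] {n r : ℕ}

theorem isHomog_of_mem_iff {I : Ideal (MvPolynomial (Fin n) K)} {M : Set (Fin n →₀ ℕ)}
    (hI : ∀ p, p ∈ I ↔ ∀ m ∈ p.support, m ∈ M) : IsHomog I := by
  intro p hp d
  refine (hI _).2 fun m hm => (hI p).1 hp m ?_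
  rw [mem_support_iff, coeff_homogeneousComponent] at hm
  rw [mem_support_iff]
  exact fun h => hm (by rw [h, ite_self])

theorem hilb_add_card_box {I : Ideal (MvPolynomial (Fin n) K)} {M : Set (Fin n →₀ ℕ)}
    (hI : ∀ p, p ∈ I ↔ ∀ m ∈ p.support, m ∈ M) {b : Fin n → ℕ∞} {e : ℕ}
    {U : Finset (Fin n →₀ ℕ)} (hU : U ⊆ box b e)
    (hM : ∀ m, expDeg m = e → (m ∈ M ↔ ¬ InBox b m ∨ m ∈ U)) :
    hilb I e + (box b e).card = hilb (⊤ : Ideal (MvPolynomial (Fin n) K)) e + U.card := by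
  have htop : ∀ m, m ∈ box (fun _ : Fin n => ⊤) e ↔ expDeg m = e := fun m => by simp [InBox]
  have hsub : box b e ⊆ box (fun _ : Fin n => ⊤) e := fun m hm => (htop m).2 (mem_box.1 hm).1
  have h1 := hilb_eq_card hI (d := e) (s := (box (fun _ : Fin n => ⊤) e \ box b e) ∪ U) fun m => by
    rw [mem_union, mem_sdiff, htop, mem_box]
    constructor
    · rintro (⟨h, h'⟩ | h)
      · exact ⟨h, (hM m h).2 (Or.inl fun hb => h' ⟨h, hb⟩)⟩
      · have := (mem_box.1 (hU h)).1
        exact ⟨this, (hM m this).2 (Or.inr h)⟩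
    · rintro ⟨h, h'⟩
      exact ((hM m h).1 h').imp (fun hb => ⟨h, fun h2 => hb h2.2⟩) id
  rw [h1, hilb_top, card_union_of_disjoint (disjoint_left.2 fun m h h' =>
    (mem_sdiff.1 h).2 (hU h')), ← card_sdiff_add_card_eq_card hsub]
  omega

/-- The pure powers, as a sequence. -/
noncomputable def powSeq (K : Type*) [Field K] (hrn : r ≤ n) (a : Fin r → ℕ) :
    Fin r → MvPolynomial (Fin n) K := fun i => X (Fin.castLE hrn i) ^ a i

theorem isHomogeneous_powSeq (hrn : r ≤ n) (a : Fin r → ℕ) (i : Fin r) :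
    (powSeq K hrn a i).IsHomogeneous (a i) := isHomogeneous_X_pow _ _

theorem not_inBox_iff (hrn : r ≤ n) (a : Fin r → ℕ) (m : Fin n →₀ ℕ) :
    ¬ InBox (bOf n a) m ↔ ∃ i, a i ≤ m (Fin.castLE hrn i) := by
  rw [InBox, not_forall]
  constructor
  · rintro ⟨i, hi⟩
    by_cases h : (i : ℕ) < r
    · refine ⟨⟨i, h⟩, ?_⟩
      simp only [bOf, h, dite_true, not_lt] at hi
      exact_mod_cast hi
    · simp [bOf, h] at hi
  · rintro ⟨i, hi⟩
    refine ⟨Fin.castLE hrn i, ?_⟩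
    simpa [bOf] using hi

theorem mem_seqIdeal_powSeq (hrn : r ≤ n) (a : Fin r → ℕ) (p : MvPolynomial (Fin n) K) :
    p ∈ seqIdeal (powSeq K hrn a) ↔ ∀ m ∈ p.support, ¬ InBox (bOf n a) m := by
  have h : Set.range (powSeq K hrn a) = (fun m => (monomial m (1 : K) : MvPolynomial (Fin n) K)) ''
      Set.range fun i : Fin r => Finsupp.single (Fin.castLE hrn i) (a i) := by
    rw [← Set.range_comp]
    congr 1
    ext1 i
    simp [powSeq, X_pow_eq_monomial]
  rw [seqIdeal, h, mem_ideal_span_monomial_image]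
  simp [not_inBox_iff hrn]

theorem isRegSeq_powSeq (hrn : r ≤ n) (a : Fin r → ℕ) : IsRegSeq (powSeq K hrn a) := by
  induction r with
  | zero => exact fun i => i.elim0
  | succ k ih =>
    have h1 : initSeq (powSeq K hrn a) = powSeq K (by omega) (initSeq a) := rfl
    set e : Fin n →₀ ℕ := Finsupp.single ⟨k, hrn⟩ (a (Fin.last k)) with he
    have h2 : powSeq K hrn a (Fin.last k) = monomial e 1 := X_pow_eq_monomial
    refine isRegSeq_succ_iff.2 ⟨h1 ▸ ih _ _, fun g hg => ?_⟩
    rw [h2, h1, mem_seqIdeal_powSeq] at hg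
    rw [h1, mem_seqIdeal_powSeq]
    intro m hm hbox
    refine hg (m + e) ?_ fun i => ?_
    · rw [mem_support_iff, coeff_mul_monomial, mul_one]
      exact mem_support_iff.1 hm
    · by_cases hi : i = ⟨k, hrn⟩
      · subst hi
        simp only [bOf, lt_irrefl, dite_false]
        exact ENat.natCast_lt_top _
      · simpa [he, Finsupp.single_apply, Ne.symm hi] using hbox i

/-- The exponents of the monomials in the ideal spanned by a subset `S` of a box and the
monomials out of the box, truncated after the degree following that of `S`. -/
def blockSet (b : Fin n → ℕ∞) (d : ℕ) (S : Finset (Fin n →₀ ℕ)) : Set (Fin n →₀ ℕ) :=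
  {m | ¬ InBox b m ∨ m ∈ S ∨ m ∈ up b S ∨ d + 2 ≤ expDeg m}

theorem isUpperSet_blockSet {b : Fin n → ℕ∞} {d : ℕ} {S : Finset (Fin n →₀ ℕ)}
    (hS : S ⊆ box b d) : IsUpperSet (blockSet b d S) := by
  intro m w hmw hm
  by_cases hw : InBox b w
  swap
  · exact Or.inl hw
  have hdeg := expDeg_mono hmw
  rcases hm with hm | hm | hm | hm
  · exact absurd (hw.mono hmw) hm
  · have hd := (mem_box.1 (hS hm)).1
    rcases Nat.lt_or_ge (expDeg w) (d + 1) with h | h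
    · rw [← eq_of_le_of_expDeg hmw (by omega)]
      exact Or.inr (Or.inl hm)
    rcases Nat.lt_or_ge (expDeg w) (d + 2) with h' | h'
    · refine Or.inr (Or.inr (Or.inl (mem_up.2 ⟨hw, m, hm, ?_⟩)))
      obtain ⟨v, rfl⟩ := exists_add_of_le hmw
      rw [expDeg_add] at h h'
      obtain ⟨i, hi⟩ : ∃ i, v i ≠ 0 := by
        by_contra! h0
        have : expDeg v = 0 := sum_eq_zero fun i _ => h0 i
        omega
      have hle : Finsupp.single i 1 ≤ v := by rw [Finsupp.single_le_iff]; omega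
      exact ⟨i, by rw [eq_of_le_of_expDeg hle (by rw [expDeg_single]; omega)]⟩
    · exact Or.inr (Or.inr (Or.inr h'))
  · have hd := (mem_box.1 (up_subset_box hS hm)).1
    rcases Nat.lt_or_ge (expDeg w) (d + 2) with h' | h'
    · rw [← eq_of_le_of_expDeg hmw (by omega)]
      exact Or.inr (Or.inr (Or.inl hm))
    · exact Or.inr (Or.inr (Or.inr h'))
  · exact Or.inr (Or.inr (Or.inr (hm.trans hdeg)))

theorem mem_blockSet_self {b : Fin n → ℕ∞} {d : ℕ} {S : Finset (Fin n →₀ ℕ)}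
    (hS : S ⊆ box b d) {m : Fin n →₀ ℕ} (hm : expDeg m = d) :
    m ∈ blockSet b d S ↔ ¬ InBox b m ∨ m ∈ S := by
  refine or_congr_right ⟨?_, Or.inl⟩
  rintro (h | h | h)
  · exact h
  · have := (mem_box.1 (up_subset_box hS h)).1; omega
  · omega

theorem mem_blockSet_succ {b : Fin n → ℕ∞} {d : ℕ} {S : Finset (Fin n →₀ ℕ)}
    (hS : S ⊆ box b d) {m : Fin n →₀ ℕ} (hm : expDeg m = d + 1) :
    m ∈ blockSet b d S ↔ ¬ InBox b m ∨ m ∈ up b S := by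
  refine or_congr_right ⟨?_, fun h => Or.inr (Or.inl h)⟩
  rintro (h | h | h)
  · have := (mem_box.1 (hS h)).1; omega
  · exact h
  · omega

/-- The monomial ideal with exponents in `blockSet`. -/
noncomputable def blockIdeal (K : Type*) [Field K] {b : Fin n → ℕ∞} {d : ℕ}
    {S : Finset (Fin n →₀ ℕ)} (hS : S ⊆ box b d) : Ideal (MvPolynomial (Fin n) K) :=
  restrictSupportIdeal K (blockSet b d S) (isUpperSet_blockSet hS)

theorem mem_blockIdeal {b : Fin n → ℕ∞} {d : ℕ} {S : Finset (Fin n →₀ ℕ)} (hS : S ⊆ box b d)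
    (p : MvPolynomial (Fin n) K) :
    p ∈ blockIdeal K hS ↔ ∀ m ∈ p.support, m ∈ blockSet b d S := Iff.rfl

theorem hilb_blockIdeal_self {b : Fin n → ℕ∞} {d : ℕ} {S : Finset (Fin n →₀ ℕ)}
    (hS : S ⊆ box b d) : hilb (blockIdeal K hS) d + (box b d).card =
      hilb (⊤ : Ideal (MvPolynomial (Fin n) K)) d + S.card :=
  hilb_add_card_box (mem_blockIdeal hS) hS fun _ hm => mem_blockSet_self hS hm

theorem hilb_blockIdeal_succ {b : Fin n → ℕ∞} {d : ℕ} {S : Finset (Fin n →₀ ℕ)}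
    (hS : S ⊆ box b d) : hilb (blockIdeal K hS) (d + 1) + (box b (d + 1)).card =
      hilb (⊤ : Ideal (MvPolynomial (Fin n) K)) (d + 1) + (up b S).card :=
  hilb_add_card_box (mem_blockIdeal hS) (up_subset_box hS) fun _ hm => mem_blockSet_succ hS hm

variable (K n) in
/-- The numerical form of the EGH property for all ideals containing a regular sequence of
degree `a`. -/
def Growth (a : Fin r → ℕ) : Prop :=
  ∀ (I : Ideal (MvPolynomial (Fin n) K)) (f : Fin r → MvPolynomial (Fin n) K), IsHomog I →
    (∀ i, f i ∈ I) → IsRegSeq f → (∀ i, (f i).IsHomogeneous (a i)) →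
    ∀ (d : ℕ) (S : Finset (Fin n →₀ ℕ)), LexTop (bOf n a) d S →
      S.card + hilb (seqIdeal f) d ≤ hilb I d →
      (up (bOf n a) S).card + hilb (seqIdeal f) (d + 1) ≤ hilb I (d + 1)

theorem Growth.cl {a : Fin r → ℕ} (h : Growth K n a) (hrn : r ≤ n) (ha : ∀ i, 0 < a i) :
    CL (bOf n a) := by
  intro d S T hS hT hTS
  have hf := isHomogeneous_powSeq (K := K) hrn a
  have hreg := isRegSeq_powSeq (K := K) hrn a
  have h0 := hilb_seqIdeal hrn hf ha hreg d
  have h1 := hilb_seqIdeal hrn hf ha hreg (d + 1)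
  have h2 := hilb_blockIdeal_self (K := K) hS
  have h3 := hilb_blockIdeal_succ (K := K) hS
  have hle : seqIdeal (powSeq K hrn a) ≤ blockIdeal K hS := fun p hp =>
    (mem_blockIdeal hS p).2 fun m hm => Or.inl ((mem_seqIdeal_powSeq hrn a p).1 hp m hm)
  have := h _ _ (isHomog_of_mem_iff (mem_blockIdeal hS)) (fun i => hle (mem_seqIdeal _ i)) hreg hf
    d T hT (by omega)
  omega

end Monomial

end CavigliaDeStefani

namespace CavigliaDeStefani

open Finset MvPolynomial

section Slicing

variable {K : Type*} [Field K] {n r : ℕ}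

theorem colon_pow_eq_self {c : Ideal (MvPolynomial (Fin n) K)} {y : MvPolynomial (Fin n) K}
    (hy : ∀ u, y * u ∈ c → u ∈ c) (j : ℕ) : colon c (y ^ j) = c := by
  induction j with
  | zero => exact colon_pow_zero c y
  | succ j ih =>
    rw [← colon_colon_pow, show colon c y = c from le_antisymm (fun u hu => hy u hu) (le_colon c y),
      ih]

theorem bOf_castSucc (n : ℕ) (a : Fin r → ℕ) :
    (fun i : Fin n => bOf (n + 1) a i.castSucc) = bOf n a := rfl

theorem bOf_last (hrn : r ≤ n) (a : Fin r → ℕ) : bOf (n + 1) a (Fin.last n) = ⊤ := by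
  simp [bOf, hrn]

theorem card_nab_biUnion_le (b : Fin n → ℕ∞) {d : ℕ} {U : ℕ → Finset (Fin n →₀ ℕ)}
    (hU : ∀ e, LexTop b e (U e)) :
    (nab b ((range (d + 1)).biUnion U)).card ≤ (U 0).card +
      ∑ e ∈ range (d + 1), max (U (e + 1)).card (up b (U e)).card := by
  have hsub : nab b ((range (d + 1)).biUnion U) ⊆
      U 0 ∪ (range (d + 1)).biUnion fun e => U (e + 1) ∪ up b (U e) := by
    intro w hw
    simp only [mem_union, mem_biUnion, mem_range]
    rcases mem_union.1 hw with hw | hw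
    · obtain ⟨e, he, hw⟩ := mem_biUnion.1 hw
      cases e with
      | zero => exact Or.inl hw
      | succ e => exact Or.inr ⟨e, by have := mem_range.1 he; omega, Or.inl hw⟩
    · obtain ⟨hw, m, hm, i, rfl⟩ := mem_up.1 hw
      obtain ⟨e, he, hm⟩ := mem_biUnion.1 hm
      exact Or.inr ⟨e, mem_range.1 he, Or.inr (mem_up.2 ⟨hw, m, hm, i, rfl⟩)⟩
  refine (card_le_card hsub).trans ((card_union_le _ _).trans (Nat.add_le_add_left ?_ _))
  refine card_biUnion_le.trans (sum_le_sum fun e _ => ?_)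
  rw [(hU (e + 1)).card_union (LexTop.up (hU e))]

/-- The growth property is inherited by polynomial rings with one more variable. -/
theorem Growth.succ [Infinite K] {a : Fin r → ℕ} (h : Growth K n a) (hrn : r ≤ n)
    (ha : ∀ i, 0 < a i) : Growth K (n + 1) a := by
  intro I f hI hfI hreg hf d T hT hTI
  obtain ⟨w, hw0, hw⟩ := exists_nzd_of_lt hf ha (Nat.lt_succ_of_le hrn) hreg
  obtain ⟨H⟩ := exists_hyperplane hw0
  set y := linForm w with hy
  set f' := fun i => H.π (f i) with hf'
  set b := bOf n a with hb
  have hf'hom : ∀ i, (f' i).IsHomogeneous (a i) := fun i => H.π_hom (hf i)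
  have hreg' : IsRegSeq f' := H.isRegSeq hf ha hreg hw
  let Q : ℕ → Ideal (MvPolynomial (Fin n) K) := fun j => H.sect (colon I (y ^ j))
  have hQhom : ∀ j, IsHomog (Q j) := fun j =>
    H.isHomog_sect (IsHomog.colon hI ((isHomogeneous_linForm w).pow j))
  have hQmono : ∀ j, Q j ≤ Q (j + 1) := fun j => H.sect_mono (colon_pow_le_succ I y j)
  have hf'Q : ∀ j i, f' i ∈ Q j := fun j i =>
    H.mem_sect.2 ⟨f i, le_colon I _ (hfI i), rfl⟩
  have hc : ∀ d, hilb (seqIdeal f) d = ∑ e ∈ range (d + 1), hilb (seqIdeal f') e := by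
    intro d
    rw [H.hilb_eq_sum (isHomog_seqIdeal hf) d]
    refine sum_congr rfl fun e _ => ?_
    rw [colon_pow_eq_self hw, H.sect_seqIdeal]
  have hcQ : ∀ j, seqIdeal f' ≤ Q j := fun j => by
    rw [seqIdeal, Ideal.span_le]
    rintro _ ⟨i, rfl⟩
    exact hf'Q j i
  have hex : ∀ e, ∃ U : Finset (Fin n →₀ ℕ), LexTop b e U ∧
      (e ≤ d → U.card + hilb (seqIdeal f') e = hilb (Q (d - e)) e) ∧ (d < e → U = ∅) := by
    intro e
    by_cases he : e ≤ d
    · have h1 := hilb_seqIdeal hrn hf'hom ha hreg' e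
      rw [← hb] at h1
      have h2 : hilb (Q (d - e)) e ≤ _ := hilb_mono le_top e
      have h3 := hilb_mono (hcQ (d - e)) e
      obtain ⟨U, hU, hUc⟩ := exists_isTop toLex (box b e) (injOn_toLex _)
        (k := hilb (Q (d - e)) e - hilb (seqIdeal f') e) (by omega)
      exact ⟨U, hU, fun _ => by omega, fun h => by omega⟩
    · exact ⟨∅, isTop_empty _ _, fun h => absurd h he, fun _ => rfl⟩
  choose U hU hUc hUe using hex
  have hScard : ((range (d + 1)).biUnion U).card = ∑ e ∈ range (d + 1), (U e).card := by
    refine card_biUnion fun e _ e' _ hne => disjoint_left.2 fun m hm hm' => hne ?_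
    rw [← (mem_box.1 ((hU e).1 hm)).1, (mem_box.1 ((hU e').1 hm')).1]
  have hsum : ((range (d + 1)).biUnion U).card + hilb (seqIdeal f) d = hilb I d := by
    rw [hScard, hc, H.hilb_eq_sum hI d, ← sum_add_distrib]
    exact sum_congr rfl fun e he => hUc e (Nat.lt_succ_iff.1 (mem_range.1 he))
  have hSsub : (range (d + 1)).biUnion U ⊆ boxLE b d := by
    intro m hm
    obtain ⟨e, he, hm⟩ := mem_biUnion.1 hm
    obtain ⟨h1, h2⟩ := mem_box.1 ((hU e).1 hm)
    exact mem_boxLE.2 ⟨by have := mem_range.1 he; omega, h2⟩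
  have hup := card_up_le_card_nab (bOf_last hrn a) (h.cl hrn ha) hSsub hT (by omega)
  have hnab := card_nab_biUnion_le b hU (d := d)
  rw [bOf_castSucc, ← hb] at hup
  have hI' := H.hilb_eq_sum hI (d + 1)
  rw [sum_range_succ'] at hI'
  replace hI' : hilb I (d + 1) = ∑ e ∈ range (d + 1), hilb (Q (d + 1 - (e + 1))) (e + 1) +
      hilb (Q (d + 1 - 0)) 0 := hI'
  have hc' := hc (d + 1)
  rw [sum_range_succ'] at hc'
  have h0 : (U 0).card + hilb (seqIdeal f') 0 ≤ hilb (Q (d + 1 - 0)) 0 := by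
    rw [hUc 0 (Nat.zero_le d)]
    exact hilb_mono (hQmono d) 0
  have hstep : ∑ e ∈ range (d + 1), max (U (e + 1)).card (up b (U e)).card +
      ∑ e ∈ range (d + 1), hilb (seqIdeal f') (e + 1) ≤
      ∑ e ∈ range (d + 1), hilb (Q (d + 1 - (e + 1))) (e + 1) := by
    rw [← sum_add_distrib]
    refine sum_le_sum fun e he => ?_
    have he' : e ≤ d := Nat.lt_succ_iff.1 (mem_range.1 he)
    rw [Nat.add_sub_add_right]
    have h1 := h (Q (d - e)) f' (hQhom _) (hf'Q _) hreg' hf'hom e (U e) (hU e) (hUc e he').le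
    have h2 : (U (e + 1)).card + hilb (seqIdeal f') (e + 1) ≤ hilb (Q (d - e)) (e + 1) := by
      by_cases hed : e + 1 ≤ d
      · rw [hUc (e + 1) hed, show d - e = d - (e + 1) + 1 by omega]
        exact hilb_mono (hQmono _) _
      · rw [hUe (e + 1) (by omega), card_empty, zero_add]
        exact hilb_mono (hcQ _) _
    rcases max_choice (U (e + 1)).card (up b (U e)).card with hm | hm <;> rw [hm] <;> assumption
  omega

end Slicing

end CavigliaDeStefani

namespace CavigliaDeStefani

open Finset MvPolynomial

section Linkage

theorem finrank_ker_add_finrank {K V W : Type*} [Field K] [AddCommGroup V] [Module K V]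
    [AddCommGroup W] [Module K W] [FiniteDimensional K V] [FiniteDimensional K W]
    (B : V →ₗ[K] W →ₗ[K] K) :
    Module.finrank K (LinearMap.ker B) + Module.finrank K W =
      Module.finrank K (LinearMap.ker B.flip) + Module.finrank K V := by
  have h1 := B.finrank_range_add_finrank_ker
  have h2 := B.flip.finrank_range_add_finrank_ker
  have h3 : LinearMap.range B.flip = LinearMap.range (Module.Dual.transpose (R := K) B) := by
    have : B.flip = (Module.Dual.transpose (R := K) B) ∘ₗ (Module.evalEquiv K W).toLinearMap := by
      ext w v; rfl
    rw [this, LinearMap.range_comp, LinearEquiv.range, Submodule.map_top]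
  have h4 : Module.finrank K (LinearMap.range B.flip) = Module.finrank K (LinearMap.range B) := by
    rw [h3]
    exact LinearMap.finrank_range_dualMap_eq_finrank_range B
  omega

variable {K : Type*} [Field K] {n : ℕ}

/-- The ideal linked to `I` by `c`. -/
noncomputable def link (c I : Ideal (MvPolynomial (Fin n) K)) : Ideal (MvPolynomial (Fin n) K) where
  carrier := {g | ∀ h ∈ I, g * h ∈ c}
  add_mem' hx hy h hh := by rw [add_mul]; exact add_mem (hx h hh) (hy h hh)
  zero_mem' h _ := by rw [zero_mul]; exact zero_mem _
  smul_mem' x y hy h hh := by rw [smul_eq_mul, mul_assoc]; exact c.mul_mem_left _ (hy h hh)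

theorem le_link (c I : Ideal (MvPolynomial (Fin n) K)) : c ≤ link c I :=
  fun _ hg _ _ => c.mul_mem_right _ hg

theorem mem_link_of_forall_isHomogeneous {c I : Ideal (MvPolynomial (Fin n) K)} (hI : IsHomog I)
    {g : MvPolynomial (Fin n) K} (h : ∀ p ∈ I, ∀ e, p.IsHomogeneous e → g * p ∈ c) :
    g ∈ link c I := by
  intro p hp
  rw [← sum_homogeneousComponent p, mul_sum]
  exact sum_mem fun e _ => h _ (hI p hp e) e (homogeneousComponent_isHomogeneous e p)

theorem isHomog_link {c I : Ideal (MvPolynomial (Fin n) K)} (hc : IsHomog c) (hI : IsHomog I) :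
    IsHomog (link c I) := by
  intro g hg d
  refine mem_link_of_forall_isHomogeneous hI fun p hp e he => ?_
  rw [← homogeneousComponent_mul_add he]
  exact hc _ (hg p hp) _

theorem card_box_sum (a : Fin n → ℕ) (ha : ∀ i, 0 < a i) :
    (box (bOf n a) (∑ i, (a i - 1))).card = 1 := by
  rw [card_eq_one]
  refine ⟨Finsupp.equivFunOnFinite.symm fun i => a i - 1, ?_⟩
  ext m
  rw [mem_box, mem_singleton]
  have hb : InBox (bOf n a) m ↔ ∀ i, m i ≤ a i - 1 := by
    refine forall_congr' fun i => ?_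
    simp only [bOf, Fin.is_lt, dite_true, Fin.eta]
    rw [Nat.cast_lt]
    have := ha i
    omega
  rw [hb]
  constructor
  · rintro ⟨h1, h2⟩
    refine eq_of_le_of_expDeg (fun i => h2 i) ?_
    rw [h1]; rfl
  · rintro rfl
    exact ⟨rfl, fun i => le_rfl⟩

/-- Duality in an Artinian complete intersection. -/
theorem hilb_link_add [Infinite K] {f : Fin n → MvPolynomial (Fin n) K} {a : Fin n → ℕ}
    (hf : ∀ i, (f i).IsHomogeneous (a i)) (ha : ∀ i, 0 < a i) (hreg : IsRegSeq f)
    {I : Ideal (MvPolynomial (Fin n) K)} (hI : IsHomog I) (hfI : ∀ i, f i ∈ I) {e e' : ℕ}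
    (he : e + e' = ∑ i, (a i - 1)) :
    hilb (link (seqIdeal f) I) e' + hilb I e =
      hilb (⊤ : Ideal (MvPolynomial (Fin n) K)) e' + hilb (seqIdeal f) e := by
  set s := ∑ i, (a i - 1) with hs
  set c := seqIdeal f with hc
  have hcI : c ≤ I := by
    rw [hc, seqIdeal, Ideal.span_le]
    rintro _ ⟨i, rfl⟩
    exact hfI i
  obtain ⟨φ, hφ⟩ : ∃ φ : MvPolynomial (Fin n) K →ₗ[K] K,
      ∀ p : MvPolynomial (Fin n) K, p.IsHomogeneous s → (φ p = 0 ↔ p ∈ c) := by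
    have h1 := hilb_seqIdeal le_rfl hf ha hreg s
    rw [hs, card_box_sum a ha, ← hs] at h1
    let W := homogeneousSubmodule (Fin n) K s
    let C : Submodule K W := (Submodule.restrictScalars K c).comap W.subtype
    have hC : Module.finrank K C = hilb c s := by
      have : C.map W.subtype = component c s := by
        rw [Submodule.map_comap_eq, Submodule.range_subtype, inf_comm]; rfl
      rw [hilb, ← this]
      exact (finrank_map_of_injective _ W.injective_subtype C).symm
    have hW : Module.finrank K W = hilb (⊤ : Ideal (MvPolynomial (Fin n) K)) s := by
      rw [hilb, component_top]
    have h2 : Module.finrank K (W ⧸ C) + hilb c s =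
        hilb (⊤ : Ideal (MvPolynomial (Fin n) K)) s := by
      rw [← hC, ← hW]; exact C.finrank_quotient_add_finrank
    have h3 : Module.finrank K (W ⧸ C) = Module.finrank K K :=
      (Nat.add_right_cancel (h2.trans (h1.symm.trans (add_comm _ _)))).trans
        (Module.finrank_self K).symm
    let eqv := LinearEquiv.ofFinrankEq (W ⧸ C) K h3
    obtain ⟨φ, hφ⟩ := LinearMap.exists_extend (eqv.toLinearMap ∘ₗ C.mkQ)
    refine ⟨φ, fun p hp => ?_⟩
    have h4 : φ p = eqv (C.mkQ ⟨p, hp⟩) := LinearMap.congr_fun hφ ⟨p, hp⟩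
    rw [h4, LinearEquiv.map_eq_zero_iff, Submodule.mkQ_apply, Submodule.Quotient.mk_eq_zero]
    rfl
  let V := homogeneousSubmodule (Fin n) K e'
  let W := component I e
  let B : V →ₗ[K] W →ₗ[K] K :=
    ((LinearMap.mul K (MvPolynomial (Fin n) K)).compr₂ φ).domRestrict₁₂ V W
  have hB : ∀ (g : V) (h : W), B g h = 0 ↔ (g : MvPolynomial (Fin n) K) * h ∈ c := by
    intro g h
    refine hφ _ ?_
    rw [← he, add_comm]
    exact IsHomogeneous.mul g.2 h.2.2
  have hker : (LinearMap.ker B).map V.subtype = component (link c I) e' := by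
    ext g
    rw [Submodule.mem_map, mem_component]
    constructor
    · rintro ⟨⟨g, hg⟩, hgk, rfl⟩
      refine ⟨mem_link_of_forall_isHomogeneous hI fun p hp j hj => ?_, hg⟩
      by_contra hgp
      have hdeg : e' + j ≤ s := by
        by_contra! hlt
        exact hgp (component_eq_top_of_lt hf ha hreg hlt (IsHomogeneous.mul hg hj))
      obtain ⟨k, hk, hkg⟩ := exists_mul_notMem hf ha hreg (e' := e - j) (IsHomogeneous.mul hg hj)
        hgp (by omega)
      refine hkg ?_
      have h1 : B ⟨g, hg⟩ ⟨k * p, I.mul_mem_left _ hp, by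
          have := hk.mul hj
          rwa [Nat.sub_add_cancel (by omega)] at this⟩ = 0 := by
        rw [LinearMap.mem_ker.1 hgk]; rfl
      rw [hB] at h1
      rw [mul_left_comm]
      exact h1
    · rintro ⟨hg, hgh⟩
      refine ⟨⟨g, hgh⟩, ?_, rfl⟩
      rw [LinearMap.mem_ker]
      ext h
      exact (hB _ _).2 (hg _ h.2.1)
  have hker' : (LinearMap.ker B.flip).map W.subtype = component c e := by
    ext h
    rw [Submodule.mem_map, mem_component]
    constructor
    · rintro ⟨⟨h, hh⟩, hhk, rfl⟩
      refine ⟨?_, hh.2⟩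
      by_contra hhc
      obtain ⟨k, hk, hkh⟩ := exists_mul_notMem hf ha hreg hh.2 hhc he
      refine hkh ((hB ⟨k, hk⟩ ⟨h, hh⟩).1 ?_)
      exact LinearMap.congr_fun (LinearMap.mem_ker.1 hhk) ⟨k, hk⟩
    · rintro ⟨hh, hhh⟩
      refine ⟨⟨h, hcI hh, hhh⟩, ?_, rfl⟩
      rw [LinearMap.mem_ker]
      ext g
      exact (hB _ _).2 (c.mul_mem_left _ hh)
  have h1 := finrank_ker_add_finrank B
  rw [← finrank_map_of_injective _ V.injective_subtype, hker,
    ← finrank_map_of_injective _ W.injective_subtype, hker', add_comm (Module.finrank K _)] at h1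
  rw [hilb, hilb, hilb, hilb, component_top]
  exact (add_comm _ _).trans (h1.trans (add_comm _ _))

end Linkage

end CavigliaDeStefani

namespace CavigliaDeStefani

open Finset MvPolynomial

section Reversal

variable {n : ℕ} {a : Fin n → ℕ}

theorem inBox_bOf (ha : ∀ i, 0 < a i) {m : Fin n →₀ ℕ} :
    InBox (bOf n a) m ↔ ∀ i, m i ≤ a i - 1 := by
  refine forall_congr' fun i => ?_
  simp only [bOf, Fin.is_lt, dite_true, Fin.eta]
  rw [Nat.cast_lt]
  have := ha i
  omega

/-- The complement of an exponent vector in the box `∏ [0, a i - 1]`. -/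
noncomputable def rev (a : Fin n → ℕ) (m : Fin n →₀ ℕ) : Fin n →₀ ℕ :=
  Finsupp.equivFunOnFinite.symm fun i => a i - 1 - m i

theorem rev_apply (a : Fin n → ℕ) (m : Fin n →₀ ℕ) (i : Fin n) : rev a m i = a i - 1 - m i := rfl

theorem rev_rev (ha : ∀ i, 0 < a i) {m : Fin n →₀ ℕ} (hm : InBox (bOf n a) m) :
    rev a (rev a m) = m := by
  ext i
  have := (inBox_bOf ha).1 hm i
  rw [rev_apply, rev_apply]; omega

theorem rev_mem_box (ha : ∀ i, 0 < a i) {m : Fin n →₀ ℕ} {d d' : ℕ} (hm : m ∈ box (bOf n a) d)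
    (hd : d + d' = ∑ i, (a i - 1)) : rev a m ∈ box (bOf n a) d' := by
  obtain ⟨h1, h2⟩ := mem_box.1 hm
  refine mem_box.2 ⟨?_, (inBox_bOf ha).2 fun i => Nat.sub_le _ _⟩
  have h3 : expDeg (rev a m) + expDeg m = ∑ i, (a i - 1) := by
    rw [expDeg, expDeg, ← sum_add_distrib]
    refine sum_congr rfl fun i _ => ?_
    have := (inBox_bOf ha).1 h2 i
    rw [rev_apply]; omega
  omega

theorem image_rev_box (ha : ∀ i, 0 < a i) {d d' : ℕ} (hd : d + d' = ∑ i, (a i - 1)) :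
    (box (bOf n a) d).image (rev a) = box (bOf n a) d' := by
  ext m
  rw [mem_image]
  constructor
  · rintro ⟨m, hm, rfl⟩
    exact rev_mem_box ha hm hd
  · intro hm
    exact ⟨rev a m, rev_mem_box ha hm (by omega), rev_rev ha (mem_box.1 hm).2⟩

theorem injOn_rev (ha : ∀ i, 0 < a i) (d : ℕ) : Set.InjOn (rev a) (box (bOf n a) d) := by
  intro m hm m' hm' h
  rw [← rev_rev ha (mem_box.1 hm).2, h, rev_rev ha (mem_box.1 hm').2]

theorem card_image_rev (ha : ∀ i, 0 < a i) {d : ℕ} {S : Finset (Fin n →₀ ℕ)}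
    (hS : S ⊆ box (bOf n a) d) : (S.image (rev a)).card = S.card :=
  card_image_of_injOn fun _ hm _ hm' => injOn_rev ha d (hS hm) (hS hm')

theorem card_box_rev (ha : ∀ i, 0 < a i) {d d' : ℕ} (hd : d + d' = ∑ i, (a i - 1)) :
    (box (bOf n a) d).card = (box (bOf n a) d').card := by
  rw [← image_rev_box ha hd, card_image_rev ha Subset.rfl]

theorem toLex_rev_le (ha : ∀ i, 0 < a i) {m m' : Fin n →₀ ℕ} (hm' : InBox (bOf n a) m')
    (h : toLex m ≤ toLex m') : toLex (rev a m') ≤ toLex (rev a m) := by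
  rcases h.eq_or_lt with h | h
  · rw [toLex_inj.1 h]
  · obtain ⟨i, h1, h2⟩ := toLex_lt_iff.1 h
    refine (toLex_lt_iff.2 ⟨i, fun j hj => ?_, ?_⟩).le
    · rw [rev_apply, rev_apply, h1 j hj]
    · have := (inBox_bOf ha).1 hm' i
      rw [rev_apply, rev_apply]; omega

theorem rev_add_single (ha : ∀ i, 0 < a i) {m : Fin n →₀ ℕ} {i : Fin n}
    (h : InBox (bOf n a) (m + Finsupp.single i 1)) :
    rev a m = rev a (m + Finsupp.single i 1) + Finsupp.single i 1 := by
  ext j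
  have := (inBox_bOf ha).1 h j
  rw [Finsupp.add_apply] at this
  simp only [rev_apply, Finsupp.add_apply]
  by_cases hj : j = i
  · subst hj; simp only [Finsupp.single_eq_same] at *; omega
  · rw [Finsupp.single_eq_of_ne hj] at *; omega

theorem exists_eq_add_single {m u : Fin n →₀ ℕ} (h : m ≤ u) (hd : expDeg u = expDeg m + 1) :
    ∃ i, u = m + Finsupp.single i 1 := by
  obtain ⟨v, rfl⟩ := exists_add_of_le h
  rw [expDeg_add] at hd
  obtain ⟨i, hi, -⟩ := exists_last (m := v) (by omega)
  refine ⟨i, congrArg (m + ·) (eq_of_le_of_expDeg ?_ ?_).symm⟩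
  · rw [Finsupp.single_le_iff]; omega
  · rw [expDeg_single]; omega

theorem exists_dual_top (ha : ∀ i, 0 < a i) {d d' : ℕ} (hd : d + d' + 1 = ∑ i, (a i - 1))
    {S : Finset (Fin n →₀ ℕ)} (hS : LexTop (bOf n a) d S) (hne : (up (bOf n a) S).Nonempty) :
    ∃ S', LexTop (bOf n a) d' S' ∧
      S'.card + (up (bOf n a) S).card = (box (bOf n a) (d + 1)).card + 1 ∧
      (box (bOf n a) d).card + 1 ≤ S.card + (up (bOf n a) S').card := by
  set b := bOf n a with hb
  have hupS := LexTop.up hS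
  obtain ⟨w₀, hw₀, hmin⟩ := exists_min_image (up b S) toLex hne
  obtain ⟨hw₀b, m₀, hm₀, k, hk⟩ := mem_up.1 hw₀
  set T := (up b S).erase w₀ with hT
  have hTsub : T ⊆ box b (d + 1) := (erase_subset _ _).trans hupS.1
  have hTtop : ∀ x ∈ T, ∀ y ∈ box b (d + 1), toLex x ≤ toLex y → y ∈ T := by
    intro x hx y hy hxy
    refine mem_erase.2 ⟨?_, hupS.2 x (mem_of_mem_erase hx) y hy hxy⟩
    rintro rfl
    have := hmin x (mem_of_mem_erase hx)
    exact (mem_erase.1 hx).1 (toLex_inj.1 (le_antisymm hxy this))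
  have hSsub : (box b (d + 1) \ T).image (rev a) ⊆ box b d' := by
    rw [← image_rev_box ha (show d + 1 + d' = _ by omega)]
    exact image_subset_image sdiff_subset
  have hmemS' : ∀ m ∈ box b d, ∀ i, InBox b (m + Finsupp.single i 1) →
      m + Finsupp.single i 1 ∉ T → rev a m ∈ up b ((box b (d + 1) \ T).image (rev a)) := by
    intro m hm i hmi hmT
    refine mem_up.2 ⟨(inBox_bOf ha).2 fun i => Nat.sub_le _ _, _,
      mem_image_of_mem _ (mem_sdiff.2 ⟨mem_box.2 ⟨?_, hmi⟩, hmT⟩), i, rev_add_single ha hmi⟩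
    rw [expDeg_add, expDeg_single, (mem_box.1 hm).1]
  refine ⟨(box b (d + 1) \ T).image (rev a), ⟨hSsub, ?_⟩, ?_, ?_⟩
  · intro x hx y hy hxy
    obtain ⟨w, hw, rfl⟩ := mem_image.1 hx
    obtain ⟨hwb, hwT⟩ := mem_sdiff.1 hw
    have hyb := rev_mem_box ha hy (show d' + (d + 1) = _ by omega)
    rw [← rev_rev ha (mem_box.1 hy).2]
    refine mem_image_of_mem _ (mem_sdiff.2 ⟨hyb, fun hyT => hwT (hTtop _ hyT w hwb ?_)⟩)
    rw [← rev_rev ha (mem_box.1 hwb).2]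
    exact toLex_rev_le ha (mem_box.1 hy).2 hxy
  · rw [card_image_rev ha sdiff_subset, card_sdiff_of_subset hTsub, card_erase_of_mem hw₀]
    have h1 := card_le_card hupS.1
    have h2 : 0 < (up b S).card := card_pos.2 hne
    omega
  · have hsub : (insert m₀ (box b d \ S)).image (rev a) ⊆
        up b ((box b (d + 1) \ T).image (rev a)) := by
      intro x hx
      obtain ⟨m, hm, rfl⟩ := mem_image.1 hx
      rcases mem_insert.1 hm with rfl | hm
      · refine hmemS' m (hS.1 hm₀) k (hk ▸ hw₀b) ?_
        rw [← hk]; exact notMem_erase _ _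
      · obtain ⟨hmb, hmS⟩ := mem_sdiff.1 hm
        have hlt : toLex m < toLex m₀ := by
          by_contra! hle
          exact hmS (hS.2 m₀ hm₀ m hmb hle)
        have hle : toLex m ≤ toLex w₀ := by
          refine hlt.le.trans ?_
          rw [hk, ← add_zero m₀, add_assoc, zero_add]
          exact Finsupp.toLex_monotone (by simp)
        obtain ⟨u, hub, hmu, huw⟩ := exists_fill_up (hupS.1 hw₀) 1 m (mem_box.1 hmb).2
          (by rw [(mem_box.1 hmb).1]) hle
        obtain ⟨i, rfl⟩ := exists_eq_add_single hmu
          (by rw [(mem_box.1 hub).1, (mem_box.1 hmb).1])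
        refine hmemS' m hmb i (mem_box.1 hub).2 fun huT => (mem_erase.1 huT).1 ?_
        exact toLex_inj.1 (le_antisymm huw (hmin _ (mem_of_mem_erase huT)))
    have h1 := card_le_card hsub
    rw [card_image_rev ha (insert_subset (hS.1 hm₀) sdiff_subset),
      card_insert_of_notMem (by simp [hm₀]), card_sdiff_of_subset hS.1] at h1
    have h2 := card_le_card hS.1
    omega

end Reversal

section Local

variable {K : Type*} [Field K] {n r : ℕ}

/-- The growth bound in a single degree for ideals containing a fixed sequence. -/
def GrowthAt (f : Fin r → MvPolynomial (Fin n) K) (a : Fin r → ℕ) (d : ℕ) : Prop :=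
  ∀ I : Ideal (MvPolynomial (Fin n) K), IsHomog I → (∀ i, f i ∈ I) →
    ∀ S : Finset (Fin n →₀ ℕ), LexTop (bOf n a) d S →
      S.card + hilb (seqIdeal f) d ≤ hilb I d →
      (up (bOf n a) S).card + hilb (seqIdeal f) (d + 1) ≤ hilb I (d + 1)

theorem GrowthAt.of_dual [Infinite K] {f : Fin n → MvPolynomial (Fin n) K} {a : Fin n → ℕ}
    (hf : ∀ i, (f i).IsHomogeneous (a i)) (ha : ∀ i, 0 < a i) (hreg : IsRegSeq f) {d d' : ℕ}
    (hd : d + d' + 1 = ∑ i, (a i - 1)) (h : GrowthAt f a d') : GrowthAt f a d := by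
  intro I hI hfI S hS hSI
  by_contra! hlt
  have hcI : seqIdeal f ≤ I := by
    rw [seqIdeal, Ideal.span_le]
    rintro _ ⟨i, rfl⟩
    exact hfI i
  have h0 := hilb_mono hcI (d + 1)
  obtain ⟨S', hS', hS'c, hup⟩ := exists_dual_top ha hd hS (card_pos.1 (by omega))
  have h1 := hilb_link_add hf ha hreg hI hfI (show d + 1 + d' = _ by omega)
  have h2 := hilb_link_add hf ha hreg hI hfI (show d + (d' + 1) = _ by omega)
  have h3 := card_box_rev ha (show d + 1 + d' = _ by omega)
  have h4 := card_box_rev ha (show d + (d' + 1) = _ by omega)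
  have h5 := hilb_seqIdeal le_rfl hf ha hreg d'
  have h6 := hilb_seqIdeal le_rfl hf ha hreg (d' + 1)
  have h7 := h (link (seqIdeal f) I) (isHomog_link (isHomog_seqIdeal hf) hI)
    (fun i => le_link _ _ (mem_seqIdeal f i)) S' hS' (by omega)
  omega

end Local

end CavigliaDeStefani

namespace CavigliaDeStefani

section Codimension

variable {K E : Type*} [Field K] [AddCommGroup E] [Module K E] [FiniteDimensional K E]

theorem exists_sub_smul_mem {V W : Submodule K E} (hVW : V ≤ W)
    (hdim : Module.finrank K W ≤ Module.finrank K V + 1) {w₀ : E} (hw₀ : w₀ ∈ W) (hw₀V : w₀ ∉ V)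
    {w : E} (hw : w ∈ W) : ∃ c : K, w - c • w₀ ∈ V := by
  have hle : V ⊔ K ∙ w₀ ≤ W := sup_le hVW ((Submodule.span_singleton_le_iff_mem _ _).2 hw₀)
  have hlt : V < V ⊔ K ∙ w₀ := lt_of_le_of_ne le_sup_left fun h =>
    hw₀V (h ▸ Submodule.mem_sup_right (Submodule.mem_span_singleton_self w₀))
  have h1 := Submodule.finrank_lt_finrank_of_lt hlt
  have h2 := Submodule.eq_of_le_of_finrank_le hle (by omega)
  rw [← h2] at hw
  obtain ⟨v, hv, u, hu, rfl⟩ := Submodule.mem_sup.1 hw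
  obtain ⟨c, rfl⟩ := Submodule.mem_span_singleton.1 hu
  exact ⟨c, by rwa [add_sub_cancel_right]⟩

theorem finrank_le_finrank_inf_comap_add_one {V W R : Submodule K E} (hVW : V ≤ W)
    (hdim : Module.finrank K W ≤ Module.finrank K V + 1) (φ : E →ₗ[K] E)
    (hφ : ∀ r ∈ R, φ r ∈ W) :
    Module.finrank K R ≤ Module.finrank K ↥(R ⊓ V.comap φ) + 1 := by
  by_cases h : ∀ r ∈ R, φ r ∈ V
  · rw [inf_eq_left.2 fun r hr => h r hr]; exact Nat.le_succ _
  · push Not at h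
    obtain ⟨r₀, hr₀, hr₀V⟩ := h
    have hle : R ≤ (R ⊓ V.comap φ) ⊔ K ∙ r₀ := by
      intro r hr
      obtain ⟨c, hc⟩ := exists_sub_smul_mem hVW hdim (hφ r₀ hr₀) hr₀V (hφ r hr)
      rw [← sub_add_cancel r (c • r₀)]
      refine Submodule.add_mem_sup ⟨R.sub_mem hr (R.smul_mem c hr₀), ?_⟩
        (Submodule.mem_span_singleton.2 ⟨c, rfl⟩)
      change φ (r - c • r₀) ∈ V
      rwa [map_sub, map_smul]
    have h1 := Submodule.finrank_mono hle
    have h2 := Submodule.finrank_add_le_finrank_add_finrank (R ⊓ V.comap φ) (K ∙ r₀)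
    have h3 : Module.finrank K (K ∙ r₀) ≤ 1 := by
      simpa using finrank_span_le_card (R := K) ({r₀} : Set E)
    omega

end Codimension

section SmallDoubling

open Polynomial

variable {K E : Type*} [Field K] [CommRing E] [Algebra K E] {F V : Submodule K E}

/-- Stability of a subspace under multiplication by the elements of another one. -/
def StableUnder (F W : Submodule K E) : Prop := ∀ f ∈ F, ∀ w ∈ W, f * w ∈ W

/-- The hypotheses under which `F * V` is barely larger than `V`. -/
structure SmallDoubling (F V : Submodule K E) : Prop where
  one_mem : 1 ∈ F
  no_ideal : ∀ W ≤ V, StableUnder F W → W = ⊥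
  ne_bot : V ≠ ⊥
  not_stable : ¬ StableUnder F (F * V)
  finrank_le : Module.finrank K ↥(F * V) ≤ Module.finrank K V + 1
  unit_mem : ∃ u ∈ F * V, IsUnit u

namespace SmallDoubling

theorem le_mul (h : SmallDoubling F V) : V ≤ F * V := fun v hv => by
  rw [← one_mul v]; exact Submodule.mul_mem_mul h.one_mem hv

theorem exists_notMem (h : SmallDoubling F V) : ∃ w ∈ F * V, w ∉ V := by
  by_contra! hle
  exact h.ne_bot (h.no_ideal V le_rfl fun f hf v hv => hle _ (Submodule.mul_mem_mul hf hv))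

theorem mem_of_forall [FiniteDimensional K E] (h : SmallDoubling F V) {x : E}
    (hx : ∀ f ∈ F, f * x ∈ F * V) : x ∈ V := by
  by_contra hxV
  have hxW : x ∈ F * V := by simpa using hx 1 h.one_mem
  refine h.not_stable fun f hf w hw => ?_
  obtain ⟨c, hc⟩ := exists_sub_smul_mem h.le_mul h.finrank_le hxW hxV hw
  rw [← sub_add_cancel w (c • x), mul_add, mul_smul_comm]
  exact add_mem (Submodule.mul_mem_mul hf hc) (Submodule.smul_mem _ c (hx f hf))

theorem mul_mem_of_stable [FiniteDimensional K E] (h : SmallDoubling F V) {z : E}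
    (hz : ∀ w ∈ F * V, z * w ∈ F * V) {v : E} (hv : v ∈ V) : z * v ∈ V :=
  h.mem_of_forall fun f hf => by
    rw [mul_left_comm]; exact hz _ (Submodule.mul_mem_mul hf hv)

theorem mul_mem_mul_of_forall {x : E} (hx : ∀ v ∈ V, x * v ∈ V) {w : E} (hw : w ∈ F * V) :
    x * w ∈ F * V := by
  induction hw using Submodule.mul_induction_on' with
  | mem_mul_mem f hf v hv => rw [mul_left_comm]; exact Submodule.mul_mem_mul hf (hx v hv)
  | add w _ w' _ hw hw' => rw [mul_add]; exact add_mem hw hw'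

theorem exists_pow_mul_eq [FiniteDimensional K E] {H : Subalgebra K E} {x : E} (hx : x ∈ H) :
    ∃ N, ∃ q ∈ H, x ^ N = x * q * x ^ N := by
  have : IsArtinianRing H := isArtinian_of_tower K inferInstance
  obtain ⟨N, q, hq⟩ := IsArtinian.exists_pow_succ_smul_dvd (R := H) (M := H) ⟨x, hx⟩ 1
  refine ⟨N, q, q.2, ?_⟩
  have := congrArg Subtype.val hq
  simp only [smul_eq_mul, Nat.succ_eq_add_one, mul_one, MulMemClass.coe_mul,
    SubmonoidClass.coe_pow] at this
  rw [mul_right_comm, ← pow_succ', this]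

/-- An element of the algebra stabilizing `V` is a scalar. -/
theorem mem_range_algebraMap [FiniteDimensional K E] (h : SmallDoubling F V) {z : E}
    (hz : ∀ v ∈ V, z * v ∈ V) : ∃ c : K, algebraMap K E c = z := by
  obtain ⟨w₀, hw₀, hw₀V⟩ := h.exists_notMem
  let H : Subalgebra K E :=
    { carrier := {x | ∀ v ∈ V, x * v ∈ V}
      mul_mem' := fun {x y} hx hy v hv => by rw [mul_assoc]; exact hx _ (hy v hv)
      add_mem' := fun {x y} hx hy v hv => by rw [add_mul]; exact V.add_mem (hx v hv) (hy v hv)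
      algebraMap_mem' := fun c v hv => by rw [← Algebra.smul_def]; exact V.smul_mem c hv }
  have hHW : ∀ x ∈ H, ∀ w ∈ F * V, x * w ∈ F * V := fun x hx w hw => mul_mem_mul_of_forall hx hw
  have hchar : ∀ x ∈ H, ∃ c : K, ∀ w ∈ F * V, (x - algebraMap K E c) * w ∈ V := by
    intro x hx
    obtain ⟨c, hc⟩ := exists_sub_smul_mem h.le_mul h.finrank_le hw₀ hw₀V (hHW x hx w₀ hw₀)
    refine ⟨c, fun w hw => ?_⟩
    obtain ⟨e, he⟩ := exists_sub_smul_mem h.le_mul h.finrank_le hw₀ hw₀V hw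
    have h1 : (x - algebraMap K E c) * w =
        (x - algebraMap K E c) * (w - e • w₀) + e • (x * w₀ - c • w₀) := by
      simp only [Algebra.smul_def]; ring
    rw [h1]
    exact V.add_mem (H.sub_mem hx (H.algebraMap_mem c) _ he) (V.smul_mem e hc)
  let N : Submodule K E :=
    { carrier := {x | ∀ w ∈ F * V, x * w ∈ V}
      zero_mem' := fun w _ => by rw [zero_mul]; exact V.zero_mem
      add_mem' := fun {x y} hx hy w hw => by rw [add_mul]; exact V.add_mem (hx w hw) (hy w hw)
      smul_mem' := fun c x hx w hw => by rw [smul_mul_assoc]; exact V.smul_mem c (hx w hw) }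
  have hNH : ∀ x ∈ N, x ∈ H := fun x hx v hv => hx v (h.le_mul hv)
  have hN : StableUnder F N := by
    intro f hf x hx
    have hfx : f * x ∈ H := fun v hv => by
      rw [mul_comm f, mul_assoc]; exact hx _ (Submodule.mul_mem_mul hf hv)
    obtain ⟨c, hc⟩ := hchar _ hfx
    suffices hc0 : c = 0 by
      intro w hw
      have := hc w hw
      rwa [hc0, map_zero, sub_zero] at this
    obtain ⟨k, q, hq, hk⟩ := exists_pow_mul_eq (hNH x hx)
    have hpow : ∀ j, ∀ w ∈ F * V, ((f * x) ^ j - algebraMap K E (c ^ j)) * w ∈ V := by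
      intro j
      induction j with
      | zero => intro w _; simp
      | succ j ih =>
        intro w hw
        have h1 : ((f * x) ^ (j + 1) - algebraMap K E (c ^ (j + 1))) * w =
            (f * x) * (((f * x) ^ j - algebraMap K E (c ^ j)) * w) +
              c ^ j • ((f * x - algebraMap K E c) * w) := by
          simp only [Algebra.smul_def, map_pow]; ring
        rw [h1]
        exact V.add_mem (hfx _ (ih w hw)) (V.smul_mem _ (hc w hw))
    have h2 : (f * x) ^ k * w₀ ∈ V := by
      have h3 : (f * x) ^ k * w₀ = x * (q * ((f * x) ^ k * w₀)) := by
        rw [mul_pow]; nth_rewrite 1 [hk]; ring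
      rw [h3]
      exact hx _ (hHW q hq _ (hHW _ (H.pow_mem hfx k) _ hw₀))
    have h4 := V.sub_mem h2 (hpow k w₀ hw₀)
    rw [sub_mul, sub_sub_cancel, ← Algebra.smul_def] at h4
    by_contra hc0
    exact hw₀V ((V.smul_mem_iff (pow_ne_zero k hc0)).1 h4)
  obtain ⟨u, huW, hu⟩ := h.unit_mem
  obtain ⟨c, hc⟩ := hchar z hz
  refine ⟨c, ?_⟩
  have h1 := h.no_ideal (N.map (LinearMap.mulRight K u)) ?_ ?_
  · have h2 : (z - algebraMap K E c) * u ∈ N.map (LinearMap.mulRight K u) := ⟨_, hc, rfl⟩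
    rw [h1, Submodule.mem_bot, hu.mul_left_eq_zero, sub_eq_zero] at h2
    exact h2.symm
  · rintro _ ⟨x, hx, rfl⟩
    exact hx u huW
  · rintro f hf _ ⟨x, hx, rfl⟩
    exact ⟨f * x, hN f hf x hx, by simp [mul_assoc]⟩

/-- A subspace of `V` stabilized by a non-scalar element of `F` is zero. -/
theorem eq_bot_of_stable [FiniteDimensional K E] (h : SmallDoubling F V) {z : E} (hzF : z ∈ F)
    (hz : ∀ c : K, algebraMap K E c ≠ z) {R : Submodule K E} (hR : R ≤ V)
    (hzR : ∀ x ∈ R, z * x ∈ R) : R = ⊥ := by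
  let M : Submodule K E := ⨅ k : ℕ, V.comap (LinearMap.mulLeft K (z ^ k))
  have hM : ∀ x, x ∈ M ↔ ∀ k : ℕ, z ^ k * x ∈ V := fun x => by
    simp [M, Submodule.mem_iInf]
  have hRM : R ≤ M := fun x hx => (hM x).2 fun k => hR (by
    induction k with
    | zero => simpa using hx
    | succ k ih => rw [pow_succ', mul_assoc]; exact hzR _ ih)
  have hMV : M ≤ V := fun x hx => by simpa using (hM x).1 hx 0
  have hMz : ∀ x ∈ M, z * x ∈ M := fun x hx => (hM _).2 fun k => by
    rw [← mul_assoc, ← pow_succ]; exact (hM x).1 hx (k + 1)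
  refine eq_bot_iff.2 (hRM.trans (h.no_ideal M hMV fun f hf x hx => ?_).le)
  refine (hM _).2 fun k => ?_
  by_contra hu
  have huW : ∀ x ∈ M, f * x ∈ F * V := fun x hx => Submodule.mul_mem_mul hf (hMV hx)
  have hpow : ∀ j : ℕ, z ^ j * x ∈ M := fun j => by
    induction j with
    | zero => simpa using hx
    | succ j ih => rw [pow_succ', mul_assoc]; exact hMz _ ih
  rw [mul_left_comm] at hu
  refine absurd (h.mem_range_algebraMap fun v hv => h.mul_mem_of_stable (fun w hw => ?_) hv)
    (not_exists.2 hz)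
  obtain ⟨c, hc⟩ := exists_sub_smul_mem h.le_mul h.finrank_le (huW _ (hpow k)) hu hw
  rw [← sub_add_cancel w (c • (f * (z ^ k * x))), mul_add, mul_smul_comm]
  refine add_mem (Submodule.mul_mem_mul hzF hc) (Submodule.smul_mem _ c ?_)
  rw [mul_left_comm, ← mul_assoc z, ← pow_succ']
  exact huW _ (hpow (k + 1))

theorem exists_forall_pow_mul_mem [FiniteDimensional K E] (h : SmallDoubling F V) {z : E}
    (hzF : z ∈ F) (k : ℕ) :
    ∃ R ≤ V, Module.finrank K V ≤ Module.finrank K R + k ∧ ∀ x ∈ R, ∀ j ≤ k, z ^ j * x ∈ V := by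
  induction k with
  | zero =>
    exact ⟨V, le_rfl, by simp, fun x hx j hj => by
      rwa [Nat.le_zero.1 hj, pow_zero, one_mul]⟩
  | succ k ih =>
    obtain ⟨R, hRV, hR, hRk⟩ := ih
    have h1 := finrank_le_finrank_inf_comap_add_one h.le_mul h.finrank_le (R := R)
      (LinearMap.mulLeft K (z ^ (k + 1))) fun x hx => by
        rw [LinearMap.mulLeft_apply, pow_succ', mul_assoc]
        exact Submodule.mul_mem_mul hzF (hRk x hx k le_rfl)
    refine ⟨R ⊓ V.comap (LinearMap.mulLeft K (z ^ (k + 1))), inf_le_left.trans hRV, by omega,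
      fun x hx j hj => ?_⟩
    rcases hj.lt_or_eq with hj | rfl
    · exact hRk x hx.1 j (by omega)
    · exact hx.2

theorem finrank_degreeLT (j : ℕ) : Module.finrank K (degreeLT K j) = j := by
  rw [(degreeLTEquiv K j).finrank_eq, Module.finrank_fin_fun]

/-- Multiplication of `g` by the values at `z` of the polynomials of degree less than `j`. -/
noncomputable def evalSpan (z g : E) (j : ℕ) : Submodule K E :=
  (degreeLT K j).map (LinearMap.mulRight K g ∘ₗ (Polynomial.aeval z).toLinearMap)

theorem mem_evalSpan {z g : E} {j : ℕ} {x : E} :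
    x ∈ evalSpan (K := K) z g j ↔ ∃ P : K[X], P.degree < j ∧ Polynomial.aeval z P * g = x := by
  simp [evalSpan, Submodule.mem_map, mem_degreeLT]

theorem evalSpan_le {z g : E} {j : ℕ} {R : Submodule K E} (h : ∀ i < j, z ^ i * g ∈ R) :
    evalSpan z g j ≤ R := by
  intro x hx
  obtain ⟨P, hP, rfl⟩ := mem_evalSpan.1 hx
  rw [aeval_eq_sum_range, Finset.sum_mul]
  refine sum_mem fun i _ => ?_
  rw [smul_mul_assoc]
  by_cases hi : P.coeff i = 0
  · rw [hi, zero_smul]; exact R.zero_mem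
  · exact R.smul_mem _ (h i (by exact_mod_cast (le_degree_of_ne_zero hi).trans_lt hP))

theorem finrank_evalSpan {z g : E} {j : ℕ}
    (h : ∀ P : K[X], P.degree < j → Polynomial.aeval z P * g = 0 → P = 0) :
    Module.finrank K (evalSpan (K := K) z g j) = j := by
  rw [evalSpan, ← LinearMap.range_domRestrict, LinearMap.finrank_range_of_inj, finrank_degreeLT]
  refine LinearMap.ker_eq_bot.1 (LinearMap.ker_eq_bot'.2 fun P hP => Subtype.ext ?_)
  exact h P (mem_degreeLT.1 P.2) hP

theorem stable_evalSpan {z g : E} {P : K[X]} (hP : P ≠ 0)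
    (h : Polynomial.aeval z P * g = 0) {x : E} (hx : x ∈ evalSpan (K := K) z g P.natDegree) :
    z * x ∈ evalSpan (K := K) z g P.natDegree := by
  obtain ⟨Q, -, rfl⟩ := mem_evalSpan.1 hx
  refine mem_evalSpan.2 ⟨(Polynomial.X * Q) % P, ?_, ?_⟩
  · rw [← degree_eq_natDegree hP]; exact degree_mod_lt _ hP
  · have h1 := congrArg (fun R => Polynomial.aeval z R * g)
      (EuclideanDomain.div_add_mod (Polynomial.X * Q) P)
    simp only [map_add, map_mul, Polynomial.aeval_X, add_mul] at h1
    rw [mul_right_comm (Polynomial.aeval z P), h, zero_mul, zero_add, mul_assoc] at h1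
    exact h1

theorem finrank_le_two [FiniteDimensional K E] (h : SmallDoubling F V) :
    Module.finrank K F ≤ 2 := by
  by_cases hF : ∀ z ∈ F, ∃ c : K, algebraMap K E c = z
  · have h1 : F ≤ K ∙ (1 : E) := fun z hz => by
      obtain ⟨c, rfl⟩ := hF z hz
      exact Submodule.mem_span_singleton.2 ⟨c, (Algebra.algebraMap_eq_smul_one c).symm⟩
    have h2 := finrank_span_le_card (R := K) ({1} : Set E)
    rw [Set.toFinset_singleton, Finset.card_singleton] at h2
    exact ((Submodule.finrank_mono h1).trans h2).trans one_le_two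
  push Not at hF
  obtain ⟨z, hzF, hz⟩ := hF
  have hV0 : 0 < Module.finrank K V := Submodule.one_le_finrank_iff.2 h.ne_bot
  obtain ⟨p, hp⟩ : ∃ p, Module.finrank K V = p + 1 := ⟨_, (Nat.succ_pred_eq_of_pos hV0).symm⟩
  obtain ⟨R, -, hR, hRp⟩ := h.exists_forall_pow_mul_mem hzF p
  obtain ⟨g, hgR, hg0⟩ : ∃ g ∈ R, g ≠ 0 := by
    refine R.exists_mem_ne_zero_of_ne_bot ?_
    rintro rfl
    rw [finrank_bot] at hR; omega
  have hgV : ∀ i < p + 1, z ^ i * g ∈ V := fun i hi => hRp g hgR i (by omega)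
  have hgW : ∀ i < p + 2, z ^ i * g ∈ F * V := by
    intro i hi
    cases i with
    | zero => exact h.le_mul (hgV 0 (by omega))
    | succ i => rw [pow_succ', mul_assoc]; exact Submodule.mul_mem_mul hzF (hgV i (by omega))
  have hnat : ∀ P : K[X], P ≠ 0 → Polynomial.aeval z P * g = 0 → p + 1 < P.natDegree := by
    intro P hP hPg
    by_contra! hle
    have h1 := h.eq_bot_of_stable hzF hz (evalSpan_le fun i hi => hgV i (by omega))
      fun x hx => stable_evalSpan hP hPg hx
    rcases Nat.eq_zero_or_pos P.natDegree with h0 | h0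
    · rw [eq_C_of_natDegree_eq_zero h0, Polynomial.aeval_C, ← Algebra.smul_def, smul_eq_zero] at hPg
      refine hP ?_
      rw [eq_C_of_natDegree_eq_zero h0, hPg.resolve_right hg0, Polynomial.C_0]
    · have h2 : g ∈ evalSpan (K := K) z g P.natDegree :=
        mem_evalSpan.2 ⟨1, by rw [degree_one]; exact_mod_cast h0, by simp⟩
      rw [h1] at h2
      exact hg0 h2
  have hVeq : evalSpan z g (p + 1) = V :=
    Submodule.eq_of_le_of_finrank_le (evalSpan_le hgV) (by
      rw [hp, finrank_evalSpan]
      intro P hP hPg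
      by_contra hP0
      have h1 := hnat P hP0 hPg
      rw [degree_eq_natDegree hP0] at hP
      have h2 : P.natDegree < p + 1 := by exact_mod_cast hP
      omega)
  have hWeq : evalSpan z g (p + 2) = F * V :=
    Submodule.eq_of_le_of_finrank_le (evalSpan_le hgW) (by
      rw [finrank_evalSpan]
      · have := h.finrank_le; omega
      intro P hP hPg
      by_contra hP0
      have h1 := hnat P hP0 hPg
      rw [degree_eq_natDegree hP0] at hP
      have h2 : P.natDegree < p + 2 := by exact_mod_cast hP
      omega)
  have hnat' : ∀ P : K[X], P ≠ 0 → Polynomial.aeval z P * g = 0 → p + 2 < P.natDegree := by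
    intro P hP hPg
    refine lt_of_le_of_ne (hnat P hP hPg) fun heq => h.ne_bot ?_
    refine h.eq_bot_of_stable hzF hz le_rfl fun v hv => h.mul_mem_of_stable (fun w hw => ?_) hv
    rw [← hWeq, show p + 2 = P.natDegree from heq] at hw ⊢
    exact stable_evalSpan hP hPg hw
  obtain ⟨u, huW, hu⟩ := h.unit_mem
  have hgu : IsUnit g := by
    rw [← hWeq] at huW
    obtain ⟨P, -, rfl⟩ := mem_evalSpan.1 huW
    exact isUnit_of_mul_isUnit_right hu
  have hFle : F ≤ Submodule.span K {1, z} := by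
    intro f hf
    have hfg : f * g ∈ evalSpan (K := K) z g (p + 2) := by
      rw [hWeq]
      exact Submodule.mul_mem_mul hf (by simpa using hgV 0 (by omega))
    obtain ⟨P, hP, hPg⟩ := mem_evalSpan.1 hfg
    obtain rfl := hgu.mul_right_cancel hPg
    have hk : P.natDegree ≤ 1 := by
      by_contra! hk
      have hP0 : P ≠ 0 := by rintro rfl; simp at hk
      have hP' : P.natDegree < p + 2 := by
        rw [degree_eq_natDegree hP0] at hP; exact_mod_cast hP
      have h1 : Polynomial.aeval z P * (z ^ (p + 2 - P.natDegree) * g) ∈ F * V :=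
        Submodule.mul_mem_mul hf (hgV _ (by omega))
      rw [← hWeq] at h1
      obtain ⟨Q, hQ, hQg⟩ := mem_evalSpan.1 h1
      have hlt : Q.degree < (P * Polynomial.X ^ (p + 2 - P.natDegree)).degree := by
        rw [degree_mul, degree_X_pow, degree_eq_natDegree hP0]
        refine hQ.trans_le ?_
        exact_mod_cast (show p + 2 ≤ P.natDegree + (p + 2 - P.natDegree) by omega)
      have hne : P * Polynomial.X ^ (p + 2 - P.natDegree) - Q ≠ 0 := fun h0 => by
        rw [sub_eq_zero.1 h0] at hlt; exact lt_irrefl _ hlt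
      have h2 := hnat' _ hne (by
        rw [map_sub, map_mul, map_pow, Polynomial.aeval_X, sub_mul, hQg]; ring)
      have h3 : (P * Polynomial.X ^ (p + 2 - P.natDegree) - Q).natDegree ≤ p + 2 := by
        refine (natDegree_sub_le _ _).trans (max_le ?_ ?_)
        · refine natDegree_mul_le.trans ?_
          rw [natDegree_X_pow]; omega
        · exact natDegree_le_of_degree_le hQ.le
      omega
    rw [eq_X_add_C_of_natDegree_le_one hk, map_add, map_mul, Polynomial.aeval_C,
      Polynomial.aeval_C, Polynomial.aeval_X,
      ← Algebra.smul_def, Algebra.algebraMap_eq_smul_one]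
    exact add_mem (Submodule.smul_mem _ _ (Submodule.subset_span (by simp)))
      (Submodule.smul_mem _ _ (Submodule.subset_span (by simp)))
  classical
  have h1 := finrank_span_le_card (R := K) ({1, z} : Set E)
  have h2 : ({1, z} : Set E).toFinset.card ≤ 2 := by
    rw [Set.toFinset_insert, Set.toFinset_singleton]; exact Finset.card_le_two
  exact ((Submodule.finrank_mono hFle).trans h1).trans h2

end SmallDoubling

end SmallDoubling

end CavigliaDeStefani

namespace CavigliaDeStefani

open Finset MvPolynomial

section Dehomogenization

variable {K E : Type*} [Field K] [CommRing E] [Algebra K E] {n : ℕ}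

/-- The image in `E` of the forms of degree `d`. -/
noncomputable def formImage (ψ : MvPolynomial (Fin n) K →ₐ[K] E) (d : ℕ) : Submodule K E :=
  (homogeneousSubmodule (Fin n) K d).map ψ.toLinearMap

/-- `ψ` is the quotient map to the dehomogenization `A / (c + (y - 1))`. -/
structure Dehomogenizes (ψ : MvPolynomial (Fin n) K →ₐ[K] E)
    (c : Ideal (MvPolynomial (Fin n) K)) (y : MvPolynomial (Fin n) K) : Prop where
  surjective : Function.Surjective ψ
  ker : ∀ p, ψ p = 0 ↔ ∃ v, p - v * (y - 1) ∈ c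
  homog : IsHomog c
  hom : y.IsHomogeneous 1
  nzd : ∀ u, y * u ∈ c → u ∈ c

theorem stableUnder_formImage_one {ψ : MvPolynomial (Fin n) K →ₐ[K] E} {W : Submodule K E}
    (h : StableUnder (formImage ψ 1) W) (p : MvPolynomial (Fin n) K) : ∀ w ∈ W, ψ p * w ∈ W := by
  induction p using MvPolynomial.induction_on with
  | C a =>
    intro w hw
    rw [← algebraMap_eq, AlgHom.commutes, ← Algebra.smul_def]
    exact W.smul_mem a hw
  | add p q hp hq => intro w hw; rw [map_add, add_mul]; exact add_mem (hp w hw) (hq w hw)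
  | mul_X p i hp =>
    intro w hw
    rw [map_mul, mul_assoc]
    exact hp _ (h _ ⟨X i, isHomogeneous_X _ _, rfl⟩ _ hw)

namespace Dehomogenizes

variable {ψ : MvPolynomial (Fin n) K →ₐ[K] E} {c : Ideal (MvPolynomial (Fin n) K)}
  {y : MvPolynomial (Fin n) K}

theorem map_y (h : Dehomogenizes ψ c y) : ψ y = 1 := by
  have : ψ (y - 1) = 0 := (h.ker _).2 ⟨1, by simp⟩
  rwa [map_sub, map_one, sub_eq_zero] at this

theorem map_mem (h : Dehomogenizes ψ c y) {p : MvPolynomial (Fin n) K} (hp : p ∈ c) : ψ p = 0 :=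
  (h.ker p).2 ⟨0, by simpa using hp⟩

theorem mem_of_map_eq_zero (h : Dehomogenizes ψ c y) {g : MvPolynomial (Fin n) K} {d : ℕ}
    (hg : g.IsHomogeneous d) (h0 : ψ g = 0) : g ∈ c := by
  obtain ⟨v, hv⟩ := (h.ker g).1 h0
  have hcomp := fun e => h.homog _ hv e
  have hsucc : ∀ e, homogeneousComponent (e + 1) (g - v * (y - 1)) =
      homogeneousComponent (e + 1) g - homogeneousComponent e v * y +
        homogeneousComponent (e + 1) v := by
    intro e
    rw [mul_sub, mul_one, map_sub, map_sub, homogeneousComponent_mul_add h.hom]; ring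
  have hz : homogeneousComponent 0 (g - v * (y - 1)) =
      homogeneousComponent 0 g + homogeneousComponent 0 v := by
    rw [mul_sub, mul_one, map_sub, map_sub, homogeneousComponent_mul_of_lt h.hom one_pos]; ring
  have hne : ∀ e, e ≠ d → homogeneousComponent e g = 0 := fun e he => by
    rw [homogeneousComponent_of_mem hg, if_neg he]
  have hlow : ∀ e, e < d → homogeneousComponent e v ∈ c := by
    intro e
    induction e with
    | zero =>
      intro he
      have := hcomp 0
      rwa [hz, hne 0 he.ne, zero_add] at this
    | succ e ih =>
      intro he
      have h1 := hcomp (e + 1)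
      rw [hsucc, hne _ he.ne, zero_sub] at h1
      have h2 := add_mem h1 (c.mul_mem_right y (ih (by omega)))
      ring_nf at h2 ⊢
      exact h2
  have hhigh : ∀ j e, v.totalDegree < e + j → d ≤ e → homogeneousComponent e v ∈ c := by
    intro j
    induction j with
    | zero =>
      intro e he _
      rw [homogeneousComponent_eq_zero _ _ (by omega)]; exact zero_mem _
    | succ j ih =>
      intro e he hde
      have h1 := hcomp (e + 1)
      rw [hsucc, hne _ (by omega), zero_sub] at h1
      have h2 := sub_mem (ih (e + 1) (by omega) (by omega)) h1
      refine h.nzd _ ?_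
      convert h2 using 1
      ring
  have hd := hhigh (v.totalDegree + 1) d (by omega) le_rfl
  have h1 := hcomp d
  rcases d with _ | d
  · rw [hz, homogeneousComponent_eq_self hg] at h1
    simpa using sub_mem h1 hd
  · rw [hsucc, homogeneousComponent_eq_self hg] at h1
    have h2 := add_mem (sub_mem h1 hd) (c.mul_mem_right y (hlow d (by omega)))
    convert h2 using 1
    ring

theorem formImage_le_succ (h : Dehomogenizes ψ c y) (d : ℕ) :
    formImage ψ d ≤ formImage ψ (d + 1) := by
  rintro _ ⟨g, hg, rfl⟩
  exact ⟨g * y, IsHomogeneous.mul hg h.hom, by simp [h.map_y]⟩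

theorem formImage_mono (h : Dehomogenizes ψ c y) : Monotone (formImage ψ) :=
  monotone_nat_of_le_succ h.formImage_le_succ

theorem finrank_map_component (h : Dehomogenizes ψ c y) {I : Ideal (MvPolynomial (Fin n) K)}
    (hcI : c ≤ I) (d : ℕ) :
    Module.finrank K ((component I d).map ψ.toLinearMap) + hilb c d = hilb I d := by
  have h1 := (ψ.toLinearMap.domRestrict (component I d)).finrank_range_add_finrank_ker
  rw [LinearMap.range_domRestrict] at h1
  have h2 : (LinearMap.ker (ψ.toLinearMap.domRestrict (component I d))).map
      (component I d).subtype = component c d := by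
    ext g
    simp only [Submodule.mem_map, LinearMap.mem_ker, LinearMap.domRestrict_apply,
      AlgHom.toLinearMap_apply, Submodule.subtype_apply]
    constructor
    · rintro ⟨x, hx, rfl⟩
      exact mem_component.2 ⟨h.mem_of_map_eq_zero x.2.2 hx, x.2.2⟩
    · intro hg
      exact ⟨⟨g, component_mono hcI d hg⟩, h.map_mem hg.1, rfl⟩
  rw [hilb, hilb, ← h2, finrank_map_of_injective _ (Submodule.injective_subtype _)]
  exact h1

theorem finrank_formImage (h : Dehomogenizes ψ c y) (d : ℕ) :
    Module.finrank K (formImage ψ d) + hilb c d =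
      hilb (⊤ : Ideal (MvPolynomial (Fin n) K)) d := by
  have := h.finrank_map_component (le_top : c ≤ ⊤) d
  rwa [component_top] at this

end Dehomogenizes

end Dehomogenization

section Hyperplane

variable {K E : Type*} [Field K] [CommRing E] [Algebra K E] {n : ℕ}
  {ψ : MvPolynomial (Fin (n + 1)) K →ₐ[K] E} {c : Ideal (MvPolynomial (Fin (n + 1)) K)}
  {y : MvPolynomial (Fin (n + 1)) K}

namespace Dehomogenizes

theorem map_mem_formImage_of_π (h : Dehomogenizes ψ c y) (H : Hyperplane y)
    {g : MvPolynomial (Fin (n + 1)) K} {d : ℕ} (hg : g.IsHomogeneous (d + 1))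
    (hπ : H.π g ∈ H.sect c) : ψ g ∈ formImage ψ d := by
  obtain ⟨v, hv⟩ := H.π_mem_sect_iff.1 hπ
  have h1 := h.homog _ hv (d + 1)
  rw [map_sub, homogeneousComponent_eq_self hg, homogeneousComponent_mul_add h.hom] at h1
  have h2 := h.map_mem h1
  rw [map_sub, map_mul, h.map_y, mul_one, sub_eq_zero] at h2
  exact ⟨_, homogeneousComponent_isHomogeneous d v, h2.symm⟩

theorem mem_of_π_of_degree_zero (h : Dehomogenizes ψ c y) (H : Hyperplane y)
    {g : MvPolynomial (Fin (n + 1)) K} (hg : g.IsHomogeneous 0)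
    (hπ : H.π g ∈ H.sect c) : g ∈ c := by
  obtain ⟨v, hv⟩ := H.π_mem_sect_iff.1 hπ
  have h1 := h.homog _ hv 0
  rwa [map_sub, homogeneousComponent_eq_self hg, homogeneousComponent_mul_of_lt h.hom one_pos,
    sub_zero] at h1

theorem formImage_eq_top (h : Dehomogenizes ψ c y) (H : Hyperplane y) {s : ℕ}
    (hs : ∀ q d, q.IsHomogeneous d → s < d → q ∈ H.sect c) : formImage ψ s = ⊤ := by
  have hle : ∀ j, formImage ψ (s + j) ≤ formImage ψ s := by
    intro j
    induction j with
    | zero => exact le_rfl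
    | succ j ih =>
      rintro _ ⟨g, hg, rfl⟩
      exact ih (h.map_mem_formImage_of_π H hg (hs _ _ (H.π_hom hg) (by omega)))
  rw [eq_top_iff]
  intro e _
  obtain ⟨p, rfl⟩ := h.surjective e
  rw [← sum_homogeneousComponent p, map_sum]
  refine sum_mem fun d _ => ?_
  have h1 : ψ (homogeneousComponent d p) ∈ formImage ψ d :=
    ⟨_, homogeneousComponent_isHomogeneous d p, rfl⟩
  rcases le_total d s with hd | hd
  · exact h.formImage_mono hd h1
  · obtain ⟨j, rfl⟩ := Nat.exists_eq_add_of_le hd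
    exact hle j h1

theorem eq_bot_of_stable (h : Dehomogenizes ψ c y) (H : Hyperplane y) {d : ℕ}
    (hs : ∀ q e e', q.IsHomogeneous e → q ∉ H.sect c → e + e' = d + 1 →
      ∃ g : MvPolynomial (Fin n) K, g.IsHomogeneous e' ∧ g * q ∉ H.sect c)
    {W : Submodule K E} (hW : W ≤ formImage ψ d) (hst : StableUnder (formImage ψ 1) W) :
    W = ⊥ := by
  classical
  by_contra hne
  obtain ⟨w, hw, hw0⟩ := W.ne_bot_iff.1 hne
  have hex : ∃ e, ∃ g : MvPolynomial (Fin (n + 1)) K,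
      g.IsHomogeneous e ∧ ψ g ∈ W ∧ ψ g ≠ 0 ∧ e ≤ d := by
    obtain ⟨g, hg, rfl⟩ := hW hw
    exact ⟨d, g, hg, hw, hw0, le_rfl⟩
  obtain ⟨g, hg, hgW, hg0, hed⟩ := Nat.find_spec hex
  have hmin := fun e (he : e < Nat.find hex) => Nat.find_min hex he
  generalize Nat.find hex = e at *
  have hπ : H.π g ∉ H.sect c := by
    intro hπ
    rcases e with _ | e
    · exact hg0 (h.map_mem (h.mem_of_π_of_degree_zero H hg hπ))
    · obtain ⟨g', hg', hgg⟩ := h.map_mem_formImage_of_π H hg hπ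
      have hgg' : ψ g' = ψ g := hgg
      exact hmin e (Nat.lt_succ_self e) ⟨g', hg', hgg' ▸ hgW, hgg' ▸ hg0, by omega⟩
  obtain ⟨q, hq, hqg⟩ := hs (H.π g) e (d + 1 - e) (H.π_hom hg) hπ (by omega)
  have h1 : ψ (H.σ q * g) ∈ W := by
    rw [map_mul]; exact stableUnder_formImage_one hst _ _ hgW
  obtain ⟨g', hg', hgg⟩ := hW h1
  have hgg' : ψ g' = ψ (H.σ q * g) := hgg
  have h2 : H.σ q * g - g' * y ∈ c := by
    refine h.mem_of_map_eq_zero (d := d + 1) (IsHomogeneous.sub ?_ (IsHomogeneous.mul hg' h.hom))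
      (by rw [map_sub, map_mul ψ g', h.map_y, mul_one, hgg', sub_self])
    have := (H.σ_hom hq).mul hg
    rwa [show d + 1 - e + e = d + 1 by omega] at this
  have h3 := H.π_mem_sect_iff.2 ⟨g', h2⟩
  rw [map_mul, H.π_σ] at h3
  exact hqg h3

theorem add_two_le_hilb (h : Dehomogenizes ψ c y) (H : Hyperplane y) {d : ℕ}
    (htop : ∀ q e, q.IsHomogeneous e → d + 1 < e → q ∈ H.sect c)
    (hs : ∀ q e e', q.IsHomogeneous e → q ∉ H.sect c → e + e' = d + 1 →
      ∃ g : MvPolynomial (Fin n) K, g.IsHomogeneous e' ∧ g * q ∉ H.sect c)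
    (h1 : hilb c 1 + 3 ≤ hilb (⊤ : Ideal (MvPolynomial (Fin (n + 1)) K)) 1)
    {I : Ideal (MvPolynomial (Fin (n + 1)) K)} (hcI : c ≤ I)
    {u : MvPolynomial (Fin (n + 1)) K} (hu : u.IsHomogeneous (d + 1)) (huI : u ∈ I)
    (hunzd : ∀ v, v * u ∈ c → v ∈ c) (hp : hilb c d < hilb I d)
    (hN : hilb I d < hilb (⊤ : Ideal (MvPolynomial (Fin (n + 1)) K)) d) :
    hilb I d + 2 + hilb c (d + 1) ≤ hilb I (d + 1) + hilb c d := by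
  have hE := h.formImage_eq_top H htop
  have hfin : FiniteDimensional K E := by
    have : Module.Finite K (formImage ψ (d + 1)) := by unfold formImage; infer_instance
    rw [hE] at this
    exact Module.finite_def.2 (Submodule.fg_top _ |>.1 (Module.finite_def.1 this))
  have hnid := fun W hW hst => h.eq_bot_of_stable H hs (W := W) hW hst
  obtain ⟨F, hF⟩ : ∃ F, F = formImage ψ 1 := ⟨_, rfl⟩
  obtain ⟨V, hV⟩ : ∃ V, V = (component I d).map ψ.toLinearMap := ⟨_, rfl⟩
  obtain ⟨U, hU⟩ : ∃ U, U = (component I (d + 1)).map ψ.toLinearMap := ⟨_, rfl⟩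
  have dF : Module.finrank K F + hilb c 1 = _ := hF ▸ h.finrank_formImage 1
  have dV : Module.finrank K V + hilb c d = _ := hV ▸ h.finrank_map_component hcI d
  have dU : Module.finrank K U + hilb c (d + 1) = _ := hU ▸ h.finrank_map_component hcI (d + 1)
  have dG := h.finrank_formImage d
  have hVG : V ≤ formImage ψ d := hV ▸ Submodule.map_mono (component_le I d)
  rw [← hF] at hnid
  have hVbot : V ≠ ⊥ := by
    rintro h0
    rw [h0, finrank_bot] at dV
    omega
  have hone : (1 : E) ∈ F := hF ▸ ⟨y, h.hom, h.map_y⟩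
  have hVFV : V ≤ F * V := fun v hv => by
    rw [← one_mul v]; exact Submodule.mul_mem_mul hone hv
  have hFVU : F * V ≤ U := by
    rw [Submodule.mul_le, hF, hV, hU]
    rintro _ ⟨f, hf, rfl⟩ _ ⟨g, hg, rfl⟩
    refine ⟨f * g, mem_component.2 ⟨I.mul_mem_left _ hg.1, ?_⟩, by simp⟩
    exact add_comm 1 d ▸ IsHomogeneous.mul hf hg.2
  have huU : ψ u ∈ U := hU ▸ ⟨u, mem_component.2 ⟨huI, hu⟩, rfl⟩
  have hunit : IsUnit (ψ u) := by
    have hinj : Function.Injective (LinearMap.mulLeft K (ψ u)) := by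
      rw [← LinearMap.ker_eq_bot, LinearMap.ker_eq_bot']
      intro e he
      have he' : e ∈ formImage ψ (d + 1) := hE ▸ Submodule.mem_top
      obtain ⟨v, hv, rfl⟩ := he'
      have h2 : ψ (v * u) = 0 := by
        rw [map_mul, mul_comm]; exact he
      exact h.map_mem (hunzd v (h.mem_of_map_eq_zero (IsHomogeneous.mul hv hu) h2))
    obtain ⟨e, he⟩ := LinearMap.surjective_of_injective hinj 1
    exact IsUnit.of_mul_eq_one e he
  have hne : (1 : E) ≠ 0 := by
    intro h0
    obtain ⟨v, -, hv⟩ := V.ne_bot_iff.1 hVbot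
    exact hv (by rw [← one_mul v, h0, zero_mul])
  have hGtop : formImage ψ d < ⊤ := by
    refine lt_top_iff_ne_top.2 fun h0 => ?_
    have := hnid ⊤ h0.ge (fun _ _ _ _ => Submodule.mem_top)
    exact hne ((Submodule.mem_bot K).1 (this ▸ Submodule.mem_top))
  have dE := Submodule.finrank_lt_finrank_of_lt hGtop
  by_cases huFV : ψ u ∈ F * V
  · by_cases hst : StableUnder F (F * V)
    · have hUtop : U = ⊤ := by
        rw [eq_top_iff]
        refine le_trans (fun e _ => ?_) hFVU
        obtain ⟨w, hw⟩ := hunit.exists_right_inv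
        obtain ⟨p, hp⟩ := h.surjective (e * w)
        have hst' : StableUnder (formImage ψ 1) (F * V) := fun f hf => hst f (hF ▸ hf)
        have := stableUnder_formImage_one hst' p _ huFV
        rwa [hp, mul_assoc, mul_comm w, hw, mul_one] at this
      rw [hUtop] at dU
      omega
    · by_contra hlt
      have dFV := Submodule.finrank_mono hFVU
      have hSD : SmallDoubling F V :=
        { one_mem := hone
          no_ideal := fun W hW hst => hnid W (hW.trans hVG) hst
          ne_bot := hVbot
          not_stable := hst
          finrank_le := by omega
          unit_mem := ⟨_, huFV, hunit⟩ }
      have := hSD.finrank_le_two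
      omega
  · have h3 : F * V < U := lt_of_le_of_ne hFVU fun h0 => huFV (h0 ▸ huU)
    have h4 : V < F * V := lt_of_le_of_ne hVFV fun h0 =>
      hVbot (hnid V hVG fun f hf v hv => by
        have := Submodule.mul_mem_mul hf hv
        rwa [← h0] at this)
    have h5 := Submodule.finrank_lt_finrank_of_lt h3
    have h6 := Submodule.finrank_lt_finrank_of_lt h4
    omega

end Dehomogenizes

end Hyperplane

end CavigliaDeStefani

namespace CavigliaDeStefani

open Finset MvPolynomial

section Middle

variable {K : Type*} [Field K]

theorem hilb_top_succ_le {n d : ℕ} {I : Ideal (MvPolynomial (Fin n) K)}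
    (h : hilb (⊤ : Ideal (MvPolynomial (Fin n) K)) d ≤ hilb I d) :
    hilb (⊤ : Ideal (MvPolynomial (Fin n) K)) (d + 1) ≤ hilb I (d + 1) := by
  have h1 := component_eq_of_hilb_eq (le_top : I ≤ ⊤) h
  suffices component (⊤ : Ideal (MvPolynomial (Fin n) K)) (d + 1) ≤ component I (d + 1) from
    Submodule.finrank_mono this
  rintro p ⟨-, hp⟩
  refine ⟨?_, hp⟩
  change p ∈ I
  rw [p.as_sum]
  refine sum_mem fun m hm => ?_
  have hdeg := isHomogeneous_iff_support.1 hp m hm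
  obtain ⟨l, hl, -⟩ := exists_last (m := m) (by omega)
  have hml := sub_single_add hl
  rw [← hml, ← mul_one (coeff _ p), ← monomial_mul]
  refine I.mul_mem_right _ ?_
  have h2 : monomial (m - Finsupp.single l 1) (coeff (m - Finsupp.single l 1 +
      Finsupp.single l 1) p) ∈ component (⊤ : Ideal (MvPolynomial (Fin n) K)) d := by
    refine ⟨trivial, isHomogeneous_monomial _ ?_⟩
    rw [← expDeg_eq_degree]
    have := congrArg expDeg hml
    simp only [expDeg_add, expDeg_single] at this
    omega
  rw [← h1] at h2
  exact h2.1

theorem card_box_zero_le {n : ℕ} (b : Fin n → ℕ∞) : (box b 0).card ≤ 1 := by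
  refine card_le_one.2 fun x hx y hy => ?_
  have hz : ∀ z ∈ box b 0, 0 = z := fun z hz =>
    eq_of_le_of_expDeg (fun _ => Nat.zero_le _) (by rw [(mem_box.1 hz).1]; simp)
  rw [← hz x hx, ← hz y hy]

variable {k : ℕ} {a : Fin (k + 1) → ℕ}

theorem three_le_card_box (hpos : ∀ i, 0 < a i) (hmono : Monotone a)
    (hsum : ∑ i : Fin k, (a i.castSucc - 1) = a (Fin.last k)) :
    3 ≤ (box (bOf (k + 1) (initSeq a)) 1).card := by
  classical
  have hlast := hpos (Fin.last k)
  obtain ⟨j, hj⟩ : ∃ j : Fin k, 1 < a j.castSucc := by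
    by_contra! h
    rw [sum_eq_zero fun i _ => by have := h i; omega] at hsum
    omega
  obtain ⟨j', hne, hj'⟩ : ∃ j' : Fin k, j' ≠ j ∧ 1 < a j'.castSucc := by
    by_contra! h
    rw [sum_eq_single j (fun i _ hi => by have := h i hi; omega) (by simp)] at hsum
    have := hmono (Fin.le_last j.castSucc)
    omega
  have h3 : ({j.castSucc, j'.castSucc, Fin.last k} : Finset (Fin (k + 1))).card = 3 :=
    card_eq_three.2 ⟨_, _, _, fun h => hne (Fin.castSucc_injective k h).symm,
      (Fin.castSucc_lt_last j).ne, (Fin.castSucc_lt_last j').ne, rfl⟩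
  rw [← h3, ← card_image_of_injective _ (Finsupp.single_left_injective (one_ne_zero (α := ℕ)))]
  refine card_le_card fun m hm => ?_
  obtain ⟨i, hi, rfl⟩ := mem_image.1 hm
  refine mem_box.2 ⟨by simp, fun l => ?_⟩
  have hb : ∀ j : Fin k, bOf (k + 1) (initSeq a) j.castSucc = (a j.castSucc : ℕ∞) := fun j => by
    simp [bOf, initSeq]
  have hbl : bOf (k + 1) (initSeq a) (Fin.last k) = ⊤ := by simp [bOf]
  rcases eq_or_ne l i with rfl | hl
  · rw [Finsupp.single_eq_same]
    simp only [mem_insert, mem_singleton] at hi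
    rcases hi with rfl | rfl | rfl
    · rw [hb]; exact_mod_cast hj
    · rw [hb]; exact_mod_cast hj'
    · rw [hbl]; exact ENat.natCast_lt_top 1
  · rw [Finsupp.single_eq_of_ne hl]
    refine Fin.lastCases ?_ (fun j => ?_) l
    · rw [hbl]; exact ENat.natCast_lt_top 0
    · rw [hb]; exact_mod_cast hpos _

theorem card_up_le_add_one (hpos : ∀ i, 0 < a i) {d : ℕ}
    (hsum : ∑ i : Fin k, (a i.castSucc - 1) = d + 1) {S : Finset (Fin (k + 1) →₀ ℕ)}
    (hS : LexTop (bOf (k + 1) a) d S) : (up (bOf (k + 1) a) S).card ≤ S.card + 1 := by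
  classical
  have hone : ((box (bOf (k + 1) a) (d + 1)).filter fun w => w (Fin.last k) = 0).card ≤ 1 := by
    have hval : ∀ w ∈ (box (bOf (k + 1) a) (d + 1)).filter fun w => w (Fin.last k) = 0,
        ∀ i : Fin k, w i.castSucc = a i.castSucc - 1 := by
      intro w hw i
      obtain ⟨hw, hw0⟩ := mem_filter.1 hw
      obtain ⟨hdeg, hbox⟩ := mem_box.1 hw
      have hle := (inBox_bOf hpos).1 hbox
      rw [expDeg, Fin.sum_univ_castSucc, hw0, add_zero, ← hsum] at hdeg
      exact (sum_eq_sum_iff_of_le fun i _ => hle _).1 hdeg i (mem_univ i)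
    refine card_le_one.2 fun x hx y hy => Finsupp.ext fun i => ?_
    refine Fin.lastCases ?_ (fun j => ?_) i
    · rw [(mem_filter.1 hx).2, (mem_filter.1 hy).2]
    · rw [hval x hx, hval y hy]
  rw [← card_image_of_injective S (add_left_injective (Finsupp.single (Fin.last k) 1))]
  refine (card_le_card ?_).trans ((card_union_le _ _).trans (Nat.add_le_add_left hone _))
  intro w hw
  have hwbox := up_subset_box hS.1 hw
  rcases Nat.eq_zero_or_pos (w (Fin.last k)) with h0 | h0
  · exact mem_union_right _ (mem_filter.2 ⟨hwbox, h0⟩)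
  · refine mem_union_left _ (mem_image.2 ⟨w - Finsupp.single (Fin.last k) 1, ?_,
      sub_single_add h0⟩)
    obtain ⟨hwb, m, hm, i, rfl⟩ := mem_up.1 hw
    have hadd := congrArg expDeg (sub_single_add h0)
    have hmdeg := (mem_box.1 (hS.1 hm)).1
    refine hS.2 m hm _ (mem_box.2 ⟨?_, hwb.mono tsub_le_self⟩)
      (toLex_le_sub_last (i := i) (by simp) le_rfl h0
        fun j hj => absurd (Fin.le_last j) (not_le.2 hj))
    simp only [expDeg_add, expDeg_single] at hadd
    omega

theorem GrowthAt.of_sum_eq [Infinite K] {f : Fin (k + 1) → MvPolynomial (Fin (k + 1)) K}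
    (hf : ∀ i, (f i).IsHomogeneous (a i)) (hpos : ∀ i, 0 < a i) (hmono : Monotone a)
    (hreg : IsRegSeq f) (hsum : ∑ i : Fin k, (a i.castSucc - 1) = a (Fin.last k)) {d : ℕ}
    (hd : d + 1 = a (Fin.last k)) : GrowthAt f a d := by
  intro I hI hfI S hS hSI
  have hcI : seqIdeal f ≤ I := by
    rw [seqIdeal, Ideal.span_le]
    rintro _ ⟨i, rfl⟩
    exact hfI i
  rcases S.eq_empty_or_nonempty with rfl | hne
  · rw [show up (bOf (k + 1) a) ∅ = ∅ by simp [up], card_empty, zero_add]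
    exact hilb_mono hcI _
  rcases Nat.lt_or_ge (hilb I d) (hilb (⊤ : Ideal (MvPolynomial (Fin (k + 1)) K)) d)
    with hN | hN
  swap
  · have h1 := hilb_top_succ_le hN
    have h2 := hilb_seqIdeal le_rfl hf hpos hreg (d + 1)
    have h3 := card_le_card (up_subset_box hS.1)
    omega
  obtain ⟨hreg', hnzd⟩ := isRegSeq_succ_iff.1 hreg
  have hf' : ∀ i, (initSeq f i).IsHomogeneous (initSeq a i) := fun i => hf _
  have hpos' : ∀ i, 0 < initSeq a i := fun i => hpos _
  have hsum' : ∑ i, (initSeq a i - 1) = d + 1 := by rw [hd]; exact hsum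
  obtain ⟨w, hw0, hw⟩ := exists_nzd_of_lt hf' hpos' (Nat.lt_succ_self k) hreg'
  obtain ⟨H⟩ := exists_hyperplane hw0
  have hHreg := H.isRegSeq hf' hpos' hreg' hw
  have hHf : ∀ i, (H.π (initSeq f i)).IsHomogeneous (initSeq a i) := fun i => H.π_hom (hf' i)
  have hD : Dehomogenizes (Ideal.Quotient.mkₐ K (seqIdeal (initSeq f) ⊔
      Ideal.span {linForm w - 1})) (seqIdeal (initSeq f)) (linForm w) :=
    { surjective := Ideal.Quotient.mkₐ_surjective K _
      ker := fun p => by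
        rw [Ideal.Quotient.mkₐ_eq_mk, Ideal.Quotient.eq_zero_iff_mem, mem_sup_span_singleton]
      homog := isHomog_seqIdeal hf'
      hom := isHomogeneous_linForm w
      nzd := hw }
  have hc : seqIdeal f = seqIdeal (initSeq f) ⊔ Ideal.span {f (Fin.last k)} := seqIdeal_succ f
  have hlt := hilb_sup_span_singleton_of_lt (isHomog_seqIdeal hf') (hf (Fin.last k))
    (show d < a (Fin.last k) by omega)
  have heq := hilb_sup_span_singleton (isHomog_seqIdeal hf') (hf (Fin.last k))
    (last_ne_zero hf hpos hreg) hnzd 0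
  rw [← hc] at hlt heq
  rw [zero_add, ← hd] at heq
  have hz := hilb_seqIdeal (show k ≤ k + 1 by omega) hf' hpos' hreg' 0
  have hz1 := card_box_zero_le (bOf (k + 1) (initSeq a))
  have h1 := hilb_seqIdeal (show k ≤ k + 1 by omega) hf' hpos' hreg' 1
  have h3 := three_le_card_box hpos hmono hsum
  have hmain := hD.add_two_le_hilb H (d := d)
    (fun q e hq he => by
      rw [H.sect_seqIdeal]
      exact component_eq_top_of_lt hHf hpos' hHreg (by omega) hq)
    (fun q e e' hq hqc he => by
      rw [H.sect_seqIdeal] at hqc ⊢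
      exact exists_mul_notMem hHf hpos' hHreg hq hqc (by omega))
    (by omega) ((le_sup_left.trans hc.ge).trans hcI) (hd ▸ hf (Fin.last k)) (hfI _) hnzd
    (by have := hne.card_pos; omega) hN
  have hup := card_up_le_add_one hpos (by omega) hS
  omega

end Middle

end CavigliaDeStefani

namespace CavigliaDeStefani

open Finset MvPolynomial

section Induction

variable {K : Type*} [Field K]

theorem GrowthAt.of_initSeq {k : ℕ} {a : Fin (k + 1) → ℕ} (h : Growth K (k + 1) (initSeq a))
    {f : Fin (k + 1) → MvPolynomial (Fin (k + 1)) K} (hf : ∀ i, (f i).IsHomogeneous (a i))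
    (hreg : IsRegSeq f) {d : ℕ} (hd : d + 1 < a (Fin.last k)) : GrowthAt f a d := by
  intro I hI hfI S hS hSI
  have hf' : ∀ i, (initSeq f i).IsHomogeneous (initSeq a i) := fun i => hf _
  have htop : bOf (k + 1) (initSeq a) (Fin.last k) = ⊤ := by simp [bOf]
  have hb : bOf (k + 1) a =
      Function.update (bOf (k + 1) (initSeq a)) (Fin.last k) (a (Fin.last k) : ℕ∞) :=
    bOf_succ (Nat.lt_succ_self k) a
  have hbox : ∀ e, e < a (Fin.last k) → box (bOf (k + 1) a) e = box (bOf (k + 1) (initSeq a)) e :=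
    fun e he => by rw [hb, box_update_of_lt htop he]
  have hc : ∀ e, e < a (Fin.last k) → hilb (seqIdeal f) e = hilb (seqIdeal (initSeq f)) e :=
    fun e he => by
      rw [seqIdeal_succ f, hilb_sup_span_singleton_of_lt (isHomog_seqIdeal hf') (hf _) he]
  have hS' : LexTop (bOf (k + 1) (initSeq a)) d S := by
    rw [LexTop, ← hbox d (by omega)]; exact hS
  have hle : (up (bOf (k + 1) a) S).card ≤ (up (bOf (k + 1) (initSeq a)) S).card :=
    card_le_card fun w hw => by
      have h1 := up_subset_box hS.1 hw
      rw [hbox _ hd] at h1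
      exact mem_up.2 ⟨(mem_box.1 h1).2, (mem_up.1 hw).2⟩
  have := h I (initSeq f) hI (fun i => hfI _) (isRegSeq_succ_iff.1 hreg).1 hf' d S hS'
    (by rw [← hc d (by omega)]; exact hSI)
  rw [hc _ hd]
  omega

theorem Growth.self_succ [Infinite K] {k : ℕ} {a : Fin (k + 1) → ℕ} (hpos : ∀ i, 0 < a i)
    (hmono : Monotone a) (hsum : ∑ i : Fin k, (a i.castSucc - 1) ≤ a (Fin.last k))
    (h : Growth K (k + 1) (initSeq a)) : Growth K (k + 1) a := by
  intro I f hI hfI hreg hf d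
  revert I
  suffices GrowthAt f a d from fun I hI hfI S => this I hI hfI S
  have hlow : ∀ e, e + 1 < a (Fin.last k) → GrowthAt f a e := fun e he => .of_initSeq h hf hreg he
  have hs : ∑ i, (a i - 1) = ∑ i : Fin k, (a i.castSucc - 1) + (a (Fin.last k) - 1) :=
    Fin.sum_univ_castSucc _
  have hlast := hpos (Fin.last k)
  rcases Nat.lt_or_ge (d + 1) (a (Fin.last k)) with hd | hd
  · exact hlow d hd
  rcases Nat.lt_or_ge (∑ i, (a i - 1)) (d + 1) with hds | hds
  · intro I hI hfI S hS hSI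
    have h1 := up_subset_box hS.1
    rw [box_eq_empty hds, subset_empty] at h1
    rw [h1, card_empty, zero_add]
    refine hilb_mono ?_ _
    rw [seqIdeal, Ideal.span_le]
    rintro _ ⟨i, rfl⟩
    exact hfI i
  rcases Nat.lt_or_ge (∑ i, (a i - 1) - 1 - d + 1) (a (Fin.last k)) with hd' | hd'
  · exact .of_dual hf hpos hreg (by omega) (hlow _ hd')
  · exact .of_sum_eq hf hpos hmono hreg (by omega) (by omega)

theorem growth_of_infinite [Infinite K] {n r : ℕ} (hrn : r ≤ n) {a : Fin r → ℕ}
    (hpos : ∀ i, 0 < a i) (hmono : Monotone a)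
    (hgrowth : ∀ i : Fin r, ∑ j ∈ univ.filter (fun j : Fin r => j < i), (a j - 1) ≤ a i) :
    Growth K n a := by
  induction r generalizing n with
  | zero =>
    induction n with
    | zero =>
      intro I f hI hfI _ _ d S hS _
      have h1 : up (bOf 0 a) S = ∅ := eq_empty_of_forall_notMem fun w hw => by
        obtain ⟨-, m, -, i, -⟩ := mem_up.1 hw
        exact i.elim0
      rw [h1, card_empty, zero_add, seqIdeal_zero]
      exact hilb_mono bot_le _
    | succ n ih => exact (ih (Nat.zero_le n)).succ (Nat.zero_le n) hpos
  | succ k ihk =>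
    induction n, hrn using Nat.le_induction with
    | succ n hn ih => exact ih.succ hn hpos
    | base =>
      refine .self_succ hpos hmono ?_ (ihk (Nat.le_succ k) (fun i => hpos _)
        (fun i j hij => hmono (Fin.castSucc_le_castSucc_iff.2 hij)) fun i => ?_)
      · refine le_trans (le_of_eq ?_) (hgrowth (Fin.last k))
        rw [sum_filter, Fin.sum_univ_castSucc]
        simp [Fin.castSucc_lt_last]
      · refine le_trans (le_of_eq ?_) (hgrowth i.castSucc)
        rw [sum_filter, sum_filter, Fin.sum_univ_castSucc]
        simp [initSeq, (Fin.castSucc_lt_last i).not_gt]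

end Induction

end CavigliaDeStefani

namespace CavigliaDeStefani

open Finset MvPolynomial

section BaseChange

variable {K L : Type*} [Field K] [Field L] [Algebra K L] {n : ℕ}

/-- Apply a functional to each coefficient of a polynomial. -/
noncomputable def coeffMap (θ : L →ₗ[K] K) (p : MvPolynomial (Fin n) L) : MvPolynomial (Fin n) K :=
  ∑ m ∈ p.support, monomial m (θ (coeff m p))

@[simp] theorem coeff_coeffMap (θ : L →ₗ[K] K) (p : MvPolynomial (Fin n) L) (m : Fin n →₀ ℕ) :
    coeff m (coeffMap θ p) = θ (coeff m p) := by
  classical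
  simp only [coeffMap, coeff_sum, coeff_monomial, sum_ite_eq', mem_support_iff]
  split_ifs with h
  · rfl
  · rw [not_not.1 h, map_zero]

theorem coeffMap_add (θ : L →ₗ[K] K) (p q : MvPolynomial (Fin n) L) :
    coeffMap θ (p + q) = coeffMap θ p + coeffMap θ q := by
  ext m; simp

theorem coeffMap_zero (θ : L →ₗ[K] K) : coeffMap (n := n) θ 0 = 0 := by
  ext m; simp

theorem coeffMap_mul_map (θ : L →ₗ[K] K) (p : MvPolynomial (Fin n) L)
    (q : MvPolynomial (Fin n) K) :
    coeffMap θ (p * map (algebraMap K L) q) = coeffMap θ p * q := by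
  classical
  ext m
  rw [coeff_coeffMap, coeff_mul, coeff_mul, map_sum]
  refine sum_congr rfl fun x _ => ?_
  rw [coeff_map, coeff_coeffMap, mul_comm, ← Algebra.smul_def, map_smul, smul_eq_mul, mul_comm]

theorem isHomogeneous_coeffMap (θ : L →ₗ[K] K) {p : MvPolynomial (Fin n) L} {d : ℕ}
    (hp : p.IsHomogeneous d) : (coeffMap θ p).IsHomogeneous d := by
  refine isHomogeneous_iff_support.2 fun m hm => isHomogeneous_iff_support.1 hp m ?_
  rw [mem_support_iff, coeff_coeffMap] at hm
  exact mem_support_iff.2 fun h => hm (by rw [h, map_zero])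

theorem coeffMap_mem {I : Ideal (MvPolynomial (Fin n) K)} {p : MvPolynomial (Fin n) L}
    (hp : p ∈ I.map (map (algebraMap K L))) (θ : L →ₗ[K] K) : coeffMap θ p ∈ I := by
  suffices ∀ r, coeffMap θ (r * p) ∈ I by simpa using this 1
  refine Submodule.span_induction ?_ ?_ ?_ ?_ hp
  · rintro _ ⟨q, hq, rfl⟩ r
    rw [coeffMap_mul_map]
    exact I.mul_mem_left _ hq
  · intro r; rw [mul_zero, coeffMap_zero]; exact zero_mem _
  · intro x y _ _ hx hy r
    rw [mul_add, coeffMap_add]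
    exact add_mem (hx r) (hy r)
  · intro s x _ hx r
    rw [smul_eq_mul, ← mul_assoc]
    exact hx _

theorem eq_sum_coeffMap (p : MvPolynomial (Fin n) L) :
    ∃ J : Finset (Module.Basis.ofVectorSpaceIndex K L),
      p = ∑ j ∈ J, C (Module.Basis.ofVectorSpace K L j) *
        map (algebraMap K L) (coeffMap ((Module.Basis.ofVectorSpace K L).coord j) p) := by
  classical
  refine ⟨p.support.biUnion fun m => ((Module.Basis.ofVectorSpace K L).repr (coeff m p)).support,
    ?_⟩
  ext m
  simp only [coeff_sum, coeff_C_mul, coeff_map, coeff_coeffMap, Module.Basis.coord_apply]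
  by_cases hm : m ∈ p.support
  · conv_lhs => rw [← (Module.Basis.ofVectorSpace K L).linearCombination_repr (coeff m p)]
    rw [Finsupp.linearCombination_apply, Finsupp.sum_of_support_subset _
      (subset_biUnion_of_mem (fun m => ((Module.Basis.ofVectorSpace K L).repr
        (coeff m p)).support) hm) _ (by simp)]
    refine sum_congr rfl fun j _ => ?_
    rw [Algebra.smul_def, mul_comm]
  · rw [notMem_support_iff.1 hm]
    simp

theorem mem_map_of_coeffMap_mem {I : Ideal (MvPolynomial (Fin n) K)} {p : MvPolynomial (Fin n) L}
    (h : ∀ θ : L →ₗ[K] K, coeffMap θ p ∈ I) : p ∈ I.map (map (algebraMap K L)) := by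
  obtain ⟨J, hJ⟩ := eq_sum_coeffMap (K := K) p
  rw [hJ]
  exact sum_mem fun j _ => Ideal.mul_mem_left _ _ (Ideal.mem_map_of_mem _ (h _))

theorem isHomog_map {I : Ideal (MvPolynomial (Fin n) K)} (hI : IsHomog I) :
    IsHomog (I.map (map (algebraMap K L))) := by
  intro p hp d
  refine mem_map_of_coeffMap_mem fun θ => ?_
  convert hI _ (coeffMap_mem hp θ) d using 1
  ext m
  simp only [coeff_coeffMap, coeff_homogeneousComponent]
  split_ifs <;> simp

theorem isRegSeq_map {r : ℕ} {f : Fin r → MvPolynomial (Fin n) K} (hf : IsRegSeq f) :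
    IsRegSeq fun i => map (algebraMap K L) (f i) := by
  intro i g hg
  have h1 : {p | ∃ j : Fin r, j < i ∧ p = map (algebraMap K L) (f j)} =
      map (algebraMap K L) '' {p | ∃ j : Fin r, j < i ∧ p = f j} := by
    ext p
    constructor
    · rintro ⟨j, hj, rfl⟩; exact ⟨_, ⟨j, hj, rfl⟩, rfl⟩
    · rintro ⟨_, ⟨j, hj, rfl⟩, rfl⟩; exact ⟨j, hj, rfl⟩
  rw [h1, ← Ideal.map_span] at hg ⊢
  refine mem_map_of_coeffMap_mem fun θ => hf i _ ?_
  rw [← coeffMap_mul_map]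
  exact coeffMap_mem hg θ

theorem seqIdeal_map {r : ℕ} (f : Fin r → MvPolynomial (Fin n) K) :
    (seqIdeal fun i => map (algebraMap K L) (f i)) = (seqIdeal f).map (map (algebraMap K L)) := by
  rw [seqIdeal, seqIdeal, Ideal.map_span, ← Set.range_comp]; rfl

theorem hilb_map (I : Ideal (MvPolynomial (Fin n) K)) (d : ℕ) :
    hilb (I.map (map (algebraMap K L))) d = hilb I d := by
  let b := Module.finBasis K (component I d)
  have hmem : ∀ i, map (algebraMap K L) (b i : MvPolynomial (Fin n) K) ∈
      component (I.map (map (algebraMap K L))) d := fun i =>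
    mem_component.2 ⟨Ideal.mem_map_of_mem _ (b i).2.1, IsHomogeneous.map (b i).2.2 _⟩
  refine le_antisymm ?_ ?_
  · have hle : component (I.map (map (algebraMap K L))) d ≤
        Submodule.span L (Set.range fun i =>
          map (algebraMap K L) (b i : MvPolynomial (Fin n) K)) := by
      intro p hp
      obtain ⟨hpI, hpd⟩ := mem_component.1 hp
      obtain ⟨J, hJ⟩ := eq_sum_coeffMap (K := K) p
      rw [hJ]
      refine sum_mem fun j _ => ?_
      rw [← smul_eq_C_mul]
      refine Submodule.smul_mem _ _ ?_
      have h1 := b.sum_repr ⟨_, mem_component.2 ⟨coeffMap_mem hpI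
        ((Module.Basis.ofVectorSpace K L).coord j), isHomogeneous_coeffMap _ hpd⟩⟩
      have h2 : _ = coeffMap ((Module.Basis.ofVectorSpace K L).coord j) p :=
        congrArg Subtype.val h1
      rw [← h2, Submodule.coe_sum, map_sum]
      refine sum_mem fun i _ => ?_
      rw [Submodule.coe_smul, smul_eq_C_mul, map_mul, map_C, ← smul_eq_C_mul]
      exact Submodule.smul_mem _ _ (Submodule.subset_span ⟨i, rfl⟩)
    have := FiniteDimensional.span_of_finite L (Set.finite_range fun i =>
      map (algebraMap K L) (b i : MvPolynomial (Fin n) K))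
    exact ((Submodule.finrank_mono hle).trans (finrank_range_le_card _)).trans
      (Fintype.card_fin _).le
  · have hli : LinearIndependent L fun i =>
        (⟨_, hmem i⟩ : component (I.map (map (algebraMap K L))) d) := by
      rw [Fintype.linearIndependent_iff]
      intro g hg i
      have hθ : ∀ θ : L →ₗ[K] K, θ (g i) = 0 := by
        intro θ
        have hb := Fintype.linearIndependent_iff.1 b.linearIndependent (fun i => θ (g i)) ?_ i
        · exact hb
        · apply Subtype.ext
          ext m
          have h1 := congrArg (fun x : component (I.map (map (algebraMap K L))) d =>
            coeff m (x : MvPolynomial (Fin n) L)) hg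
          simp only [Submodule.coe_sum, Submodule.coe_smul, coeff_sum, coeff_smul, coeff_map,
            Submodule.coe_zero, coeff_zero, smul_eq_mul] at h1 ⊢
          have h2 := congrArg θ h1
          rw [map_sum, map_zero] at h2
          rw [← h2]
          refine sum_congr rfl fun j _ => ?_
          rw [mul_comm (g j), ← Algebra.smul_def, map_smul, smul_eq_mul, mul_comm]
      refine (Module.Basis.ofVectorSpace K L).ext_elem fun j => ?_
      rw [map_zero]
      exact hθ ((Module.Basis.ofVectorSpace K L).coord j)
    have := hli.fintype_card_le_finrank
    rwa [Fintype.card_fin] at this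

theorem Growth.of_algebra {r : ℕ} {a : Fin r → ℕ} (h : Growth L n a) : Growth K n a := by
  intro I f hI hfI hreg hf d S hS hSI
  have := h _ _ (isHomog_map hI) (fun i => Ideal.mem_map_of_mem _ (hfI i)) (isRegSeq_map hreg)
    (fun i => (hf i).map _) d S hS
  simp only [seqIdeal_map, hilb_map] at this
  exact this hSI

end BaseChange

end CavigliaDeStefani

namespace CavigliaDeStefani

open Finset MvPolynomial

section LexPlusPowers

variable {K : Type*} [Field K] {n r : ℕ}

theorem isLPP_blockIdeal (hrn : r ≤ n) {a : Fin r → ℕ} {d : ℕ} {S : Finset (Fin n →₀ ℕ)}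
    (hS : LexTop (bOf n a) d S) : IsLPP hrn a (blockIdeal K hS.1) := by
  refine ⟨isHomog_of_mem_iff (mem_blockIdeal hS.1), fun e => ⟨{m | expDeg m = e ∧
    ∃ s ∈ blockSet (bOf n a) d S, InBox (bOf n a) s ∧ expDeg s = e ∧ lexLe s m}, ?_, ?_⟩⟩
  · refine ⟨fun m hm => hm.1, ?_⟩
    rintro m ⟨-, s, hs, hsb, hse, hsm⟩ m' hm' hmm'
    rw [lexLe_iff] at hsm hmm'
    exact ⟨hm', s, hs, hsb, hse, (lexLe_iff).2 (hsm.trans hmm')⟩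
  · have hc : purePowers K hrn a = seqIdeal (powSeq K hrn a) := rfl
    rw [hc]
    apply le_antisymm
    · intro p hp
      obtain ⟨hpJ, hpe⟩ := mem_component.1 hp
      rw [p.as_sum]
      refine sum_mem fun m hm => ?_
      have hme := isHomogeneous_iff_support.1 hpe m hm
      by_cases hmb : InBox (bOf n a) m
      · rw [← mul_one (coeff m p), ← smul_eq_mul, ← smul_monomial]
        exact Submodule.mem_sup_left (Submodule.smul_mem _ _ (Submodule.subset_span
          ⟨m, ⟨hme, m, (mem_blockIdeal hS.1 p).1 hpJ m hm, hmb, hme, Or.inl rfl⟩, rfl⟩))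
      · refine Submodule.mem_sup_right (mem_component.2 ⟨?_, isHomogeneous_monomial _
          (by rw [← expDeg_eq_degree, hme])⟩)
        refine (mem_seqIdeal_powSeq hrn a _).2 fun m' hm' => ?_
        rw [mem_singleton.1 (support_monomial_subset hm')]
        exact hmb
    · refine sup_le (Submodule.span_le.2 ?_) (component_mono (fun p hp =>
        (mem_blockIdeal hS.1 p).2 fun m hm => Or.inl ((mem_seqIdeal_powSeq hrn a p).1 hp m hm)) e)
      rintro _ ⟨m, ⟨hme, s, hs, hsb, hse, hsm⟩, rfl⟩
      refine mem_component.2 ⟨(mem_blockIdeal hS.1 _).2 fun m' hm' => ?_,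
        isHomogeneous_monomial _ (by rw [← expDeg_eq_degree, hme])⟩
      rw [mem_singleton.1 (support_monomial_subset hm')]
      rw [lexLe_iff] at hsm
      by_cases hmb : InBox (bOf n a) m
      swap
      · exact Or.inl hmb
      rcases hs with hs | hs | hs | hs
      · exact absurd hsb hs
      · have := (mem_box.1 (hS.1 hs)).1
        exact Or.inr (Or.inl (hS.2 s hs m (mem_box.2 ⟨by omega, hmb⟩) hsm))
      · have := (mem_box.1 (hS.up.1 hs)).1
        exact Or.inr (Or.inr (Or.inl (hS.up.2 s hs m (mem_box.2 ⟨by omega, hmb⟩) hsm)))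
      · exact Or.inr (Or.inr (Or.inr (by omega)))

theorem Growth.egh {a : Fin r → ℕ} (h : Growth K n a) (hrn : r ≤ n) (hpos : ∀ i, 0 < a i)
    {I : Ideal (MvPolynomial (Fin n) K)} (hI : IsHomog I) (hreg : ContainsRegSeq a I) :
    EGH hrn a I := by
  obtain ⟨f, hfI, hf, hfa⟩ := hreg
  intro d
  have hcI : seqIdeal f ≤ I := by
    rw [seqIdeal, Ideal.span_le]
    rintro _ ⟨i, rfl⟩
    exact hfI i
  have h0 := hilb_seqIdeal hrn hfa hpos hf d
  have h1 := hilb_seqIdeal hrn hfa hpos hf (d + 1)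
  have hle := hilb_mono hcI d
  have hle' := hilb_mono (le_top : I ≤ ⊤) d
  obtain ⟨S, hS, hcard⟩ := exists_isTop (toLex : (Fin n →₀ ℕ) → Lex (Fin n →₀ ℕ))
    (box (bOf n a) d) (injOn_toLex _) (k := hilb I d - hilb (seqIdeal f) d) (by omega)
  have h2 := hilb_blockIdeal_self (K := K) hS.1
  have h3 := hilb_blockIdeal_succ (K := K) hS.1
  have h4 := h I f hI hfI hf hfa d S hS (by omega)
  exact ⟨_, isLPP_blockIdeal hrn hS, by omega, by omega⟩

theorem sum_filter_lt_le {a : Fin r → ℕ} (hmono : Monotone a)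
    (hgrowth : ∀ i : Fin r, 2 ≤ (i : ℕ) →
      ∑ j ∈ univ.filter (fun j : Fin r => j < i), (a j - 1) ≤ a i) (i : Fin r) :
    ∑ j ∈ univ.filter (fun j : Fin r => j < i), (a j - 1) ≤ a i := by
  rcases Nat.lt_or_ge (i : ℕ) 2 with hi | hi
  swap
  · exact hgrowth i hi
  have hcard : (univ.filter fun j : Fin r => j < i).card ≤ 1 := by
    rw [filter_gt_eq_Iio, Fin.card_Iio]; omega
  calc _ ≤ ∑ j ∈ univ.filter (fun j : Fin r => j < i), a i := sum_le_sum fun j hj =>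
        (Nat.sub_le _ _).trans (hmono (mem_filter.1 hj).2.le)
    _ ≤ a i := by rw [sum_const, smul_eq_mul]; nlinarith

end LexPlusPowers

end CavigliaDeStefani

/-- **Caviglia–De Stefani.** If `I ⊆ K[x_1,…,x_n]` is a homogeneous ideal containing a
homogeneous regular sequence of degree `a = (a_1,…,a_r)` with
`a_i ≥ Σ_{j=1}^{i−1} (a_j − 1)` for all `i ≥ 3`, then `I` satisfies `EGH_a`.
(Indices below are 0-based: `i ≥ 3` becomes `2 ≤ i`.) -/
theorem caviglia_destefani {K : Type*} [Field K] {n r : ℕ} (hrn : r ≤ n)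
    (a : Fin r → ℕ) (hpos : ∀ i, 0 < a i) (hmono : Monotone a)
    (hgrowth : ∀ i : Fin r, 2 ≤ (i : ℕ) →
      ∑ j ∈ Finset.univ.filter (fun j : Fin r => j < i), (a j - 1) ≤ a i)
    (I : Ideal (MvPolynomial (Fin n) K)) (hI : IsHomog I)
    (hreg : ContainsRegSeq a I) : EGH hrn a I := by
  exact (CavigliaDeStefani.growth_of_infinite (K := AlgebraicClosure K) hrn hpos hmono
    (CavigliaDeStefani.sum_filter_lt_le hmono hgrowth)).of_algebra.egh hrn hpos hI hreg
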